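/- For graphs G₁ = (V₁,E₁) and G₂ = (V₂,E₂) and their Cartesian product G = G₁ □ G₂, the sorting number satisfies st(G) = O(min(log|V₁| · (rt(G) + st(G₂)), log|V₂| · (rt(G) + st(G₁)))). -/

import Mathlib

open Finset

variable {V : Type*}

/-- A stage of a sorting network on a graph `G`: a finite set of vertex-disjoint
edges of `G`, each either directed (compare-exchange) or undirected (swap). -/
structure Stage {V : Type*} (G : SimpleGraph V) where
  pairs : Finset (V × V)
  adj : ∀ p ∈ pairs, G.Adj p.1 p.2
  directed : V × V → Bool
  disj : ∀ p ∈ pairs, ∀ q ∈ pairs, p ≠ q →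
    p.1 ≠ q.1 ∧ p.1 ≠ q.2 ∧ p.2 ≠ q.1 ∧ p.2 ≠ q.2

open scoped Classical in
/-- Apply a stage to a configuration of keys `f : V → ℕ`.  For a directed pair
`(u,v)` the smaller key goes to `u` and the larger to `v`; an undirected pair
unconditionally swaps its keys. -/
noncomputable def Stage.apply {G : SimpleGraph V} (s : Stage G) (f : V → ℕ) (v : V) : ℕ :=
  if h1 : ∃ p, p ∈ s.pairs ∧ p.1 = v then
    (if s.directed h1.choose then min (f h1.choose.1) (f h1.choose.2) else f h1.choose.2)
  else if h2 : ∃ p, p ∈ s.pairs ∧ p.2 = v then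
    (if s.directed h2.choose then max (f h2.choose.1) (f h2.choose.2) else f h2.choose.1)
  else f v

noncomputable def runNetwork {G : SimpleGraph V} (L : List (Stage G)) (f : V → ℕ) : V → ℕ :=
  L.foldl (fun g s => s.apply g) f

/-- `L` is a sorting network on `(G, π)`: for every injective assignment of keys,
after running all stages, the key at a vertex of smaller `π`-rank is smaller. -/
def IsSortingNetwork {n : ℕ} (G : SimpleGraph V) (π : V ≃ Fin n) (L : List (Stage G)) : Prop :=
  ∀ f : V → ℕ, Function.Injective f →
    ∀ u w : V, π u < π w → runNetwork L f u < runNetwork L f w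

/-- Minimal depth of a sorting network on `(G, π)`. -/
noncomputable def stP {n : ℕ} (G : SimpleGraph V) (π : V ≃ Fin n) : ℕ :=
  sInf {t | ∃ L : List (Stage G), L.length = t ∧ IsSortingNetwork G π L}

/-- The sorting number of `G` : the minimum over sorted orders `π` of the
minimal depth of a sorting network on `(G, π)`. -/
noncomputable def st [Fintype V] (G : SimpleGraph V) : ℕ :=
  sInf {t | ∃ π : V ≃ Fin (Fintype.card V), ∃ L : List (Stage G),
    L.length = t ∧ IsSortingNetwork G π L}

/-- A matching step: an involution of the vertices moving pebbles only along edges. -/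
def IsMatchingStep (G : SimpleGraph V) (σ : Equiv.Perm V) : Prop :=
  (∀ v, σ (σ v) = v) ∧ ∀ v, σ v ≠ v → G.Adj v (σ v)

/-- Position of a pebble starting at `v` after applying the matching steps in `L`. -/
def finalPos (L : List (Equiv.Perm V)) (v : V) : V :=
  L.foldl (fun p σ => σ p) v

/-- `t` matching steps of `G` suffice to route every pebble from `v` to `σ v`. -/
def RoutesIn (G : SimpleGraph V) (σ : Equiv.Perm V) (t : ℕ) : Prop :=
  ∃ L : List (Equiv.Perm V), L.length = t ∧ (∀ τ ∈ L, IsMatchingStep G τ) ∧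
    ∀ v, finalPos L v = σ v

/-- Routing time of the permutation `σ` on `G`. -/
noncomputable def rtP (G : SimpleGraph V) (σ : Equiv.Perm V) : ℕ :=
  sInf {t | RoutesIn G σ t}

/-- The routing number of `G`. -/
noncomputable def rt [Fintype V] [DecidableEq V] (G : SimpleGraph V) : ℕ :=
  Finset.univ.sup fun σ : Equiv.Perm V => rtP G σ

namespace AKS

/-! ### Expanders -/

/-- Number of permutations mapping `S` into `T`. -/
noncomputable def permCount (m : ℕ) (S T : Finset (Fin m)) : ℕ :=
  (Finset.univ.filter fun π : Equiv.Perm (Fin m) => ∀ a ∈ S, π a ∈ T).card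

lemma permCount_insert (m : ℕ) (S T : Finset (Fin m)) (a : Fin m) (ha : a ∉ S) :
    permCount m (insert a S) T * (m - S.card) ≤ permCount m S T * (T.card - S.card) := by
  classical
  unfold permCount
  have h1 : (m - S.card) = (Sᶜ).card := by rw [Finset.card_compl, Fintype.card_fin]
  rw [h1, ← Finset.card_product]
  have key : ∀ π : Equiv.Perm (Fin m), (∀ x ∈ S, π x ∈ T) →
      ((Sᶜ).filter fun b => π b ∈ T).card = T.card - S.card := by
    intro π hπ
    have : ((Sᶜ).filter fun b => π b ∈ T) = (T \ S.map π.toEmbedding).map π.symm.toEmbedding := by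
      ext b
      simp only [mem_filter, mem_compl, mem_map_equiv, mem_sdiff]
      simp
      tauto
    rw [this, card_map, card_sdiff_of_subset, card_map]
    intro y hy
    simp only [mem_map] at hy
    obtain ⟨x, hx, rfl⟩ := hy
    exact hπ x hx
  have h2 : (Finset.univ.filter fun π : Equiv.Perm (Fin m) => ∀ x ∈ S, π x ∈ T).card
      * (T.card - S.card) =
      ((Finset.univ.filter fun π : Equiv.Perm (Fin m) => ∀ x ∈ S, π x ∈ T).sigma
        (fun π => (Sᶜ).filter fun b => π b ∈ T)).card := by
    rw [Finset.card_sigma, Finset.sum_const_nat]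
    intro π hπ
    exact key π (by simpa using hπ)
  rw [h2]
  apply Finset.card_le_card_of_injOn (fun p => ⟨p.1 * Equiv.swap a p.2, p.2⟩)
  · rintro ⟨π, b⟩ hp
    simp only [coe_product, Set.mem_prod, mem_coe, mem_filter, mem_univ, true_and, mem_compl,
      mem_insert, forall_eq_or_imp, mem_sigma] at hp ⊢
    obtain ⟨⟨hpa, hpS⟩, hb⟩ := hp
    refine ⟨?_, hb, ?_⟩
    · intro x hx
      rw [Equiv.Perm.mul_apply, Equiv.swap_apply_of_ne_of_ne]
      · exact hpS x hx
      · rintro rfl; exact ha hx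
      · rintro rfl; exact hb hx
    · simpa [Equiv.Perm.mul_apply] using hpa
  · rintro ⟨π, b⟩ _ ⟨π', b'⟩ _ h
    simp only [Sigma.mk.injEq, heq_eq_eq] at h
    obtain ⟨h, rfl⟩ := h
    simpa using h

lemma permCount_bound (m : ℕ) (T : Finset (Fin m)) (S : Finset (Fin m)) :
    permCount m S T * m ^ S.card ≤ m.factorial * T.card ^ S.card := by
  classical
  induction S using Finset.induction_on with
  | empty =>
    simp only [permCount]
    simp [Fintype.card_perm]
  | insert a S ha ih =>
    have h := permCount_insert m S T a ha
    rw [card_insert_of_notMem ha]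
    have hS : S.card < m := by
      have := Finset.card_lt_univ_of_notMem ha
      simpa using this
    have hT : T.card ≤ m := by simpa using T.card_le_univ
    set N' := permCount m (insert a S) T
    set N := permCount m S T
    have h3 : N' * m ≤ N * T.card := by
      have hpos : 0 < m - S.card := by omega
      apply Nat.le_of_mul_le_mul_right _ hpos
      have h4 : (T.card - S.card) * m ≤ T.card * (m - S.card) := by
        rw [Nat.sub_mul, Nat.mul_sub]
        have : T.card * S.card ≤ S.card * m := by nlinarith
        omega
      calc N' * m * (m - S.card) = N' * (m - S.card) * m := by ring
        _ ≤ N * (T.card - S.card) * m := Nat.mul_le_mul_right _ h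
        _ = N * ((T.card - S.card) * m) := by ring
        _ ≤ N * (T.card * (m - S.card)) := Nat.mul_le_mul_left _ h4
        _ = _ := by ring
    calc N' * m ^ (S.card + 1) = (N' * m) * m ^ S.card := by ring
      _ ≤ N * T.card * m ^ S.card := Nat.mul_le_mul_right _ h3
      _ = N * m ^ S.card * T.card := by ring
      _ ≤ m.factorial * T.card ^ S.card * T.card := Nat.mul_le_mul_right _ ih
      _ = _ := by ring

lemma choose_le_exp (m s : ℕ) (hs : 0 < s) :
    (m.choose s : ℝ) ≤ (Real.exp 1 * m / s) ^ s := by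
  have h1 := Nat.choose_le_pow_div (α := ℝ) s m
  have h2 := Real.pow_div_factorial_le_exp (x := (s:ℝ)) (by positivity) s
  have hf : (0:ℝ) < s.factorial := by positivity
  have hs' : (0:ℝ) < s := by exact_mod_cast hs
  rw [div_le_iff₀ hf] at h2
  refine h1.trans ?_
  rw [div_pow, mul_pow, ← Real.exp_nat_mul, mul_one, div_le_div_iff₀ hf (by positivity)]
  calc (m:ℝ)^s * (s:ℝ)^s ≤ (m:ℝ)^s * (Real.exp s * s.factorial) := by gcongr
    _ = _ := by ring

lemma num_bound (q : ℕ) (hq : 1 ≤ q) : ∃ c : ℕ, ∀ m s t : ℕ, 1 ≤ s → 1 ≤ t → t ≤ q * s →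
    (q + 1) * t ≤ q * m →
    (m.choose s : ℝ) * (m.choose t) * (((t:ℝ) / m) ^ s) ^ c ≤ (1/4) ^ s := by
  have hq' : (0:ℝ) < q := by exact_mod_cast hq
  have hlt : (q:ℝ) / (q+1) < 1 := by rw [div_lt_one (by positivity)]; linarith
  obtain ⟨c', hc'⟩ := exists_pow_lt_of_lt_one
    (show (0:ℝ) < 1 / (4 * (q * Real.exp 1 ^ (q+1))) by positivity) hlt
  refine ⟨q + 1 + c', ?_⟩
  intro m s t hs ht hts htm
  have hs' : (0:ℝ) < s := by exact_mod_cast hs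
  have ht' : (0:ℝ) < t := by exact_mod_cast ht
  have hm : 0 < m := by
    rcases Nat.eq_zero_or_pos m with h | h
    · subst h; nlinarith
    · exact h
  have hm' : (0:ℝ) < m := by exact_mod_cast hm
  have hts' : (t:ℝ) ≤ q * s := by exact_mod_cast hts
  have htm' : ((q:ℝ) + 1) * t ≤ q * m := by exact_mod_cast htm
  set x : ℝ := (t:ℝ)/m with hx
  have hx0 : 0 < x := by positivity
  have hxq : x ≤ q/(q+1) := by
    rw [hx, div_le_div_iff₀ hm' (by positivity)]; linarith
  have hx1 : x ≤ 1 := hxq.trans hlt.le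
  have e1 : 1 ≤ Real.exp 1 := Real.one_le_exp (by norm_num)
  have b1 : (m.choose s : ℝ) ≤ (Real.exp 1 * q * x⁻¹) ^ s := by
    refine (choose_le_exp m s hs).trans ?_
    apply pow_le_pow_left₀ (by positivity)
    rw [hx, inv_div, mul_div_assoc, mul_assoc]
    apply mul_le_mul_of_nonneg_left _ (by positivity)
    rw [← mul_div_assoc, div_le_div_iff₀ hs' ht']
    nlinarith
  have b2 : (m.choose t : ℝ) ≤ (Real.exp 1 * x⁻¹) ^ (q*s) := by
    refine (choose_le_exp m t ht).trans ?_
    rw [hx, inv_div, mul_div_assoc]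
    apply pow_le_pow_right₀ _ hts
    have : 1 ≤ x⁻¹ := by rw [one_le_inv₀ hx0]; exact hx1
    rw [hx, inv_div] at this
    nlinarith
  have h0 : (0:ℝ) ≤ (x ^ s) ^ (q+1+c') := by positivity
  calc (m.choose s : ℝ) * (m.choose t) * (x ^ s) ^ (q+1+c')
      ≤ (Real.exp 1 * q * x⁻¹) ^ s * (Real.exp 1 * x⁻¹) ^ (q*s) * (x ^ s) ^ (q+1+c') := by
        gcongr
    _ = (q * Real.exp 1 ^ (q+1) * x ^ c') ^ s := by
        have : (x ^ s) ^ (q+1+c') = (x ^ (q+1+c')) ^ s := by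
          rw [← pow_mul, ← pow_mul, mul_comm]
        rw [this, pow_mul, ← mul_pow, ← mul_pow]
        congr 1
        have hxx : x⁻¹ * x = 1 := inv_mul_cancel₀ hx0.ne'
        have : (x⁻¹)^q * x ^ q = 1 := by rw [← mul_pow, hxx, one_pow]
        rw [mul_pow, pow_add, pow_add, pow_one, pow_add, pow_one]
        calc _ = q * (Real.exp 1 ^ q * Real.exp 1) * x^c' * (x⁻¹ * x) * (x⁻¹^q * x^q) := by ring
          _ = _ := by rw [hxx, this]; ring
    _ ≤ (1/4)^s := by
        apply pow_le_pow_left₀ (by positivity)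
        have h5 : x ^ c' ≤ (q/(q+1):ℝ)^c' := pow_le_pow_left₀ hx0.le hxq _
        have h6 : x ^ c' ≤ 1 / (4 * (q * Real.exp 1 ^ (q+1))) := h5.trans hc'.le
        rw [le_div_iff₀ (by positivity)] at h6
        nlinarith

/-- Expansion property of a family of permutations. -/
def Expands {m c : ℕ} (q : ℕ) (π : Fin c → Equiv.Perm (Fin m)) : Prop :=
  ∀ S T : Finset (Fin m), S.Nonempty → (∀ i, ∀ a ∈ S, π i a ∈ T) → T.card ≤ q * S.card →
    m < T.card + S.card

open scoped Classical in
lemma bad_count (q c m : ℕ)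
    (hc : ∀ m s t : ℕ, 1 ≤ s → 1 ≤ t → t ≤ q * s → (q + 1) * t ≤ q * m →
      (m.choose s : ℝ) * (m.choose t) * (((t:ℝ) / m) ^ s) ^ (c) ≤ (1/4) ^ s) (hc0 : 0 < c) :
    3 * (((Finset.univ.filter fun π : Fin c → Equiv.Perm (Fin m) => ¬ Expands q π).card : ℕ) : ℝ)
      ≤ (m.factorial : ℝ) ^ c := by
  let tt : ℕ → ℕ := fun s => min (q * s) (m - s)
  let B : Finset (Fin m) × Finset (Fin m) → Finset (Fin c → Equiv.Perm (Fin m)) := fun p =>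
    Fintype.piFinset fun _ => Finset.univ.filter fun π : Equiv.Perm (Fin m) => ∀ a ∈ p.1, π a ∈ p.2
  have hsub : (Finset.univ.filter fun π : Fin c → Equiv.Perm (Fin m) => ¬ Expands q π) ⊆
      (Finset.Icc 1 m).biUnion fun s =>
        ((univ : Finset (Fin m)).powersetCard s ×ˢ (univ : Finset (Fin m)).powersetCard (tt s)).biUnion
          B := by
    intro π hπ
    replace hπ := (mem_filter.mp hπ).2
    unfold Expands at hπ
    push Not at hπ
    obtain ⟨S, T, hS, hST, hT, hm⟩ := hπ
    simp only [mem_biUnion, mem_Icc, mem_product, mem_powersetCard, subset_univ, true_and]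
    have hT2 : T.card ≤ tt S.card := by simp only [tt]; apply le_min hT; omega
    have htm : tt S.card ≤ (univ : Finset (Fin m)).card := by
      simp only [tt, card_univ, Fintype.card_fin]; exact (min_le_right _ _).trans (Nat.sub_le _ _)
    obtain ⟨T', hTT', -, hT'⟩ := Finset.exists_subsuperset_card_eq (subset_univ T) hT2 htm
    refine ⟨S.card, ⟨hS.card_pos, by simpa using S.card_le_univ⟩, (S, T'), ⟨rfl, hT'⟩, ?_⟩
    simp only [B, Fintype.mem_piFinset, mem_filter, mem_univ, true_and]
    exact fun i a ha => hTT' (hST i a ha)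
  have h1 : ((Finset.univ.filter fun π : Fin c → Equiv.Perm (Fin m) => ¬ Expands q π).card : ℝ) ≤
      ∑ s ∈ Finset.Icc 1 m, (1/4:ℝ)^s * (m.factorial : ℝ)^c := by
    refine (Nat.cast_le.mpr ((card_le_card hsub).trans card_biUnion_le)).trans ?_
    rw [Nat.cast_sum]
    apply Finset.sum_le_sum
    intro s hs
    rw [mem_Icc] at hs
    refine (Nat.cast_le.mpr card_biUnion_le).trans ?_
    rw [Nat.cast_sum]
    have hm : 0 < m := by omega
    have hm' : (0:ℝ) < m := by exact_mod_cast hm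
    have hB : ∀ p ∈ ((univ : Finset (Fin m)).powersetCard s ×ˢ
        (univ : Finset (Fin m)).powersetCard (tt s)),
        ((B p).card : ℝ) ≤ (m.factorial * ((tt s : ℝ)/m)^s)^c := by
      rintro ⟨S, T⟩ hp
      simp only [mem_product, mem_powersetCard, subset_univ, true_and] at hp
      have hb := permCount_bound m T S
      rw [hp.1, hp.2] at hb
      have : (B (S,T)).card = (permCount m S T)^c := by
        simp only [B, Fintype.card_piFinset, permCount]
        simp
      rw [this, Nat.cast_pow]
      apply pow_le_pow_left₀ (by positivity)
      rw [div_pow, ← mul_div_assoc, le_div_iff₀ (by positivity)]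
      exact_mod_cast hb
    refine (Finset.sum_le_sum hB).trans ?_
    rw [sum_const, nsmul_eq_mul, card_product, card_powersetCard, card_powersetCard]
    simp only [card_univ, Fintype.card_fin]
    rcases Nat.eq_zero_or_pos (tt s) with h0 | h0
    · rw [h0]
      have : ((m.factorial:ℝ) * (((0:ℕ):ℝ)/m)^s)^c = 0 := by
        rw [Nat.cast_zero, zero_div, zero_pow (by omega), mul_zero, zero_pow (by omega)]
      rw [this, mul_zero]; positivity
    · have h2 : tt s ≤ q * s := min_le_left _ _
      have h3 : tt s ≤ m - s := min_le_right _ _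
      have h4 : (q+1) * tt s ≤ q * m := by
        have : q * tt s ≤ q * (m - s) := Nat.mul_le_mul_left _ h3
        have h5 : q * (m - s) + q * s = q * m := by rw [← Nat.mul_add]; congr 1; omega
        nlinarith
      have := hc m s (tt s) hs.1 h0 h2 h4
      rw [mul_pow, Nat.cast_mul]
      have hf : (0:ℝ) ≤ (m.factorial:ℝ)^c := by positivity
      calc _ = (m.factorial:ℝ)^c * ((m.choose s : ℝ) * (m.choose (tt s)) * (((tt s:ℝ) / m) ^ s) ^ c) := by
            ring
        _ ≤ (m.factorial:ℝ)^c * (1/4)^s := by gcongr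
        _ = _ := by ring
  have h2 : ∀ k : ℕ, ∑ s ∈ Finset.Icc 1 k, (1/4:ℝ)^s ≤ 1/3 - (1/3) * (1/4)^k := by
    intro k
    induction k with
    | zero => simp
    | succ k ih =>
      rw [Finset.sum_Icc_succ_top (by omega), pow_succ]
      linarith
  rw [← Finset.sum_mul] at h1
  have h3 : ∑ s ∈ Finset.Icc 1 m, (1/4:ℝ)^s ≤ 1/3 := by
    have := h2 m
    have : (0:ℝ) ≤ (1/3) * (1/4)^m := by positivity
    linarith [h2 m]
  have hf : (0:ℝ) ≤ (m.factorial:ℝ)^c := by positivity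
  nlinarith

lemma exists_expander (q : ℕ) (hq : 1 ≤ q) : ∃ c : ℕ, ∀ m : ℕ,
    ∃ π : Fin c → Equiv.Perm (Fin m), Expands q π ∧ Expands q (fun i => (π i)⁻¹) := by
  classical
  obtain ⟨c0, hc0⟩ := num_bound q hq
  refine ⟨c0 + 1, fun m => ?_⟩
  have hc : ∀ m s t : ℕ, 1 ≤ s → 1 ≤ t → t ≤ q * s → (q + 1) * t ≤ q * m →
      (m.choose s : ℝ) * (m.choose t) * (((t:ℝ) / m) ^ s) ^ (c0+1) ≤ (1/4) ^ s := by
    intro m s t h1 h2 h3 h4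
    refine le_trans ?_ (hc0 m s t h1 h2 h3 h4)
    apply mul_le_mul_of_nonneg_left _ (by positivity)
    apply pow_le_pow_of_le_one (by positivity)
    · apply pow_le_one₀ (by positivity)
      apply div_le_one_of_le₀ _ (by positivity)
      have : q * t ≤ q * m := by nlinarith
      exact_mod_cast Nat.le_of_mul_le_mul_left this hq
    · omega
  have hb := bad_count q (c0+1) m hc (by omega)
  by_contra hcon
  push Not at hcon
  set Bad := Finset.univ.filter fun π : Fin (c0+1) → Equiv.Perm (Fin m) => ¬ Expands q π with hBad
  have hcov : (Finset.univ : Finset (Fin (c0+1) → Equiv.Perm (Fin m))) ⊆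
      Bad ∪ Bad.image (fun π i => (π i)⁻¹) := by
    intro π _
    rw [mem_union, mem_image]
    by_cases h : Expands q π
    · right
      refine ⟨fun i => (π i)⁻¹, ?_, ?_⟩
      · simp only [hBad, mem_filter, mem_univ, true_and]
        exact hcon π h
      · funext i; simp
    · left
      simp only [hBad, mem_filter, mem_univ, true_and]
      exact h
  have h1 := (card_le_card hcov).trans ((card_union_le _ _).trans
    (Nat.add_le_add_left (card_image_le) _))
  have h2 : (univ : Finset (Fin (c0+1) → Equiv.Perm (Fin m))).card = m.factorial ^ (c0+1) := by
    simp [Fintype.card_perm]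
  rw [h2] at h1
  have h3 : ((m.factorial:ℝ))^(c0+1) ≤ (Bad.card:ℝ) + Bad.card := by exact_mod_cast h1
  have h4 : (0:ℝ) < (m.factorial:ℝ)^(c0+1) := by positivity
  nlinarith

end AKS

namespace AKS

/-- An abstract comparator stage on wires `W`. -/
structure CStage (W : Type*) where
  σ : W → W
  inv : ∀ v, σ (σ v) = v
  lo : W → Bool
  hlo : ∀ v, σ v ≠ v → lo (σ v) = !lo v

variable {W : Type*} {α β : Type*} [LinearOrder α] [LinearOrder β]

def CStage.apply (s : CStage W) (g : W → α) (v : W) : α :=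
  if s.lo v then min (g v) (g (s.σ v)) else max (g v) (g (s.σ v))

def crun (L : List (CStage W)) (g : W → α) : W → α :=
  L.foldl (fun g s => s.apply g) g

@[simp] lemma crun_nil (g : W → α) : crun ([] : List (CStage W)) g = g := rfl
@[simp] lemma crun_cons (s : CStage W) (L : List (CStage W)) (g : W → α) :
    crun (s :: L) g = crun L (s.apply g) := rfl
lemma crun_append (L L' : List (CStage W)) (g : W → α) :
    crun (L ++ L') g = crun L' (crun L g) := by
  simp [crun, List.foldl_append]

lemma CStage.apply_mono (s : CStage W) {φ : α → β} (hφ : Monotone φ) (g : W → α) (v : W) :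
    s.apply (fun w => φ (g w)) v = φ (s.apply g v) := by
  unfold CStage.apply
  split_ifs
  · exact (hφ.map_min).symm
  · exact (hφ.map_max).symm

lemma crun_mono (L : List (CStage W)) {φ : α → β} (hφ : Monotone φ) (g : W → α) :
    crun L (fun w => φ (g w)) = fun v => φ (crun L g v) := by
  induction L generalizing g with
  | nil => rfl
  | cons s L ih =>
    rw [crun_cons, crun_cons, ← ih]
    congr 1
    funext v
    exact s.apply_mono hφ g v

lemma CStage.exists_perm (s : CStage W) (g : W → α) :
    ∃ e : Equiv.Perm W, (∀ v, s.apply g v = g (e v)) ∧ ∀ v, e v = v ∨ e v = s.σ v := by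
  classical
  let sw : W → Prop := fun v => if s.lo v then g (s.σ v) < g v else g v < g (s.σ v)
  have hsw : ∀ v, s.σ v ≠ v → (sw (s.σ v) ↔ sw v) := by
    intro v hv
    simp only [sw, s.hlo v hv, s.inv]
    cases s.lo v <;> simp
  let e : W → W := fun v => if sw v then s.σ v else v
  have he : Function.Involutive e := by
    intro v
    simp only [e]
    by_cases hv : s.σ v = v
    · simp [hv]
    · by_cases h : sw v
      · simp only [h, if_true, (hsw v hv).mpr h, s.inv]
      · simp only [h, if_false]
  refine ⟨he.toPerm, ?_, ?_⟩
  · intro v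
    simp only [Function.Involutive.coe_toPerm, e, sw, CStage.apply]
    cases s.lo v
    · simp only [Bool.false_eq_true, if_false]
      split_ifs with h
      · exact max_eq_right h.le
      · exact max_eq_left (not_lt.mp h)
    · simp only [if_true]
      split_ifs with h
      · exact min_eq_right h.le
      · exact min_eq_left (not_lt.mp h)
  · intro v
    simp only [Function.Involutive.coe_toPerm, e]
    split_ifs <;> simp

lemma crun_perm (L : List (CStage W)) (g : W → α) :
    ∃ e : Equiv.Perm W, (∀ v, crun L g v = g (e v)) ∧
      ∀ S : Set W, (∀ s ∈ L, ∀ v ∈ S, s.σ v ∈ S) → ∀ v ∈ S, e v ∈ S := by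
  induction L generalizing g with
  | nil => exact ⟨1, fun v => rfl, fun S _ v hv => hv⟩
  | cons s L ih =>
    obtain ⟨e₁, h1, h2⟩ := s.exists_perm g
    obtain ⟨e₂, h3, h4⟩ := ih (s.apply g)
    refine ⟨e₁ * e₂, fun v => ?_, fun S hS v hv => ?_⟩
    · rw [crun_cons, h3, h1]; rfl
    · have := h4 S (fun s' hs' => hS s' (List.mem_cons_of_mem _ hs')) v hv
      rw [Equiv.Perm.mul_apply]
      rcases h2 (e₂ v) with h | h
      · rw [h]; exact this
      · rw [h]; exact hS s (List.mem_cons_self ..) _ this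

lemma crun_card (L : List (CStage W)) (g : W → α) (S : Finset W)
    (hS : ∀ s ∈ L, ∀ v ∈ S, s.σ v ∈ S) (P : α → Prop) [DecidablePred P] :
    (S.filter fun v => P (crun L g v)).card = (S.filter fun v => P (g v)).card := by
  classical
  obtain ⟨e, h1, h2⟩ := crun_perm L g
  have hmaps : ∀ v ∈ S, e v ∈ S := fun v hv => by
    have := h2 (S : Set W) (fun s hs v hv => by exact_mod_cast hS s hs v (by exact_mod_cast hv)) v
      (by exact_mod_cast hv)
    exact_mod_cast this
  have himg : S.image e = S := by
    apply Finset.eq_of_subset_of_card_le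
    · intro x hx
      obtain ⟨v, hv, rfl⟩ := mem_image.mp hx
      exact hmaps v hv
    · rw [card_image_of_injective _ e.injective]
  rw [← card_image_of_injective (S.filter fun v => P (crun L g v)) e.injective]
  congr 1
  ext x
  simp only [mem_image, mem_filter, h1]
  constructor
  · rintro ⟨v, ⟨hv, hp⟩, rfl⟩
    exact ⟨hmaps v hv, hp⟩
  · rintro ⟨hx, hp⟩
    rw [← himg, mem_image] at hx
    obtain ⟨v, hv, rfl⟩ := hx
    exact ⟨v, ⟨hv, hp⟩, rfl⟩

lemma crun_congr (L : List (CStage W)) (g g' : W → α) (S : Set W)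
    (hS : ∀ s ∈ L, ∀ v ∈ S, s.σ v ∈ S) (h : ∀ v ∈ S, g v = g' v) :
    ∀ v ∈ S, crun L g v = crun L g' v := by
  induction L generalizing g g' with
  | nil => exact h
  | cons s L ih =>
    intro v hv
    rw [crun_cons, crun_cons]
    apply ih _ _ (fun s' hs' => hS s' (List.mem_cons_of_mem _ hs')) _ v hv
    intro v hv
    unfold CStage.apply
    rw [h v hv, h _ (hS s (List.mem_cons_self ..) v hv)]

/-- Running separate lists of stages in separate bags in parallel. -/
lemma parallel {N : Type*} (loc : W → N) (idx : W → ℕ) (wire : N → ℕ → W) (size : N → ℕ)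
    (h1 : ∀ w, wire (loc w) (idx w) = w) (h1' : ∀ w, idx w < size (loc w))
    (h2 : ∀ n p, p < size n → loc (wire n p) = n ∧ idx (wire n p) = p) (c : ℕ) :
    ∀ sep : N → List (CStage ℕ), (∀ n, (sep n).length = c) →
    (∀ n, ∀ s ∈ sep n, ∀ p, p < size n → s.σ p < size n) →
    ∃ L : List (CStage W), L.length = c ∧ ∀ (g : W → α) w,
      crun L g w = crun (sep (loc w)) (fun p => g (wire (loc w) p)) (idx w) := by
  induction c with
  | zero =>
    intro sep hl _
    refine ⟨[], rfl, fun g w => ?_⟩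
    rw [List.length_eq_zero_iff.mp (hl (loc w))]
    simp [h1]
  | succ c ih =>
    intro sep hl hs
    have : ∀ n, ∃ s t, sep n = s :: t := fun n => by
      cases h : sep n with
      | nil => have := hl n; rw [h] at this; simp at this
      | cons s t => exact ⟨s, t, rfl⟩
    choose s t hst using this
    have hs1 : ∀ n p, p < size n → (s n).σ p < size n := fun n p hp =>
      hs n (s n) (by rw [hst]; exact List.mem_cons_self ..) p hp
    have hs2 : ∀ n, ∀ s ∈ t n, ∀ p, p < size n → s.σ p < size n := fun n s' hs' =>
      hs n s' (by rw [hst]; exact List.mem_cons_of_mem _ hs')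
    obtain ⟨L, hL, hrun⟩ := ih t (fun n => by have := hl n; rw [hst] at this; simpa using this) hs2
    let S : CStage W :=
      { σ := fun w => wire (loc w) ((s (loc w)).σ (idx w))
        inv := by
          intro w
          obtain ⟨e1, e2⟩ := h2 (loc w) _ (hs1 (loc w) (idx w) (h1' w))
          simp only [e1, e2, (s (loc w)).inv, h1]
        lo := fun w => (s (loc w)).lo (idx w)
        hlo := by
          intro w hw
          obtain ⟨e1, e2⟩ := h2 (loc w) _ (hs1 (loc w) (idx w) (h1' w))
          simp only [e1, e2]
          apply (s (loc w)).hlo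
          intro hh
          exact hw (by simp only [hh, h1]) }
    refine ⟨S :: L, by simp [hL], fun g w => ?_⟩
    rw [crun_cons, hrun, hst, crun_cons]
    apply crun_congr (t (loc w)) _ _ {p | p < size (loc w)}
    · intro s' hs' v hv; exact hs2 _ s' hs' v hv
    · intro p hp
      obtain ⟨e1, e2⟩ := h2 (loc w) p hp
      simp only [CStage.apply, S, e1, e2]
    · exact h1' w

lemma attract (L : List (CStage W)) (τ : Bool) (FS CS : Set W)
    (hF : ∀ s ∈ L, ∀ v ∈ FS, s.lo v = !τ) (hC : ∀ s ∈ L, ∀ v ∈ CS, s.lo v = τ)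
    (b : W → Bool) :
    (∀ v ∈ FS, b v = τ → crun L b v = τ) ∧ (∀ v ∈ CS, crun L b v = τ → b v = τ) ∧
    ∀ s ∈ L, ∀ v ∈ CS, s.σ v ∈ FS → crun L b v = τ → crun L b (s.σ v) = τ := by
  induction L generalizing b with
  | nil => simp
  | cons s L ih =>
    obtain ⟨i1, i2, i3⟩ := ih (fun s hs => hF s (List.mem_cons_of_mem _ hs))
      (fun s hs => hC s (List.mem_cons_of_mem _ hs)) (s.apply b)
    have f1 : ∀ v ∈ FS, b v = τ → s.apply b v = τ := by
      intro v hv h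
      simp only [CStage.apply, hF s (List.mem_cons_self ..) v hv, h]
      cases τ <;> simp
    have f2 : ∀ v ∈ CS, s.apply b v = τ → b v = τ ∧ b (s.σ v) = τ := by
      intro v hv h
      simp only [CStage.apply, hC s (List.mem_cons_self ..) v hv] at h
      revert h
      cases τ <;> cases b v <;> cases b (s.σ v) <;> simp
    simp only [crun_cons]
    refine ⟨fun v hv h => i1 v hv (f1 v hv h), fun v hv h => (f2 v hv (i2 v hv h)).1, ?_⟩
    intro s' hs' v hv hsv h
    rcases List.mem_cons.mp hs' with rfl | hs'
    · exact i1 _ hsv (f1 _ hsv (f2 v hv (i2 v hv h)).2)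
    · exact i3 s' hs' v hv hsv h

lemma exists_pairStage (lo : ℕ → Bool) (a c m m' : ℕ) (hm : m' ≤ m)
    (hdisj : ∀ p, a ≤ p → p < a + m → c ≤ p → p < c + m' → False)
    (hlo : ∀ p r, a ≤ p → p < a + m → c ≤ r → r < c + m' → lo p = !lo r)
    (π : Equiv.Perm (Fin m)) :
    ∃ s : CStage ℕ, s.lo = lo ∧ (∀ j (hj : j < m), j < m' → s.σ (c + j) = a + (π ⟨j, hj⟩ : ℕ)) ∧
      ∀ p, s.σ p = p ∨ (a ≤ p ∧ p < a + m ∧ c ≤ s.σ p ∧ s.σ p < c + m') ∨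
        (c ≤ p ∧ p < c + m' ∧ a ≤ s.σ p ∧ s.σ p < a + m) := by
  classical
  let σ : ℕ → ℕ := fun p =>
    if h : c ≤ p ∧ p < c + m' then a + (π ⟨p - c, by omega⟩ : ℕ)
    else if h' : ∃ h : a ≤ p ∧ p < a + m, (π.symm ⟨p - a, by omega⟩ : ℕ) < m' then
      c + (π.symm ⟨p - a, by obtain ⟨h1, _⟩ := h'; omega⟩ : ℕ)
    else p
  have hσC : ∀ j (hj : j < m), j < m' → σ (c + j) = a + (π ⟨j, hj⟩ : ℕ) := by
    intro j hj hj'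
    have : c ≤ c + j ∧ c + j < c + m' := by omega
    simp only [σ, dif_pos this]
    simp
  have hσF : ∀ j (hj : j < m), j < m' → σ (a + (π ⟨j, hj⟩ : ℕ)) = c + j := by
    intro j hj hj'
    have h0 := (π ⟨j, hj⟩).2
    have h1 : ¬ (c ≤ a + (π ⟨j, hj⟩ : ℕ) ∧ a + (π ⟨j, hj⟩ : ℕ) < c + m') := fun h =>
      hdisj _ (by omega) (by omega) h.1 h.2
    have h3 : ∀ h : a + (π ⟨j, hj⟩ : ℕ) - a < m,
        (π.symm ⟨a + (π ⟨j, hj⟩ : ℕ) - a, h⟩) = ⟨j, hj⟩ := by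
      intro h
      rw [Equiv.symm_apply_eq]
      apply Fin.ext; simp
    have h2 : ∃ h : a ≤ a + (π ⟨j, hj⟩ : ℕ) ∧ a + (π ⟨j, hj⟩ : ℕ) < a + m,
        (π.symm ⟨a + (π ⟨j, hj⟩ : ℕ) - a, by omega⟩ : ℕ) < m' :=
      ⟨by omega, by rw [h3]; exact hj'⟩
    simp only [σ, dif_neg h1, dif_pos h2]
    rw [h3]
  have hcase : ∀ p, (σ p = p) ∨ (∃ j, ∃ hj : j < m, j < m' ∧ p = c + j ∧ σ p = a + (π ⟨j, hj⟩ : ℕ)) ∨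
      ∃ j, ∃ hj : j < m, j < m' ∧ p = a + (π ⟨j, hj⟩ : ℕ) ∧ σ p = c + j := by
    intro p
    by_cases h : c ≤ p ∧ p < c + m'
    · right; left
      refine ⟨p - c, by omega, by omega, by omega, ?_⟩
      have := hσC (p - c) (by omega) (by omega)
      rwa [Nat.add_sub_cancel' h.1] at this
    · by_cases h' : ∃ h : a ≤ p ∧ p < a + m, (π.symm ⟨p - a, by omega⟩ : ℕ) < m'
      · right; right
        obtain ⟨h1, h2⟩ := h'
        have e : p = a + (π ⟨(π.symm ⟨p - a, by omega⟩ : ℕ), Fin.is_lt _⟩ : ℕ) := by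
          simp; omega
        refine ⟨(π.symm ⟨p - a, by omega⟩ : ℕ), Fin.is_lt _, h2, e, ?_⟩
        have := hσF _ (Fin.is_lt (π.symm ⟨p - a, by omega⟩)) h2
        rwa [← e] at this
      · left
        simp only [σ, dif_neg h, dif_neg h']
  refine ⟨⟨σ, ?_, lo, ?_⟩, rfl, hσC, ?_⟩
  · intro p
    rcases hcase p with h | ⟨j, hj, hj', h1, h2⟩ | ⟨j, hj, hj', h1, h2⟩
    · rw [h, h]
    · rw [h2, hσF j hj hj', h1]
    · rw [h2, hσC j hj hj', ← h1]
  · intro p hp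
    rcases hcase p with h | ⟨j, hj, hj', h1, h2⟩ | ⟨j, hj, hj', h1, h2⟩
    · exact absurd h hp
    · have := (π ⟨j, hj⟩).2
      rw [h2]
      exact hlo _ _ (by omega) (by omega) (by omega) (by omega)
    · have := (π ⟨j, hj⟩).2
      rw [h2]
      have := hlo p (c + j) (by omega) (by omega) (by omega) (by omega)
      rw [this, Bool.not_not]
  · intro p
    show σ p = p ∨ (a ≤ p ∧ p < a + m ∧ c ≤ σ p ∧ σ p < c + m') ∨
        (c ≤ p ∧ p < c + m' ∧ a ≤ σ p ∧ σ p < a + m)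
    rcases hcase p with h | ⟨j, hj, hj', h1, h2⟩ | ⟨j, hj, hj', h1, h2⟩
    · exact Or.inl h
    · have := (π ⟨j, hj⟩).2; omega
    · have := (π ⟨j, hj⟩).2; omega

lemma expand_count {m c q : ℕ} {π : Fin c → Equiv.Perm (Fin m)} (hπ : Expands q π)
    (Z T : Finset (Fin m)) (h : ∀ i, ∀ a ∈ Z, π i a ∈ T) (k : ℕ) (hk : Z.card + T.card ≤ k) :
    (k ≤ m → (q + 1) * Z.card ≤ k) ∧ q * (Z.card - (k - m)) ≤ m := by
  constructor
  · intro hkm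
    rcases Z.eq_empty_or_nonempty with hZ | hZ
    · simp [hZ]
    · by_contra hcon
      have h1 : T.card ≤ q * Z.card := by
        by_contra h2
        rw [Nat.add_mul, Nat.one_mul] at hcon
        omega
      have := hπ Z T hZ h h1
      omega
  · obtain ⟨S, hSZ, hS⟩ := Finset.exists_subset_card_eq (s := Z) (n := Z.card - (k - m)) (Nat.sub_le _ _)
    rw [← hS]
    rcases S.eq_empty_or_nonempty with hS0 | hS0
    · simp [hS0]
    · by_contra hcon
      have hTm : T.card ≤ m := by simpa using T.card_le_univ
      have := hπ S T hS0 (fun i a ha => h i a (hSZ ha)) (by omega)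
      have : 0 < S.card := hS0.card_pos
      omega

lemma card_Ico_filter (y : ℕ → Bool) (τ : Bool) (c m m' : ℕ) (hm : m' ≤ m) :
    (univ.filter fun j : Fin m => (j : ℕ) < m' ∧ y (c + j) = τ).card =
      ((Ico c (c + m')).filter fun p => y p = τ).card := by
  apply Finset.card_bij (fun (j : Fin m) _ => c + (j : ℕ))
  · intro j hj
    simp only [mem_filter, mem_univ, true_and, mem_Ico] at hj ⊢
    refine ⟨by omega, hj.2⟩
  · intro i _ j _ h
    apply Fin.ext; omega
  · intro p hp
    simp only [mem_filter, mem_Ico] at hp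
    refine ⟨⟨p - c, by omega⟩, ?_, ?_⟩
    · simp only [mem_filter, mem_univ, true_and]
      refine ⟨by omega, ?_⟩
      rw [Nat.add_sub_cancel' hp.1.1]; exact hp.2
    · simp only; omega

lemma halver_count {m e q : ℕ} {π : Fin e → Equiv.Perm (Fin m)} (hπ : Expands q π)
    (y : ℕ → Bool) (τ : Bool) (a c m' : ℕ) (hm : m' ≤ m)
    (h : ∀ i j (hj : j < m), j < m' → y (c + j) = τ → y (a + (π i ⟨j, hj⟩ : ℕ)) = τ) (k : ℕ)
    (hk : ((Ico c (c + m')).filter fun p => y p = τ).card +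
      ((Ico a (a + m)).filter fun p => y p = τ).card ≤ k) :
    (k ≤ m → (q + 1) * ((Ico c (c + m')).filter fun p => y p = τ).card ≤ k) ∧
      q * (((Ico c (c + m')).filter fun p => y p = τ).card - (k - m)) ≤ m := by
  rw [← card_Ico_filter y τ c m m' hm] at hk ⊢
  rw [← card_Ico_filter y τ a m m le_rfl] at hk
  apply expand_count hπ _ _ _ k hk
  intro i j hj
  simp only [mem_filter, mem_univ, true_and] at hj ⊢
  exact ⟨Fin.is_lt _, h i j j.2 hj.1 hj.2⟩

end AKS

namespace AKS

lemma list_of_fintype {ι : Type*} [Fintype ι] {X : Type*} (s : ι → X) :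
    ∃ L : List X, L.length = Fintype.card ι ∧ (∀ i, s i ∈ L) ∧ ∀ x ∈ L, ∃ i, x = s i := by
  refine ⟨(Finset.univ : Finset ι).toList.map s, by simp, fun i => by simp, fun x hx => ?_⟩
  simp only [List.mem_map, mem_toList, mem_univ, true_and] at hx
  obtain ⟨i, hi⟩ := hx
  exact ⟨i, hi.symm⟩

lemma exists_halver (q : ℕ) (hq : 1 ≤ q) : ∃ c, ∀ m : ℕ, ∃ L : List (CStage ℕ), L.length = c ∧
    (∀ s ∈ L, ∀ p, (p < 2 * m → s.σ p < 2 * m) ∧ (2 * m ≤ p → s.σ p = p)) ∧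
    ∀ (b : ℕ → Bool) (k1 k0 : ℕ), ((range (2 * m)).filter fun p => b p = true).card = k1 →
      ((range (2 * m)).filter fun p => b p = false).card = k0 →
      (k1 ≤ m → (q + 1) * ((Ico 0 m).filter fun p => crun L b p = true).card ≤ k1) ∧
      (q * (((Ico 0 m).filter fun p => crun L b p = true).card - (k1 - m)) ≤ m) ∧
      (k0 ≤ m → (q + 1) * ((Ico m (2 * m)).filter fun p => crun L b p = false).card ≤ k0) ∧
      (q * (((Ico m (2 * m)).filter fun p => crun L b p = false).card - (k0 - m)) ≤ m) := by
  obtain ⟨c, hc⟩ := exists_expander q hq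
  refine ⟨c, fun m => ?_⟩
  obtain ⟨π, hπ, hπ'⟩ := hc m
  have hst := fun i => exists_pairStage (fun p => decide (p < m)) 0 m m m le_rfl
    (by intros; omega) (by
      intro p r h1 h2 h3 h4
      have : p < m := by omega
      have : ¬ r < m := by omega
      simp [*]) (π i)
  choose st hlo hσ hcl using hst
  obtain ⟨L, hL, hL1, hL2⟩ := list_of_fintype st
  have hclosed : ∀ s ∈ L, ∀ p, (p < 2 * m → s.σ p < 2 * m) ∧ (2 * m ≤ p → s.σ p = p) := by
    intro s hs p
    obtain ⟨i, rfl⟩ := hL2 s hs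
    have := hcl i p
    constructor <;> intro <;> omega
  refine ⟨L, by simpa using hL, hclosed, ?_⟩
  intro b k1 k0 hk1 hk0
  have hcons : ∀ τ, ((range (2 * m)).filter fun p => crun L b p = τ).card =
      ((range (2 * m)).filter fun p => b p = τ).card := fun τ =>
    crun_card L b (range (2 * m)) (fun s hs v hv => by
      simp only [mem_range] at hv ⊢; exact (hclosed s hs v).1 hv) (fun x => x = τ)
  have hsplit : ∀ τ, ((range (2 * m)).filter fun p => crun L b p = τ).card =
      ((Ico 0 m).filter fun p => crun L b p = τ).card +
      ((Ico m (2 * m)).filter fun p => crun L b p = τ).card := by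
    intro τ
    rw [← card_union_of_disjoint]
    · rw [← filter_union]
      congr 2
      ext p; simp; omega
    · apply disjoint_filter_filter
      rw [disjoint_left]; intro p; simp; omega
  have e2 : m + m = 2 * m := by ring
  have A0 := attract L false {p | p < m} {p | m ≤ p ∧ p < 2 * m}
    (by rintro s hs v hv; obtain ⟨i, rfl⟩ := hL2 s hs; simp only [Set.mem_ofPred_eq] at hv; simp [hlo, hv])
    (by rintro s hs v hv; obtain ⟨i, rfl⟩ := hL2 s hs; simp only [Set.mem_ofPred_eq] at hv; simp [hlo, hv]) b
  have A1 := attract L true {p | m ≤ p ∧ p < 2 * m} {p | p < m}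
    (by rintro s hs v hv; obtain ⟨i, rfl⟩ := hL2 s hs; simp only [Set.mem_ofPred_eq] at hv; simp [hlo, hv])
    (by rintro s hs v hv; obtain ⟨i, rfl⟩ := hL2 s hs; simp only [Set.mem_ofPred_eq] at hv; simp [hlo, hv]) b
  have H0 := halver_count hπ (crun L b) false 0 m m le_rfl (by
    intro i j hj _ hy
    have := hσ i j hj hj
    have h3 := (π i ⟨j, hj⟩).2
    have := A0.2.2 (st i) (hL1 i) (m + j) ⟨by omega, by omega⟩ (by
      rw [this]; simp) hy
    rwa [hσ i j hj hj] at this) k0 (by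
      have h1 := hcons false
      have h2 := hsplit false
      rw [e2, Nat.zero_add]; omega)
  have H1 := halver_count hπ' (crun L b) true m 0 m le_rfl (by
    intro i j hj _ hy
    have h3 := ((π i)⁻¹ ⟨j, hj⟩).2
    have h4 := hσ i ((π i)⁻¹ ⟨j, hj⟩ : Fin m) h3 h3
    have h5 : (st i).σ (0 + j) = m + ((π i)⁻¹ ⟨j, hj⟩ : Fin m) := by
      rw [← (st i).inv (m + ((π i)⁻¹ ⟨j, hj⟩ : Fin m)), h4]
      simp
    have := A1.2.2 (st i) (hL1 i) (0 + j) (by simp; omega) (by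
      rw [h5]; simp; omega) hy
    rwa [h5] at this) k1 (by
      have h1 := hcons true
      have h2 := hsplit true
      rw [e2, Nat.zero_add]; omega)
  rw [e2] at H0
  rw [Nat.zero_add] at H1
  exact ⟨H1.1, H1.2, H0.1, H0.2⟩

lemma exists_fringe (q : ℕ) (hq : 1 ≤ q) : ∃ c, ∀ m f : ℕ, f ≤ m → m ≤ 64 * f →
    ∃ L : List (CStage ℕ), L.length = c ∧
    (∀ s ∈ L, ∀ p, (p < m → s.σ p < m) ∧ (m ≤ p → p < 2 * m → m ≤ s.σ p ∧ s.σ p < 2 * m) ∧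
      (2 * m ≤ p → s.σ p = p)) ∧
    ∀ (b : ℕ → Bool) (k : ℕ), k ≤ f →
      (((range (2 * m)).filter fun p => b p = true).card ≤ k →
        (q + 1) * ((Ico m (2 * m - f)).filter fun p => crun L b p = true).card ≤ 64 * k) ∧
      (((range (2 * m)).filter fun p => b p = false).card ≤ k →
        (q + 1) * ((Ico f m).filter fun p => crun L b p = false).card ≤ 64 * k) := by
  obtain ⟨c, hc⟩ := exists_expander q hq
  refine ⟨Fintype.card (Fin 64 × Fin c ⊕ Fin 64 × Fin c), fun m f hf hmf => ?_⟩
  obtain ⟨π, hπ, -⟩ := hc f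
  let lo : ℕ → Bool := fun p => decide (p < f ∨ (m ≤ p ∧ p < 2 * m - f))
  let ml : ℕ → ℕ := fun i => min f (m - (f + f * i))
  let mr : ℕ → ℕ := fun i => min f ((2 * m - f) - (m + f * i))
  have hl := fun i : Fin 64 × Fin c => exists_pairStage lo 0 (f + f * i.1) f (ml i.1)
    (min_le_left _ _) (by intros; omega) (by
      intro p r h1 h2 h3 h4
      simp only [ml] at h4
      have h5 : (p < f ∨ (m ≤ p ∧ p < 2 * m - f)) := by omega
      have h6 : ¬ (r < f ∨ (m ≤ r ∧ r < 2 * m - f)) := by omega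
      simp only [lo, h5, h6, decide_true, decide_false, Bool.not_false]) (π i.2)
  have hr := fun i : Fin 64 × Fin c => exists_pairStage lo (2 * m - f) (m + f * i.1) f (mr i.1)
    (min_le_left _ _) (by simp only [mr]; intros; omega) (by
      intro p r h1 h2 h3 h4
      simp only [mr] at h4
      have h5 : ¬ (p < f ∨ (m ≤ p ∧ p < 2 * m - f)) := by omega
      have h6 : (r < f ∨ (m ≤ r ∧ r < 2 * m - f)) := by omega
      simp only [lo, h5, h6, decide_true, decide_false, Bool.not_true]) (π i.2)
  choose sl hlol hσl hcll using hl
  choose sr hlor hσr hclr using hr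
  obtain ⟨L, hL, hL1, hL2⟩ := list_of_fintype (Sum.elim sl sr)
  have hlo : ∀ s ∈ L, s.lo = lo := by
    intro s hs
    obtain ⟨i | i, rfl⟩ := hL2 s hs
    · exact hlol i
    · exact hlor i
  have hclosed : ∀ s ∈ L, ∀ p, (p < m → s.σ p < m) ∧ (m ≤ p → p < 2 * m → m ≤ s.σ p ∧ s.σ p < 2 * m) ∧
      (2 * m ≤ p → s.σ p = p) := by
    intro s hs p
    obtain ⟨i | i, rfl⟩ := hL2 s hs
    · have := hcll i p
      simp only [Sum.elim_inl]
      have : ml i.1 ≤ m - (f + f * i.1) := min_le_right _ _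
      refine ⟨?_, ?_, ?_⟩ <;> intros <;> omega
    · have := hclr i p
      simp only [Sum.elim_inr]
      have : mr i.1 ≤ (2 * m - f) - (m + f * i.1) := min_le_right _ _
      refine ⟨?_, ?_, ?_⟩ <;> intros <;> omega
  refine ⟨L, hL, hclosed, ?_⟩
  intro b k hk
  have hcons : ∀ τ, ((range (2 * m)).filter fun p => crun L b p = τ).card =
      ((range (2 * m)).filter fun p => b p = τ).card := fun τ =>
    crun_card L b (range (2 * m)) (fun s hs v hv => by
      simp only [mem_range] at hv ⊢; have := hclosed s hs v; omega) (fun x => x = τ)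
  have hle : ∀ (τ : Bool) (A B A' B' : ℕ), B ≤ 2 * m → B' ≤ 2 * m → (B ≤ A' ∨ B' ≤ A ∨ A = B) →
      ((Ico A B).filter fun p => crun L b p = τ).card +
      ((Ico A' B').filter fun p => crun L b p = τ).card ≤
      ((range (2 * m)).filter fun p => crun L b p = τ).card := by
    intro τ A B A' B' h1 h2 h3
    rw [← card_union_of_disjoint]
    · rw [← filter_union]
      apply card_le_card
      apply filter_subset_filter
      intro p; simp; omega
    · apply disjoint_filter_filter
      rw [disjoint_left]; intro p; simp; omega
  have hchunk : ∀ (τ : Bool) (A B : ℕ) (C ℓ : ℕ → ℕ), (∀ p, A ≤ p → p < B → ∃ i < 64, C i ≤ p ∧ p < C i + ℓ i) →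
      (∀ i < 64, (q + 1) * ((Ico (C i) (C i + ℓ i)).filter fun p => crun L b p = τ).card ≤ k) →
      (q + 1) * ((Ico A B).filter fun p => crun L b p = τ).card ≤ 64 * k := by
    intro τ A B C ℓ h1 h2
    have hsub : ((Ico A B).filter fun p => crun L b p = τ) ⊆
        (range 64).biUnion fun i => ((Ico (C i) (C i + ℓ i)).filter fun p => crun L b p = τ) := by
      intro p hp
      simp only [mem_filter, mem_Ico, mem_biUnion, mem_range] at hp ⊢
      obtain ⟨i, hi, h⟩ := h1 p hp.1.1 hp.1.2
      exact ⟨i, hi, h, hp.2⟩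
    calc _ ≤ (q + 1) * ∑ i ∈ range 64, ((Ico (C i) (C i + ℓ i)).filter fun p => crun L b p = τ).card :=
          Nat.mul_le_mul_left _ ((card_le_card hsub).trans card_biUnion_le)
      _ = ∑ i ∈ range 64, (q + 1) * ((Ico (C i) (C i + ℓ i)).filter fun p => crun L b p = τ).card := by
          rw [mul_sum]
      _ ≤ ∑ i ∈ range 64, k := Finset.sum_le_sum fun i hi => h2 i (mem_range.mp hi)
      _ = 64 * k := by simp
  have hdiv : ∀ u, 0 < f → u < 64 * f → ∃ i < 64, f * i ≤ u ∧ u < f * i + f := by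
    intro u hf0 hu
    refine ⟨u / f, Nat.div_lt_of_lt_mul (by linarith), Nat.mul_div_le _ _, ?_⟩
    have := Nat.lt_mul_div_succ u hf0
    rw [Nat.mul_add] at this; linarith
  constructor
  · intro hb
    have A1 := attract L true {p | 2 * m - f ≤ p ∧ p < 2 * m} {p | m ≤ p ∧ p < 2 * m - f}
      (by
        intro s hs v hv
        simp only [Set.mem_ofPred_eq] at hv
        have : ¬ (v < f ∨ (m ≤ v ∧ v < 2 * m - f)) := by omega
        simp only [hlo s hs, lo, this, decide_false, Bool.not_true])
      (by
        intro s hs v hv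
        simp only [Set.mem_ofPred_eq] at hv
        have : (v < f ∨ (m ≤ v ∧ v < 2 * m - f)) := by omega
        simp only [hlo s hs, lo, this, decide_true]) b
    apply hchunk true m (2 * m - f) (fun i => m + f * i) mr
    · intro p h1 h2
      obtain ⟨i, hi, h3, h4⟩ := hdiv (p - m) (by omega) (by omega)
      refine ⟨i, hi, by omega, ?_⟩
      simp only [mr]; omega
    · intro i hi
      have hmr : mr i ≤ (2 * m - f) - (m + f * i) := min_le_right _ _
      apply (halver_count hπ (crun L b) true (2 * m - f) (m + f * i) (mr i) (min_le_left _ _) ?_ k ?_).1 hk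
      · intro e j hj hj' hy
        have h3 := (π e ⟨j, hj⟩).2
        have h4 := hσr (⟨i, hi⟩, e) j hj hj'
        simp only at h4
        have := A1.2.2 _ (hL1 (Sum.inr (⟨i, hi⟩, e))) (m + f * i + j)
          (by simp only [Set.mem_ofPred_eq]; omega) (by
            simp only [Sum.elim_inr, h4, Set.mem_ofPred_eq]; omega) hy
        simpa only [Sum.elim_inr, h4] using this
      · rcases Nat.eq_zero_or_pos (mr i) with h0 | h0
        · have := hle true (m + f * i) (m + f * i) (2 * m - f) (2 * m - f + f)
          have h5 := hle true 0 0 (2 * m - f) (2 * m - f + f) (by omega) (by omega) (by omega)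
          rw [h0, Nat.add_zero, Ico_self, filter_empty, card_empty]
          have h1 := hcons true
          omega
        · have := hle true (m + f * i) (m + f * i + mr i) (2 * m - f) (2 * m - f + f) (by omega) (by omega)
            (by omega)
          have h1 := hcons true
          omega
  · intro hb
    have A1 := attract L false {p | p < f} {p | f ≤ p ∧ p < m}
      (by
        intro s hs v hv
        simp only [Set.mem_ofPred_eq] at hv
        have : (v < f ∨ (m ≤ v ∧ v < 2 * m - f)) := by omega
        simp only [hlo s hs, lo, this, decide_true, Bool.not_false])
      (by
        intro s hs v hv
        simp only [Set.mem_ofPred_eq] at hv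
        have : ¬ (v < f ∨ (m ≤ v ∧ v < 2 * m - f)) := by omega
        simp only [hlo s hs, lo, this, decide_false]) b
    apply hchunk false f m (fun i => f + f * i) ml
    · intro p h1 h2
      obtain ⟨i, hi, h3, h4⟩ := hdiv (p - f) (by omega) (by omega)
      refine ⟨i, hi, by omega, ?_⟩
      simp only [ml]; omega
    · intro i hi
      have hmr : ml i ≤ m - (f + f * i) := min_le_right _ _
      apply (halver_count hπ (crun L b) false 0 (f + f * i) (ml i) (min_le_left _ _) ?_ k ?_).1 hk
      · intro e j hj hj' hy
        have h3 := (π e ⟨j, hj⟩).2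
        have h4 := hσl (⟨i, hi⟩, e) j hj hj'
        simp only at h4
        have := A1.2.2 _ (hL1 (Sum.inl (⟨i, hi⟩, e))) (f + f * i + j)
          (by simp only [Set.mem_ofPred_eq]; omega) (by
            simp only [Sum.elim_inl, h4, Set.mem_ofPred_eq]; omega) hy
        simpa only [Sum.elim_inl, h4] using this
      · have h1 := hcons false
        rcases Nat.eq_zero_or_pos (ml i) with h0 | h0
        · have h5 := hle false 0 0 0 (0 + f) (by omega) (by omega) (by omega)
          rw [h0, Nat.add_zero, Ico_self, filter_empty, card_empty]
          omega
        · have := hle false (f + f * i) (f + f * i + ml i) 0 (0 + f) (by omega) (by omega)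
            (by omega)
          omega

def idStage (W : Type*) : CStage W := ⟨id, fun _ => rfl, fun _ => true, fun _ h => absurd rfl h⟩

lemma crun_replicate_id {W α : Type*} [LinearOrder α] (n : ℕ) (g : W → α) :
    crun (List.replicate n (idStage W)) g = g := by
  induction n with
  | zero => rfl
  | succ n ih =>
    rw [List.replicate_succ, crun_cons]
    have : (idStage W).apply g = g := by funext v; simp [CStage.apply, idStage]
    rw [this, ih]

theorem exists_separator (Q : ℕ) (hQ : 1 ≤ Q) : ∃ c, ∀ m f : ℕ, f ≤ m → (f = 0 ∨ m ≤ 64 * f) →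
    ∃ L : List (CStage ℕ), L.length = c ∧
    (∀ s ∈ L, ∀ p, (p < 2 * m → s.σ p < 2 * m) ∧ (2 * m ≤ p → s.σ p = p)) ∧
    ∀ (b : ℕ → Bool) (k1 k0 : ℕ), ((range (2 * m)).filter fun p => b p = true).card = k1 →
      ((range (2 * m)).filter fun p => b p = false).card = k0 →
      (Q * (((Ico 0 m).filter fun p => crun L b p = true).card - (k1 - m)) ≤ m) ∧
      (Q * (((Ico m (2 * m)).filter fun p => crun L b p = false).card - (k0 - m)) ≤ m) ∧
      (k1 ≤ f → Q * ((Ico f (2 * m - f)).filter fun p => crun L b p = true).card ≤ k1) ∧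
      (k0 ≤ f → Q * ((Ico f (2 * m - f)).filter fun p => crun L b p = false).card ≤ k0) := by
  obtain ⟨q, hq⟩ : ∃ q, q + 1 = 65 * Q := ⟨65 * Q - 1, by omega⟩
  obtain ⟨c1, hc1⟩ := exists_halver q (by omega)
  obtain ⟨c2, hc2⟩ := exists_fringe q (by omega)
  refine ⟨c1 + c2, fun m f hf hmf => ?_⟩
  obtain ⟨LH, hl1, hcl1, hH⟩ := hc1 m
  have hQq : ∀ x, q * x ≤ m → Q * x ≤ m := fun x hx =>
    (Nat.mul_le_mul_right x (by omega)).trans hx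
  rcases Nat.eq_zero_or_pos f with hf0 | hf0
  · refine ⟨LH ++ List.replicate c2 (idStage ℕ), by simp [hl1], ?_, ?_⟩
    · intro s hs p
      rcases List.mem_append.mp hs with hs | hs
      · exact hcl1 s hs p
      · rw [List.eq_of_mem_replicate hs]; exact ⟨fun h => h, fun h => rfl⟩
    · intro b k1 k0 hk1 hk0
      rw [crun_append, crun_replicate_id]
      obtain ⟨h1, h2, h3, h4⟩ := hH b k1 k0 hk1 hk0
      have hcons : ∀ τ, ((range (2 * m)).filter fun p => crun LH b p = τ).card =
          ((range (2 * m)).filter fun p => b p = τ).card := fun τ =>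
        crun_card LH b (range (2 * m)) (fun s hs v hv => by
          simp only [mem_range] at hv ⊢; have := hcl1 s hs v; omega) (fun x => x = τ)
      have hz : ∀ τ, ((range (2 * m)).filter fun p => b p = τ).card = 0 →
          ((Ico f (2 * m - f)).filter fun p => crun LH b p = τ).card = 0 := by
        intro τ h
        rw [← hcons, card_eq_zero, filter_eq_empty_iff] at h
        rw [card_eq_zero, filter_eq_empty_iff]
        intro p hp
        apply h
        simp only [mem_Ico, mem_range] at hp ⊢; omega
      refine ⟨hQq _ h2, hQq _ h4, fun h => ?_, fun h => ?_⟩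
      · rw [hz true (by omega)]; omega
      · rw [hz false (by omega)]; omega
  · obtain ⟨LF, hl2, hcl2, hF⟩ := hc2 m f hf (by omega)
    refine ⟨LH ++ LF, by simp [hl1, hl2], ?_, ?_⟩
    · intro s hs p
      rcases List.mem_append.mp hs with hs | hs
      · exact hcl1 s hs p
      · have := hcl2 s hs p; constructor <;> intro <;> omega
    · intro b k1 k0 hk1 hk0
      rw [crun_append]
      obtain ⟨h1, h2, h3, h4⟩ := hH b k1 k0 hk1 hk0
      have hcons : ∀ τ, ((range (2 * m)).filter fun p => crun LH b p = τ).card =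
          ((range (2 * m)).filter fun p => b p = τ).card := fun τ =>
        crun_card LH b (range (2 * m)) (fun s hs v hv => by
          simp only [mem_range] at hv ⊢; have := hcl1 s hs v; omega) (fun x => x = τ)
      set y := crun LH b with hy
      have hconL : ((Ico 0 m).filter fun p => crun LF y p = true).card =
          ((Ico 0 m).filter fun p => y p = true).card :=
        crun_card LF y (Ico 0 m) (fun s hs v hv => by
          simp only [mem_Ico] at hv ⊢; have := hcl2 s hs v; omega) (fun x => x = true)
      have hconR : ((Ico m (2 * m)).filter fun p => crun LF y p = false).card =
          ((Ico m (2 * m)).filter fun p => y p = false).card :=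
        crun_card LF y (Ico m (2 * m)) (fun s hs v hv => by
          simp only [mem_Ico] at hv ⊢; have := hcl2 s hs v; omega) (fun x => x = false)
      rw [hconL, hconR]
      refine ⟨hQq _ h2, hQq _ h4, fun h => ?_, fun h => ?_⟩
      · have a1 := h1 (by omega)
        have a2 := (hF y k1 h).1 (by rw [hcons, hk1])
        have a3 : ((Ico f (2 * m - f)).filter fun p => crun LF y p = true).card ≤
            ((Ico 0 m).filter fun p => crun LF y p = true).card +
            ((Ico m (2 * m - f)).filter fun p => crun LF y p = true).card := by
          refine le_trans (card_le_card ?_) (card_union_le _ _)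
          intro p; simp only [mem_filter, mem_Ico, mem_union]
          rintro ⟨h1, h2⟩
          simp only [h2, and_true]; omega
        rw [hconL] at a3
        have a4 := Nat.mul_le_mul_left (q + 1) a3
        rw [Nat.mul_add] at a4
        have a5 : 65 * (Q * ((Ico f (2 * m - f)).filter fun p => crun LF y p = true).card) ≤ 65 * k1 := by
          rw [← Nat.mul_assoc, ← hq]; omega
        omega
      · have a1 := h3 (by omega)
        have a2 := (hF y k0 h).2 (by rw [hcons, hk0])
        have a3 : ((Ico f (2 * m - f)).filter fun p => crun LF y p = false).card ≤
            ((Ico m (2 * m)).filter fun p => crun LF y p = false).card +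
            ((Ico f m).filter fun p => crun LF y p = false).card := by
          refine le_trans (card_le_card ?_) (card_union_le _ _)
          intro p; simp only [mem_filter, mem_Ico, mem_union]
          rintro ⟨h1, h2⟩
          simp only [h2, and_true]; omega
        rw [hconR] at a3
        have a4 := Nat.mul_le_mul_left (q + 1) a3
        rw [Nat.mul_add] at a4
        have a5 : 65 * (Q * ((Ico f (2 * m - f)).filter fun p => crun LF y p = false).card) ≤ 65 * k0 := by
          rw [← Nat.mul_assoc, ← hq]; omega
        omega

end AKS

namespace AKS

/-- Capacity of a bag at depth `d` and time `t`. -/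
noncomputable def bb (K t d : ℕ) : ℝ := 2 ^ K * 4 ^ d * (3 / 4) ^ t

lemma bb_pos (K t d : ℕ) : 0 < bb K t d := by unfold bb; positivity

lemma bb_succ_d (K t d : ℕ) : bb K t (d + 1) = 4 * bb K t d := by unfold bb; ring

lemma bb_succ_t (K t d : ℕ) : bb K (t + 1) d = 3 / 4 * bb K t d := by unfold bb; ring

lemma rr_exists (K t : ℕ) : ∃ d, d % 2 = t % 2 ∧ 4 ≤ bb K t d := by
  refine ⟨t + 2, by omega, ?_⟩
  unfold bb
  have h1 : (1:ℝ) ≤ 2 ^ K := one_le_pow₀ (by norm_num)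
  have h2 : (1:ℝ) ≤ 3 ^ t := one_le_pow₀ (by norm_num)
  have h3 : (4:ℝ) ^ (t + 2) * (3 / 4) ^ t = 16 * 3 ^ t := by
    rw [pow_add, mul_right_comm, ← mul_pow]; norm_num; ring
  rw [mul_assoc, h3]
  nlinarith

open scoped Classical in
/-- Topmost active level at time `t`. -/
noncomputable def rr (K t : ℕ) : ℕ := Nat.find (rr_exists K t)

lemma rr_spec (K t : ℕ) : rr K t % 2 = t % 2 ∧ 4 ≤ bb K t (rr K t) := by
  classical
  unfold rr
  exact Nat.find_spec (rr_exists K t)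

lemma rr_min (K t d : ℕ) (h : d < rr K t) (hd : d % 2 = t % 2) : bb K t d < 4 := by
  classical
  unfold rr at h
  have := Nat.find_min (rr_exists K t) h
  by_contra hcon
  exact this ⟨hd, not_lt.mp hcon⟩

lemma rr_le (K t d : ℕ) (hd : d % 2 = t % 2) (h : 4 ≤ bb K t d) : rr K t ≤ d := by
  by_contra hcon
  have := rr_min K t d (not_le.mp hcon) hd
  linarith

lemma rr_succ (K t : ℕ) : rr K (t + 1) ≤ rr K t + 1 := by
  obtain ⟨h1, h2⟩ := rr_spec K t
  apply rr_le
  · omega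
  · rw [bb_succ_t, bb_succ_d]; linarith

lemma bb_mono (K t : ℕ) {d e : ℕ} (h : d ≤ e) : bb K t d ≤ bb K t e := by
  unfold bb
  have : (4:ℝ) ^ d ≤ 4 ^ e := pow_le_pow_right₀ (by norm_num) h
  gcongr

lemma rr_zero (K : ℕ) (hK : 2 ≤ K) : rr K 0 = 0 := by
  have : rr K 0 ≤ 0 := by
    apply rr_le _ _ _ rfl
    unfold bb
    have : (2:ℝ) ^ 2 ≤ 2 ^ K := pow_le_pow_right₀ (by norm_num) hK
    norm_num at this ⊢
    exact this
  omega

lemma rr_large (K : ℕ) : K ≤ rr K (8 * K) := by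
  by_contra hcon
  push Not at hcon
  have h1 := (rr_spec K (8 * K)).2
  have h2 := bb_mono K (8 * K) hcon.le
  have h3 : bb K (8 * K) K < 4 := by
    unfold bb
    rw [← mul_pow, pow_mul, ← mul_pow]
    calc _ ≤ (1:ℝ) ^ K := pow_le_pow_left₀ (by norm_num) (by norm_num) K
      _ < 4 := by norm_num
  linarith

lemma exists_index {W N : Type*} [Fintype W] [Nonempty W] [DecidableEq N] (loc : W → N) :
    ∃ (idx : W → ℕ) (wire : N → ℕ → W), (∀ w, wire (loc w) (idx w) = w) ∧
      (∀ w, idx w < (univ.filter fun w' => loc w' = loc w).card) ∧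
      ∀ n p, p < (univ.filter fun w' => loc w' = n).card → loc (wire n p) = n ∧ idx (wire n p) = p := by
  classical
  let e : ∀ n, (univ.filter fun w' => loc w' = n) ≃ Fin (univ.filter fun w' => loc w' = n).card :=
    fun n => Finset.equivFin _
  let idx : W → ℕ := fun w => e (loc w) ⟨w, by simp⟩
  let wire : N → ℕ → W := fun n p =>
    if h : p < (univ.filter fun w' => loc w' = n).card then ((e n).symm ⟨p, h⟩).1
    else Classical.arbitrary W
  have hidx : ∀ n (w : W) (h : loc w = n), idx w = (e n ⟨w, by simp [h]⟩ : ℕ) := by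
    intro n w h; subst h; rfl
  refine ⟨idx, wire, ?_, ?_, ?_⟩
  · intro w
    simp only [idx, wire]
    rw [dif_pos (Fin.is_lt _)]
    simp
  · intro w; exact Fin.is_lt _
  · intro n p hp
    have h1 : loc (wire n p) = n := by
      simp only [wire, dif_pos hp]
      exact (mem_filter.mp ((e n).symm ⟨p, hp⟩).2).2
    refine ⟨h1, ?_⟩
    rw [hidx n _ h1]
    have : (⟨wire n p, by simp [h1]⟩ : (univ.filter fun w' => loc w' = n)) = (e n).symm ⟨p, hp⟩ := by
      apply Subtype.ext
      simp only [wire, dif_pos hp]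
    rw [this]; simp

/-- Combinatorial part of the invariant. -/
structure LInv (K t : ℕ) (loc : Fin (2 ^ K) → ℕ × ℕ) (s : ℕ → ℕ) : Prop where
  cnt : ∀ d i, (univ.filter fun w => loc w = (d, i)).card = if i < 2 ^ d then s d else 0
  par : ∀ d, s d ≠ 0 → d % 2 = t % 2 ∧ rr K t ≤ d
  cap : ∀ d, (s d : ℝ) ≤ bb K t d

def IsKey (K : ℕ) (x : Fin (2 ^ K) → ℕ) : Prop := Function.Injective x ∧ ∀ w, x w < 2 ^ K

/-- Stranger part of the invariant. -/
def SInv (K t : ℕ) (loc : Fin (2 ^ K) → ℕ × ℕ) (x : Fin (2 ^ K) → ℕ) : Prop :=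
  ∀ d i j, ((univ.filter fun w => loc w = (d, i) ∧ x w / 2 ^ (K - d + j) ≠ i / 2 ^ j).card : ℝ) ≤
    1 / 64 * (1 / 256) ^ j * bb K t d

section
variable {K t : ℕ} {loc : Fin (2 ^ K) → ℕ × ℕ} {s : ℕ → ℕ}

lemma LInv.idx_lt (h : LInv K t loc s) (w) : (loc w).2 < 2 ^ (loc w).1 := by
  by_contra hcon
  have := h.cnt (loc w).1 (loc w).2
  rw [if_neg hcon, card_eq_zero, filter_eq_empty_iff] at this
  exact this (mem_univ w) rfl

lemma LInv.s_ne (h : LInv K t loc s) (w) : s (loc w).1 ≠ 0 := by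
  intro hcon
  have := h.cnt (loc w).1 (loc w).2
  rw [hcon, ite_self, card_eq_zero, filter_eq_empty_iff] at this
  exact this (mem_univ w) rfl

/-- Counting wires in a range of bags at a given level. -/
lemma LInv.level (_ : LInv K t loc s) (d : ℕ) (I : Finset ℕ) (P : Fin (2 ^ K) → Prop) [DecidablePred P] :
    (univ.filter fun w => (loc w).1 = d ∧ (loc w).2 ∈ I ∧ P w).card =
      ∑ i ∈ I, (univ.filter fun w => loc w = (d, i) ∧ P w).card := by
  rw [Finset.card_eq_sum_card_fiberwise (f := fun w => (loc w).2) (t := I)]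
  · apply Finset.sum_congr rfl
    intro i hi
    congr 1
    ext w
    simp only [mem_filter, mem_univ, true_and, Prod.ext_iff]
    constructor
    · rintro ⟨⟨h1, h2, h3⟩, h4⟩; exact ⟨⟨h1, h4⟩, h3⟩
    · rintro ⟨⟨h1, h4⟩, h3⟩; exact ⟨⟨h1, by rw [h4]; exact hi, h3⟩, h4⟩
  · intro w hw
    simp only [coe_filter, mem_univ, true_and, Set.mem_ofPred_eq] at hw
    exact hw.2.1

lemma LInv.level_card (h : LInv K t loc s) (d : ℕ) :
    (univ.filter fun w => (loc w).1 = d).card = 2 ^ d * s d := by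
  have h1 := h.level d (range (2 ^ d)) (fun _ => True)
  have h2 : (univ.filter fun w => (loc w).1 = d ∧ (loc w).2 ∈ range (2 ^ d) ∧ True) =
      univ.filter fun w => (loc w).1 = d := by
    apply filter_congr
    intro w _
    simp only [mem_range, and_true, and_iff_left_iff_imp]
    intro hd; rw [← hd]; exact h.idx_lt w
  rw [h2] at h1
  rw [h1]
  simp only [and_true]
  rw [Finset.sum_congr rfl (fun i hi => by rw [h.cnt, if_pos (mem_range.mp hi)])]
  simp

lemma LInv.depth_le (h : LInv K t loc s) (d : ℕ) (hd : s d ≠ 0) : d ≤ K := by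
  have h1 := h.level_card d
  have h2 : (univ.filter fun w => (loc w).1 = d).card ≤ 2 ^ K := by
    refine (card_le_univ _).trans ?_
    simp
  rw [h1] at h2
  have : 2 ^ d ≤ 2 ^ K := le_trans (Nat.le_mul_of_pos_right _ (Nat.pos_of_ne_zero hd)) h2
  exact (Nat.pow_le_pow_iff_right (by norm_num)).mp this

lemma LInv.total (h : LInv K t loc s) : ∑ e ∈ range (K + 1), 2 ^ e * s e = 2 ^ K := by
  have h1 : (univ : Finset (Fin (2 ^ K))).card =
      ∑ e ∈ range (K + 1), (univ.filter fun w => (loc w).1 = e).card := by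
    apply Finset.card_eq_sum_card_fiberwise (f := fun w => (loc w).1) (t := range (K + 1))
    intro w _
    have := h.depth_le _ (h.s_ne w)
    simp; omega
  rw [card_univ, Fintype.card_fin] at h1
  rw [h1]
  exact Finset.sum_congr rfl fun e _ => (h.level_card e).symm

lemma LInv.even (h : LInv K t loc s) (hK : rr K t < K) (d : ℕ) (hd : d < rr K (t + 1)) : 2 ∣ s d := by
  by_cases h0 : s d = 0
  · simp [h0]
  have hdr : d = rr K t := by
    have := (h.par d h0).2
    have := rr_succ K t
    omega
  have h1 := h.total
  rw [← Finset.add_sum_erase _ _ (mem_range.mpr (show d < K + 1 by omega))] at h1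
  have h2 : 2 ^ (d + 1) ∣ ∑ x ∈ (range (K + 1)).erase d, 2 ^ x * s x := by
    apply Finset.dvd_sum
    intro e he
    by_cases he0 : s e = 0
    · simp [he0]
    · have := (h.par e he0).2
      have hne : e ≠ d := (mem_erase.mp he).1
      exact Dvd.dvd.mul_right (pow_dvd_pow 2 (by omega)) _
  have h3 : 2 ^ (d + 1) ∣ 2 ^ d * s d := by
    rw [← Nat.dvd_add_left h2, h1]
    exact pow_dvd_pow 2 (by omega)
  rw [pow_succ] at h3
  exact Nat.dvd_of_mul_dvd_mul_left (by positivity) h3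

lemma LInv.nostrange (_ : LInv K t loc s) (x : Fin (2 ^ K) → ℕ) (hx : IsKey K x) (hS : SInv K t loc x)
    (d i j : ℕ) (hi : i < 2 ^ d) (hpar : d % 2 = t % 2) (hd : d < rr K (t + 1)) :
    (univ.filter fun w => loc w = (d, i) ∧ x w / 2 ^ (K - d + j) ≠ i / 2 ^ j).card = 0 := by
  rcases Nat.eq_zero_or_pos d with h0 | h0
  · subst h0
    rw [card_eq_zero, filter_eq_empty_iff]
    rintro w - ⟨-, h2⟩
    apply h2
    have : i = 0 := by simpa using hi
    rw [this, Nat.zero_div, Nat.div_eq_zero_iff]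
    right
    refine (hx.2 w).trans_le (Nat.pow_le_pow_right (by norm_num) (by omega))
  · have h1 := rr_min K (t + 1) (d - 1) (by omega) (by omega)
    have h2 : bb K t d = 4 * bb K t (d - 1) := by
      rw [← bb_succ_d]; congr 1; omega
    rw [bb_succ_t] at h1
    have h3 := hS d i j
    have h4 : ((1:ℝ) / 256) ^ j ≤ 1 := pow_le_one₀ (by norm_num) (by norm_num)
    have h5 := bb_pos K t d
    have h6 : ((univ.filter fun w => loc w = (d, i) ∧ x w / 2 ^ (K - d + j) ≠ i / 2 ^ j).card : ℝ) < 1 := by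
      refine h3.trans_lt ?_
      nlinarith
    have h7 : (univ.filter fun w => loc w = (d, i) ∧ x w / 2 ^ (K - d + j) ≠ i / 2 ^ j).card < 1 := by
      exact_mod_cast h6
    omega

end

end AKS

namespace AKS

lemma geom_aux (n : ℕ) : ∑ k ∈ range n, (if k = 0 then (0:ℝ) else (1 / 32) ^ k) ≤ 1 / 31 := by
  rcases n with _ | n
  · simp
  · have : ∑ k ∈ range (n + 1), (if k = 0 then (0:ℝ) else (1 / 32) ^ k) = 1 / 31 * (1 - (1 / 32) ^ n) := by
      induction n with
      | zero => simp
      | succ n ih => rw [sum_range_succ, ih, if_neg (by omega)]; ring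
    rw [this]
    have : (0:ℝ) ≤ (1 / 32) ^ n := by positivity
    linarith

lemma geom_aux2 (n : ℕ) : ∑ k ∈ range n, (8:ℝ) ^ k ≤ 8 ^ n / 7 := by
  induction n with
  | zero => simp
  | succ n ih => rw [sum_range_succ, pow_succ]; linarith

lemma geom_aux3 (d : ℕ) (u : ℕ → ℝ) (C : ℝ) (hC : 0 ≤ C) (hu : ∀ e, u e ≤ 8 ^ e * C) (hu0 : ∀ e, e + 1 = d → u e = 0) :
    ∑ e ∈ range d, u e ≤ 8 ^ d * C / 56 := by
  rcases d with _ | d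
  · simp; positivity
  · rw [sum_range_succ, hu0 d rfl, add_zero]
    calc _ ≤ ∑ e ∈ range d, 8 ^ e * C := Finset.sum_le_sum fun e _ => hu e
      _ = (∑ e ∈ range d, 8 ^ e) * C := by rw [sum_mul]
      _ ≤ 8 ^ d / 7 * C := by gcongr; exact geom_aux2 d
      _ = _ := by rw [pow_succ]; ring

section
variable {K t : ℕ} {loc : Fin (2 ^ K) → ℕ × ℕ} {s : ℕ → ℕ}

lemma LInv.balance_nat (h : LInv K t loc s) (x : Fin (2 ^ K) → ℕ) (hx : IsKey K x)
    (d i c : ℕ) (hd : d < K) (hc : c < 2 ^ (d + 1)) :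
    (univ.filter fun w => loc w = (d, i) ∧ x w / 2 ^ (K - d - 1) = c).card +
      ∑ k ∈ range (K - d), 2 ^ k * s (d + 1 + k) ≤ 2 ^ (K - d - 1) +
      ∑ k ∈ range (K - d), ∑ i' ∈ Ico (c * 2 ^ k) ((c + 1) * 2 ^ k),
        (univ.filter fun w => loc w = (d + 1 + k, i') ∧
          x w / 2 ^ (K - (d + 1 + k) + k) ≠ i' / 2 ^ k).card := by
  set D := K - d - 1 with hD
  let B : ℕ → Finset (Fin (2 ^ K)) := fun k => univ.filter fun w =>
    (loc w).1 = d + 1 + k ∧ (loc w).2 ∈ Ico (c * 2 ^ k) ((c + 1) * 2 ^ k) ∧ x w / 2 ^ D = c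
  let A := univ.filter fun w => loc w = (d, i) ∧ x w / 2 ^ D = c
  have h1 : A.card + ∑ k ∈ range (K - d), (B k).card ≤ 2 ^ D := by
    rw [← card_biUnion, ← card_union_of_disjoint]
    · have hsub : (A ∪ (range (K - d)).biUnion B).image x ⊆ Ico (c * 2 ^ D) ((c + 1) * 2 ^ D) := by
        intro y hy
        obtain ⟨w, hw, rfl⟩ := mem_image.mp hy
        have : x w / 2 ^ D = c := by
          rcases mem_union.mp hw with hw | hw
          · exact (mem_filter.mp hw).2.2
          · obtain ⟨k, -, hk⟩ := mem_biUnion.mp hw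
            exact (mem_filter.mp hk).2.2.2
        rw [mem_Ico, ← this]
        exact ⟨Nat.div_mul_le_self _ _, by
          rw [← Nat.div_lt_iff_lt_mul (by positivity)]; omega⟩
      rw [← card_image_of_injective _ hx.1]
      refine (card_le_card hsub).trans ?_
      rw [Nat.card_Ico, Nat.add_mul]; omega
    · rw [disjoint_left]
      intro w hw hw'
      obtain ⟨k, -, hk⟩ := mem_biUnion.mp hw'
      have a1 := (mem_filter.mp hw).2.1
      have a2 := (mem_filter.mp hk).2.1
      rw [a1] at a2
      simp at a2; omega
    · intro k _ k' _ hkk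
      rw [Function.onFun, disjoint_left]
      intro w hw hw'
      have a1 := (mem_filter.mp hw).2.1
      have a2 := (mem_filter.mp hw').2.1
      omega
  have h2 : ∀ k ∈ range (K - d), 2 ^ k * s (d + 1 + k) = (B k).card +
      ∑ i' ∈ Ico (c * 2 ^ k) ((c + 1) * 2 ^ k), (univ.filter fun w => loc w = (d + 1 + k, i') ∧
          x w / 2 ^ (K - (d + 1 + k) + k) ≠ i' / 2 ^ k).card := by
    intro k hk
    have hk' := mem_range.mp hk
    have e1 : K - (d + 1 + k) + k = D := by omega
    simp only [B]
    rw [h.level (d + 1 + k) (Ico (c * 2 ^ k) ((c + 1) * 2 ^ k)) (fun w => x w / 2 ^ D = c),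
      ← Finset.sum_add_distrib]
    rw [Finset.sum_congr rfl (g := fun _ => s (d + 1 + k))]
    · rw [sum_const, Nat.card_Ico, Nat.add_mul]; simp
    · intro i' hi'
      rw [mem_Ico] at hi'
      have e2 : i' / 2 ^ k = c := by
        rw [Nat.div_eq_iff (by positivity)]
        rw [Nat.add_mul] at hi'
        omega
      have e3 : i' < 2 ^ (d + 1 + k) := by
        calc i' < (c + 1) * 2 ^ k := hi'.2
          _ ≤ 2 ^ (d + 1) * 2 ^ k := Nat.mul_le_mul_right _ hc
          _ = _ := by rw [← pow_add]
      rw [e1, e2]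
      have := h.cnt (d + 1 + k) i'
      rw [if_pos e3] at this
      rw [← this, ← filter_filter, ← filter_filter]
      exact Finset.card_filter_add_card_filter_not _
  rw [Finset.sum_congr rfl h2, Finset.sum_add_distrib]
  change A.card + _ ≤ _
  omega

lemma LInv.balance (h : LInv K t loc s) (x : Fin (2 ^ K) → ℕ) (hx : IsKey K x) (hS : SInv K t loc x)
    (d i c : ℕ) (hd : d < K) (hpar : d % 2 = t % 2) (hc : c < 2 ^ (d + 1)) :
    ((univ.filter fun w => loc w = (d, i) ∧ x w / 2 ^ (K - d - 1) = c).card : ℝ) ≤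
      s d / 2 + (bb K t d / 112 + 1 / 64 * bb K t d * (4 / 31)) := by
  have hnat := h.balance_nat x hx d i c hd hc
  set N := (univ.filter fun w => loc w = (d, i) ∧ x w / 2 ^ (K - d - 1) = c).card
  have hzero : ∀ e, e % 2 ≠ t % 2 → s e = 0 := fun e he => by
    by_contra h0; exact he (h.par e h0).1
  set b := bb K t d with hb
  have hbpos : 0 < b := bb_pos K t d
  have hstr : ∀ k ∈ range (K - d), ((∑ i' ∈ Ico (c * 2 ^ k) ((c + 1) * 2 ^ k),
        (univ.filter fun w => loc w = (d + 1 + k, i') ∧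
          x w / 2 ^ (K - (d + 1 + k) + k) ≠ i' / 2 ^ k).card : ℕ) : ℝ) ≤
      (1 / 64 * b * 4) * (if k = 0 then (0:ℝ) else (1 / 32) ^ k) := by
    intro k _
    by_cases hk0 : k = 0
    · subst hk0
      rw [if_pos rfl, mul_zero]
      have : ∀ i' ∈ Ico (c * 2 ^ 0) ((c + 1) * 2 ^ 0), (univ.filter fun w => loc w = (d + 1 + 0, i') ∧
          x w / 2 ^ (K - (d + 1 + 0) + 0) ≠ i' / 2 ^ 0).card = 0 := by
        intro i' _
        rw [card_eq_zero, filter_eq_empty_iff]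
        rintro w - ⟨hw, -⟩
        have := h.s_ne w
        rw [hw] at this
        exact this (hzero _ (by simp only; omega))
      rw [Finset.sum_eq_zero this]; simp
    · rw [if_neg hk0]
      push_cast
      calc _ ≤ ∑ i' ∈ Ico (c * 2 ^ k) ((c + 1) * 2 ^ k), (1 / 64 * (1 / 256) ^ k * bb K t (d + 1 + k) : ℝ) :=
            Finset.sum_le_sum fun i' _ => hS _ _ _
        _ = 2 ^ k * (1 / 64 * (1 / 256) ^ k * bb K t (d + 1 + k)) := by
            rw [sum_const, Nat.card_Ico, Nat.add_mul, Nat.add_sub_cancel_left]; simp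
        _ = _ := by
            have : bb K t (d + 1 + k) = 4 * 4 ^ k * b := by rw [hb]; unfold bb; ring
            rw [this]
            have : (1 / 32 : ℝ) ^ k = 2 ^ k * (1 / 256) ^ k * 4 ^ k := by
              rw [← mul_pow, ← mul_pow]; norm_num
            rw [this]; ring
  have hstr2 := Finset.sum_le_sum hstr
  rw [← mul_sum] at hstr2
  have hg := geom_aux (K - d)
  have hN : (N:ℝ) + ∑ k ∈ range (K - d), (2:ℝ) ^ k * s (d + 1 + k) ≤ 2 ^ (K - d - 1) +
      (1 / 64 * b * 4) * (1 / 31) := by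
    have h1 : (N:ℝ) + ∑ k ∈ range (K - d), (2:ℝ) ^ k * s (d + 1 + k) ≤ 2 ^ (K - d - 1) +
      ∑ k ∈ range (K - d), ((∑ i' ∈ Ico (c * 2 ^ k) ((c + 1) * 2 ^ k),
        (univ.filter fun w => loc w = (d + 1 + k, i') ∧
          x w / 2 ^ (K - (d + 1 + k) + k) ≠ i' / 2 ^ k).card : ℕ) : ℝ) := by exact_mod_cast hnat
    have h2 : (1 / 64 * b * 4) * ∑ k ∈ range (K - d), (if k = 0 then (0:ℝ) else (1 / 32) ^ k) ≤
      (1 / 64 * b * 4) * (1 / 31) := by gcongr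
    linarith
  have htot : ∑ e ∈ range (K + 1), (2:ℝ) ^ e * s e = 2 ^ K := by exact_mod_cast h.total
  have eK : K + 1 = (d + 1) + (K - d) := by omega
  rw [eK, Finset.sum_range_add, sum_range_succ] at htot
  have e2 : ∑ k ∈ range (K - d), (2:ℝ) ^ (d + 1 + k) * s (d + 1 + k) =
      2 ^ (d + 1) * ∑ k ∈ range (K - d), (2:ℝ) ^ k * s (d + 1 + k) := by
    rw [mul_sum]; apply Finset.sum_congr rfl; intro k _; rw [pow_add]; ring
  have e3 : (2:ℝ) ^ K = 2 ^ (d + 1) * 2 ^ (K - d - 1) := by rw [← pow_add]; congr 1; omega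
  rw [e2, e3] at htot
  have hlow : ∑ e ∈ range d, (2:ℝ) ^ e * s e ≤ 8 ^ d * (2 ^ K * (3 / 4) ^ t) / 56 := by
    apply geom_aux3
    · positivity
    · intro e
      calc (2:ℝ) ^ e * s e ≤ 2 ^ e * bb K t e := by gcongr; exact h.cap e
        _ = _ := by
          unfold bb
          have : (8:ℝ) ^ e = 2 ^ e * 4 ^ e := by rw [← mul_pow]; norm_num
          rw [this]; ring
    · intro e he; rw [hzero e (by omega)]; simp
  have e4 : (8:ℝ) ^ d * (2 ^ K * (3 / 4) ^ t) = 2 ^ d * b := by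
    rw [hb]; unfold bb
    have : (8:ℝ) ^ d = 2 ^ d * 4 ^ d := by rw [← mul_pow]; norm_num
    rw [this]; ring
  rw [e4] at hlow
  have hp : (0:ℝ) < 2 ^ d := by positivity
  set Z := ∑ k ∈ range (K - d), (2:ℝ) ^ k * s (d + 1 + k)
  set Y := ∑ e ∈ range d, (2:ℝ) ^ e * s e
  rw [pow_succ] at htot
  have h5 : (2:ℝ) ^ d * (2 * (2 ^ (K - d - 1) - Z)) ≤ 2 ^ d * (b / 56 + s d) := by linarith
  have h6 := le_of_mul_le_mul_left h5 hp
  linarith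

end

end AKS

namespace AKS

/-- The separation property of a list of stages on positions. -/
def IsSep (Q m f : ℕ) (L : List (CStage ℕ)) : Prop :=
    (∀ s ∈ L, ∀ p, (p < 2 * m → s.σ p < 2 * m) ∧ (2 * m ≤ p → s.σ p = p)) ∧
    ∀ (b : ℕ → Bool) (k1 k0 : ℕ), ((range (2 * m)).filter fun p => b p = true).card = k1 →
      ((range (2 * m)).filter fun p => b p = false).card = k0 →
      (Q * (((Ico 0 m).filter fun p => crun L b p = true).card - (k1 - m)) ≤ m) ∧
      (Q * (((Ico m (2 * m)).filter fun p => crun L b p = false).card - (k0 - m)) ≤ m) ∧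
      (k1 ≤ f → Q * ((Ico f (2 * m - f)).filter fun p => crun L b p = true).card ≤ k1) ∧
      (k0 ≤ f → Q * ((Ico f (2 * m - f)).filter fun p => crun L b p = false).card ≤ k0)

lemma thr_mono (θ : ℕ) : Monotone (fun x : ℕ => decide (θ ≤ x)) := by
  intro a b hab
  by_cases h : θ ≤ a
  · have : θ ≤ b := h.trans hab
    simp [h, this]
  · simp [h]

lemma IsSep.thr {Q m f : ℕ} {L : List (CStage ℕ)} (h : IsSep Q m f L) (X : ℕ → ℕ) (θ : ℕ) :
    (Q * (((Ico 0 m).filter fun p => θ ≤ crun L X p).card -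
      (((range (2 * m)).filter fun p => θ ≤ X p).card - m)) ≤ m) ∧
    (Q * (((Ico m (2 * m)).filter fun p => crun L X p < θ).card -
      (((range (2 * m)).filter fun p => X p < θ).card - m)) ≤ m) ∧
    (((range (2 * m)).filter fun p => θ ≤ X p).card ≤ f →
      Q * ((Ico f (2 * m - f)).filter fun p => θ ≤ crun L X p).card ≤
        ((range (2 * m)).filter fun p => θ ≤ X p).card) ∧
    (((range (2 * m)).filter fun p => X p < θ).card ≤ f →
      Q * ((Ico f (2 * m - f)).filter fun p => crun L X p < θ).card ≤
        ((range (2 * m)).filter fun p => X p < θ).card) := by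
  have := h.2 (fun p => decide (θ ≤ X p)) _ _ rfl rfl
  rw [crun_mono L (thr_mono θ) X] at this
  simpa only [decide_eq_true_eq, decide_eq_false_iff_not, not_le] using this

lemma IsSep.mid {Q m f sz : ℕ} {L : List (CStage ℕ)} (h : IsSep Q m f L) (hsz : 2 * m ≤ sz)
    (X : ℕ → ℕ) (lo hi : ℕ) (hlh : lo ≤ hi)
    (hS : ((range sz).filter fun p => X p < lo ∨ hi ≤ X p).card ≤ f ∨ f = m) :
    Q * ((Ico f (2 * m - f)).filter fun p => crun L X p < lo ∨ hi ≤ crun L X p).card ≤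
      ((range sz).filter fun p => X p < lo ∨ hi ≤ X p).card := by
  rcases hS with hS | hS
  · have h1 := (h.thr X lo).2.2.2
    have h2 := (h.thr X hi).2.2.1
    have h3 : ((range (2 * m)).filter fun p => X p < lo).card +
        ((range (2 * m)).filter fun p => hi ≤ X p).card ≤
        ((range sz).filter fun p => X p < lo ∨ hi ≤ X p).card := by
      rw [← card_union_of_disjoint]
      · apply card_le_card
        intro p
        simp only [mem_union, mem_filter, mem_range]
        rintro (⟨h1, h2⟩ | ⟨h1, h2⟩)
        · exact ⟨by omega, Or.inl h2⟩
        · exact ⟨by omega, Or.inr h2⟩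
      · rw [disjoint_left]; intro p
        simp only [mem_filter, mem_range]
        omega
    have h4 : ((Ico f (2 * m - f)).filter fun p => crun L X p < lo ∨ hi ≤ crun L X p).card ≤
        ((Ico f (2 * m - f)).filter fun p => crun L X p < lo).card +
        ((Ico f (2 * m - f)).filter fun p => hi ≤ crun L X p).card := by
      rw [filter_or]; exact card_union_le _ _
    have h5 := Nat.mul_le_mul_left Q h4
    rw [Nat.mul_add] at h5
    have := h1 (by omega)
    have := h2 (by omega)
    omega
  · have : Ico f (2 * m - f) = ∅ := Ico_eq_empty (by omega)
    rw [this]; simp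

lemma bag_count {W N : Type*} [Fintype W] [DecidableEq N] {loc : W → N} {idx : W → ℕ} {wire : N → ℕ → W}
    (h1 : ∀ w, wire (loc w) (idx w) = w)
    (h1' : ∀ w, idx w < (univ.filter fun w' => loc w' = loc w).card)
    (h2 : ∀ n p, p < (univ.filter fun w' => loc w' = n).card → loc (wire n p) = n ∧ idx (wire n p) = p)
    (n : N) (sz : ℕ) (hsz : (univ.filter fun w' => loc w' = n).card = sz)
    (R : ℕ → W → Prop) [∀ p w, Decidable (R p w)] :
    (univ.filter fun w => loc w = n ∧ R (idx w) w).card =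
      ((range sz).filter fun p => R p (wire n p)).card := by
  subst hsz
  apply card_bij (fun w _ => idx w)
  · intro w hw
    simp only [mem_filter, mem_univ, true_and, mem_range] at hw ⊢
    obtain ⟨rfl, hR⟩ := hw
    rw [h1]
    exact ⟨h1' w, hR⟩
  · intro w hw w' hw' he
    simp only [mem_filter, mem_univ, true_and] at hw hw'
    rw [← h1 w, ← h1 w', hw.1, hw'.1, he]
  · intro p hp
    simp only [mem_filter, mem_range] at hp
    obtain ⟨e1, e2⟩ := h2 n p hp.1
    refine ⟨wire n p, ?_, e2⟩
    simp only [mem_filter, mem_univ, true_and, e1, e2]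
    exact hp.2

lemma div_ne_iff (y q c : ℕ) (hq : 0 < q) : y / q ≠ c ↔ y < c * q ∨ (c + 1) * q ≤ y := by
  rw [← Nat.div_lt_iff_lt_mul hq, ← Nat.le_div_iff_mul_le hq]
  omega

end AKS

namespace AKS

/-- Data for a single step of the AKS network. -/
structure StepCtx (K t : ℕ) (loc : Fin (2 ^ K) → ℕ × ℕ) (s : ℕ → ℕ) (idx : Fin (2 ^ K) → ℕ)
    (wire : ℕ × ℕ → ℕ → Fin (2 ^ K)) (f : ℕ → ℕ) (sep : ℕ → List (CStage ℕ)) : Prop where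
  inv : LInv K t loc s
  hK : rr K t < K
  h1 : ∀ w, wire (loc w) (idx w) = w
  h1' : ∀ w, idx w < (univ.filter fun w' => loc w' = loc w).card
  h2 : ∀ n p, p < (univ.filter fun w' => loc w' = n).card → loc (wire n p) = n ∧ idx (wire n p) = p
  hf : ∀ d, f d ≤ s d / 2
  hf1 : ∀ d, (f d : ℝ) ≤ 1 / 64 * bb K t d
  hf0 : ∀ d, d < rr K (t + 1) → f d = 0
  hf2 : ∀ d, ¬ d < rr K (t + 1) → f d = s d / 2 ∨ ∀ n : ℕ, (n : ℝ) ≤ 1 / 64 * bb K t d → n ≤ f d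
  hsep : ∀ d, IsSep 256 (s d / 2) (f d) (sep d)

section
variable {K t : ℕ} {loc : Fin (2 ^ K) → ℕ × ℕ} {s : ℕ → ℕ} {idx : Fin (2 ^ K) → ℕ}
    {wire : ℕ × ℕ → ℕ → Fin (2 ^ K)} {f : ℕ → ℕ} {sep : ℕ → List (CStage ℕ)}

/-- Relation between the keys before and after the step. -/
def Stepped (loc : Fin (2 ^ K) → ℕ × ℕ) (idx : Fin (2 ^ K) → ℕ)
    (wire : ℕ × ℕ → ℕ → Fin (2 ^ K)) (sep : ℕ → List (CStage ℕ)) (x x' : Fin (2 ^ K) → ℕ) : Prop :=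
  ∀ w, x' w = crun (sep (loc w).1) (fun p => x (wire (loc w) p)) (idx w)

lemma StepCtx.sz (C : StepCtx K t loc s idx wire f sep) {d i : ℕ} (hi : i < 2 ^ d) :
    (univ.filter fun w => loc w = (d, i)).card = s d := by
  rw [C.inv.cnt, if_pos hi]

lemma StepCtx.idx_lt (C : StepCtx K t loc s idx wire f sep) (w) : idx w < s (loc w).1 := by
  have := C.h1' w
  rwa [C.sz (d := (loc w).1) (i := (loc w).2) (C.inv.idx_lt w)] at this

lemma StepCtx.pos (C : StepCtx K t loc s idx wire f sep) {x x' : Fin (2 ^ K) → ℕ}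
    (hx' : Stepped loc idx wire sep x x') {d i : ℕ} (hi : i < 2 ^ d) {p : ℕ} (hp : p < s d) :
    x' (wire (d, i) p) = crun (sep d) (fun p => x (wire (d, i) p)) p := by
  obtain ⟨e1, e2⟩ := C.h2 (d, i) p (by rw [C.sz hi]; exact hp)
  rw [hx', e1, e2]

lemma StepCtx.count (C : StepCtx K t loc s idx wire f sep) {x x' : Fin (2 ^ K) → ℕ}
    (hx' : Stepped loc idx wire sep x x') {d i : ℕ} (hi : i < 2 ^ d) (R : ℕ → ℕ → Prop)
    [∀ p y, Decidable (R p y)] :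
    (univ.filter fun w => loc w = (d, i) ∧ R (idx w) (x' w)).card =
      ((range (s d)).filter fun p => R p (crun (sep d) (fun p => x (wire (d, i) p)) p)).card := by
  rw [bag_count C.h1 C.h1' C.h2 (d, i) (s d) (C.sz hi) (fun p w => R p (x' w))]
  congr 1
  apply filter_congr
  intro p hp
  rw [C.pos hx' hi (mem_range.mp hp)]

lemma StepCtx.count0 (C : StepCtx K t loc s idx wire f sep) (x : Fin (2 ^ K) → ℕ)
    {d i : ℕ} (hi : i < 2 ^ d) (R : ℕ → Prop) [DecidablePred R] :
    (univ.filter fun w => loc w = (d, i) ∧ R (x w)).card =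
      ((range (s d)).filter fun p => R (x (wire (d, i) p))).card :=
  bag_count C.h1 C.h1' C.h2 (d, i) (s d) (C.sz hi) (fun _ w => R (x w))

lemma StepCtx.conserve (C : StepCtx K t loc s idx wire f sep) {x x' : Fin (2 ^ K) → ℕ}
    (hx' : Stepped loc idx wire sep x x') {d i : ℕ} (hi : i < 2 ^ d) (R : ℕ → Prop)
    [DecidablePred R] :
    (univ.filter fun w => loc w = (d, i) ∧ R (x' w)).card =
      (univ.filter fun w => loc w = (d, i) ∧ R (x w)).card := by
  rw [C.count hx' hi (fun _ y => R y), C.count0 x hi R]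
  apply crun_card (sep d) (fun p => x (wire (d, i) p)) (range (s d))
  intro st hst p hp
  have := (C.hsep d).1 st hst p
  simp only [mem_range] at hp ⊢
  by_cases h : p < 2 * (s d / 2)
  · have := this.1 h; omega
  · rw [this.2 (by omega)]; exact hp

/-- Strangers sent down from a bag. -/
lemma StepCtx.mid (C : StepCtx K t loc s idx wire f sep) {x x' : Fin (2 ^ K) → ℕ}
    (hx : IsKey K x) (hS : SInv K t loc x)
    (hx' : Stepped loc idx wire sep x x') {d i : ℕ} (hi : i < 2 ^ d) (hs : s d ≠ 0) (j : ℕ) :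
    256 * (univ.filter fun w => loc w = (d, i) ∧ ((f d ≤ idx w ∧ idx w < 2 * (s d / 2) - f d) ∧
      x' w / 2 ^ (K - d + j) ≠ i / 2 ^ j)).card ≤
      (univ.filter fun w => loc w = (d, i) ∧ x w / 2 ^ (K - d + j) ≠ i / 2 ^ j).card := by
  rw [C.count hx' hi (fun p y => (f d ≤ p ∧ p < 2 * (s d / 2) - f d) ∧ y / 2 ^ (K - d + j) ≠ i / 2 ^ j),
    C.count0 x hi (fun y => y / 2 ^ (K - d + j) ≠ i / 2 ^ j)]
  have hq : 0 < 2 ^ (K - d + j) := by positivity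
  have hS' := hS d i j
  have hno := C.inv.nostrange x hx hS d i j hi (C.inv.par d hs).1
  rw [C.count0 x hi (fun y => y / 2 ^ (K - d + j) ≠ i / 2 ^ j)] at hS' hno
  simp only [div_ne_iff _ _ _ hq] at hS' hno ⊢
  refine le_trans ?_ ((C.hsep d).mid (sz := s d) (by omega) (fun p => x (wire (d, i) p))
    (i / 2 ^ j * 2 ^ (K - d + j)) ((i / 2 ^ j + 1) * 2 ^ (K - d + j))
    (Nat.mul_le_mul_right _ (by omega)) ?_)
  · apply Nat.mul_le_mul_left
    apply card_le_card
    intro p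
    simp only [mem_filter, mem_Ico]
    rintro ⟨h1, h2, h3⟩
    exact ⟨h2, h3⟩
  · by_cases hd : d < rr K (t + 1)
    · left
      rw [hno hd]; omega
    · rcases C.hf2 d hd with h | h
      · right; exact h
      · left
        apply h
        refine hS'.trans ?_
        have h4 : ((1:ℝ) / 256) ^ j ≤ 1 := pow_le_one₀ (by norm_num) (by norm_num)
        have := bb_pos K t d
        nlinarith

/-- Final estimate used for level-0 strangers. -/
lemma numeric_side (b N S0 S1 sd c1 c2 : ℝ) (m k : ℕ) (hm : (m:ℝ) ≤ sd / 2)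
    (hN : N ≤ sd / 2 + (b / 112 + 1 / 64 * b * (4 / 31)))
    (hNk : (k : ℝ) ≤ N + S0) (hm2 : sd / 2 ≤ m + 1 / 2) (Nn : ℕ) (hNn : (Nn : ℝ) = N)
    (hsd : sd ≤ b) (hS0 : S0 ≤ 1 / 64 * b) (hS0' : 0 ≤ S0) (h1 : 256 * c1 ≤ S1) (hS1 : S1 ≤ 1 / 64 * b)
    (cn : ℕ) (hcn : (cn : ℝ) = c2) (h2 : 256 * (cn - (k - m)) ≤ m) (hb : 0 < b) : c1 + c2 ≤ 1 / 25 * b := by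
  have h3 : c2 ≤ m / 256 + ((k - m : ℕ) : ℝ) := by
    have : (256 * (cn : ℝ)) ≤ m + 256 * ((k - m : ℕ) : ℝ) := by
      have : 256 * cn ≤ m + 256 * (k - m) := by omega
      exact_mod_cast this
    rw [← hcn]; linarith
  have h4 : ((k - m : ℕ) : ℝ) ≤ 2 * (b / 112 + 1 / 64 * b * (4 / 31)) + S0 := by
    rcases le_total k m with hkm | hkm
    · rw [Nat.sub_eq_zero_of_le hkm]
      push_cast; positivity
    · rw [Nat.cast_sub hkm]
      rcases Nat.lt_or_ge m Nn with hlt | hge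
      · have : (m:ℝ) + 1 ≤ Nn := by exact_mod_cast hlt
        rw [hNn] at this
        linarith
      · have : (Nn:ℝ) ≤ m := by exact_mod_cast hge
        rw [hNn] at this
        have : 0 ≤ b / 112 + 1 / 64 * b * (4 / 31) := by positivity
        linarith
  linarith

lemma StepCtx.left (C : StepCtx K t loc s idx wire f sep) {x x' : Fin (2 ^ K) → ℕ}
    (hx : IsKey K x) (hS : SInv K t loc x)
    (hx' : Stepped loc idx wire sep x x') {d i : ℕ} (hi : i < 2 ^ d) (hs : s d ≠ 0) (hd : d < K) :
    ((univ.filter fun w => loc w = (d, i) ∧ ((f d ≤ idx w ∧ idx w < s d / 2) ∧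
      x' w / 2 ^ (K - d - 1) ≠ 2 * i)).card : ℝ) ≤ 1 / 25 * bb K t d := by
  set D := K - d - 1 with hD
  have eD : K - d + 0 = D + 1 := by omega
  have hq : 0 < 2 ^ D := by positivity
  have hmid := C.mid hx hS hx' hi hs 0
  have hfm := C.hf d
  have hbal := C.inv.balance x hx hS d i (2 * i + 1) hd (C.inv.par d hs).1 (by rw [pow_succ]; omega)
  rw [← hD] at hbal
  have hS0 := hS d i 0
  rw [eD, pow_succ, pow_zero, Nat.div_one] at hmid hS0
  rw [pow_zero, mul_one] at hS0
  have hthr := ((C.hsep d).thr (fun p => x (wire (d, i) p)) ((2 * i + 1) * 2 ^ D)).1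
  set k := ((range (2 * (s d / 2))).filter fun p => (2 * i + 1) * 2 ^ D ≤ x (wire (d, i) p)).card with hk
  set cn := ((Ico 0 (s d / 2)).filter fun p => (2 * i + 1) * 2 ^ D ≤
    crun (sep d) (fun p => x (wire (d, i) p)) p).card with hcn
  set S0 := (univ.filter fun w => loc w = (d, i) ∧ x w / (2 ^ D * 2) ≠ i).card with hS0def
  set Nn := (univ.filter fun w => loc w = (d, i) ∧ x w / 2 ^ D = 2 * i + 1).card with hNn
  set c1 := (univ.filter fun w => loc w = (d, i) ∧ ((f d ≤ idx w ∧ idx w < 2 * (s d / 2) - f d) ∧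
      x' w / (2 ^ D * 2) ≠ i)).card with hc1
  have hkN : k ≤ Nn + S0 := by
    rw [hk, hNn, hS0def, C.count0 x hi (fun y => y / 2 ^ D = 2 * i + 1),
      C.count0 x hi (fun y => y / (2 ^ D * 2) ≠ i)]
    refine le_trans (card_le_card ?_) (card_union_le _ _)
    intro p
    simp only [mem_union, mem_filter, mem_range]
    rintro ⟨a1, a2⟩
    rw [← Nat.le_div_iff_mul_le hq] at a2
    rw [← Nat.div_div_eq_div_mul]
    have : p < s d := by omega
    simp only [this, true_and]
    omega
  have htot : (univ.filter fun w => loc w = (d, i) ∧ ((f d ≤ idx w ∧ idx w < s d / 2) ∧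
      x' w / 2 ^ D ≠ 2 * i)).card ≤ c1 + cn := by
    rw [hc1, hcn, C.count hx' hi (fun p y => (f d ≤ p ∧ p < s d / 2) ∧ y / 2 ^ D ≠ 2 * i),
      C.count hx' hi (fun p y => (f d ≤ p ∧ p < 2 * (s d / 2) - f d) ∧ y / (2 ^ D * 2) ≠ i)]
    refine le_trans (card_le_card ?_) (card_union_le _ _)
    intro p
    simp only [mem_union, mem_filter, mem_range, mem_Ico]
    rintro ⟨a1, ⟨a2, a3⟩, a4⟩
    rw [← Nat.le_div_iff_mul_le hq, ← Nat.div_div_eq_div_mul]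
    omega
  have hm : 2 * (s d / 2) ≤ s d := by omega
  have hm2 : s d ≤ 2 * (s d / 2) + 1 := by omega
  have hm' : (2:ℝ) * ((s d / 2 : ℕ) : ℝ) ≤ s d := by exact_mod_cast hm
  have hm2' : (s d : ℝ) ≤ 2 * ((s d / 2 : ℕ) : ℝ) + 1 := by exact_mod_cast hm2
  have hkN' : (k : ℝ) ≤ Nn + S0 := by exact_mod_cast hkN
  have hmid' : 256 * (c1 : ℝ) ≤ S0 := by exact_mod_cast hmid
  have := numeric_side (bb K t d) Nn S0 S0 (s d) c1 cn (s d / 2) k (by linarith) hbal hkN' (by linarith)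
    Nn rfl (C.inv.cap d) hS0 (by positivity) hmid' hS0 cn rfl hthr (bb_pos K t d)
  refine le_trans ?_ this
  exact_mod_cast htot

lemma StepCtx.right (C : StepCtx K t loc s idx wire f sep) {x x' : Fin (2 ^ K) → ℕ}
    (hx : IsKey K x) (hS : SInv K t loc x)
    (hx' : Stepped loc idx wire sep x x') {d i : ℕ} (hi : i < 2 ^ d) (hs : s d ≠ 0) (hd : d < K) :
    ((univ.filter fun w => loc w = (d, i) ∧ ((s d / 2 ≤ idx w ∧ idx w < 2 * (s d / 2) - f d) ∧
      x' w / 2 ^ (K - d - 1) ≠ 2 * i + 1)).card : ℝ) ≤ 1 / 25 * bb K t d := by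
  set D := K - d - 1 with hD
  have eD : K - d + 0 = D + 1 := by omega
  have hq : 0 < 2 ^ D := by positivity
  have hmid := C.mid hx hS hx' hi hs 0
  have hfm := C.hf d
  have hbal := C.inv.balance x hx hS d i (2 * i) hd (C.inv.par d hs).1 (by rw [pow_succ]; omega)
  rw [← hD] at hbal
  have hS0 := hS d i 0
  rw [eD, pow_succ, pow_zero, Nat.div_one] at hmid hS0
  rw [pow_zero, mul_one] at hS0
  have hthr := ((C.hsep d).thr (fun p => x (wire (d, i) p)) ((2 * i + 1) * 2 ^ D)).2.1
  set k := ((range (2 * (s d / 2))).filter fun p => x (wire (d, i) p) < (2 * i + 1) * 2 ^ D).card with hk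
  set cn := ((Ico (s d / 2) (2 * (s d / 2))).filter fun p =>
    crun (sep d) (fun p => x (wire (d, i) p)) p < (2 * i + 1) * 2 ^ D).card with hcn
  set S0 := (univ.filter fun w => loc w = (d, i) ∧ x w / (2 ^ D * 2) ≠ i).card with hS0def
  set Nn := (univ.filter fun w => loc w = (d, i) ∧ x w / 2 ^ D = 2 * i).card with hNn
  set c1 := (univ.filter fun w => loc w = (d, i) ∧ ((f d ≤ idx w ∧ idx w < 2 * (s d / 2) - f d) ∧
      x' w / (2 ^ D * 2) ≠ i)).card with hc1
  have hkN : k ≤ Nn + S0 := by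
    rw [hk, hNn, hS0def, C.count0 x hi (fun y => y / 2 ^ D = 2 * i),
      C.count0 x hi (fun y => y / (2 ^ D * 2) ≠ i)]
    refine le_trans (card_le_card ?_) (card_union_le _ _)
    intro p
    simp only [mem_union, mem_filter, mem_range]
    rintro ⟨a1, a2⟩
    rw [← Nat.div_lt_iff_lt_mul hq] at a2
    rw [← Nat.div_div_eq_div_mul]
    have : p < s d := by omega
    simp only [this, true_and]
    omega
  have htot : (univ.filter fun w => loc w = (d, i) ∧ ((s d / 2 ≤ idx w ∧ idx w < 2 * (s d / 2) - f d) ∧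
      x' w / 2 ^ D ≠ 2 * i + 1)).card ≤ c1 + cn := by
    rw [hc1, hcn, C.count hx' hi (fun p y => (s d / 2 ≤ p ∧ p < 2 * (s d / 2) - f d) ∧ y / 2 ^ D ≠ 2 * i + 1),
      C.count hx' hi (fun p y => (f d ≤ p ∧ p < 2 * (s d / 2) - f d) ∧ y / (2 ^ D * 2) ≠ i)]
    refine le_trans (card_le_card ?_) (card_union_le _ _)
    intro p
    simp only [mem_union, mem_filter, mem_range, mem_Ico]
    rintro ⟨a1, ⟨a2, a3⟩, a4⟩
    rw [← Nat.div_lt_iff_lt_mul hq, ← Nat.div_div_eq_div_mul]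
    omega
  have hm : 2 * (s d / 2) ≤ s d := by omega
  have hm2 : s d ≤ 2 * (s d / 2) + 1 := by omega
  have hm' : (2:ℝ) * ((s d / 2 : ℕ) : ℝ) ≤ s d := by exact_mod_cast hm
  have hm2' : (s d : ℝ) ≤ 2 * ((s d / 2 : ℕ) : ℝ) + 1 := by exact_mod_cast hm2
  have hkN' : (k : ℝ) ≤ Nn + S0 := by exact_mod_cast hkN
  have hmid' : 256 * (c1 : ℝ) ≤ S0 := by exact_mod_cast hmid
  have := numeric_side (bb K t d) Nn S0 S0 (s d) c1 cn (s d / 2) k (by linarith) hbal hkN' (by linarith)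
    Nn rfl (C.inv.cap d) hS0 (by positivity) hmid' hS0 cn rfl hthr (bb_pos K t d)
  refine le_trans ?_ this
  exact_mod_cast htot

end

end AKS

namespace AKS

/-- Item goes to the left child. -/
def goL (s f : ℕ → ℕ) (d p : ℕ) : Prop := f d ≤ p ∧ p < s d / 2
/-- Item goes to the right child. -/
def goR (s f : ℕ → ℕ) (d p : ℕ) : Prop := s d / 2 ≤ p ∧ p < 2 * (s d / 2) - f d

instance (s f : ℕ → ℕ) (d p : ℕ) : Decidable (goL s f d p) := by unfold goL; infer_instance
instance (s f : ℕ → ℕ) (d p : ℕ) : Decidable (goR s f d p) := by unfold goR; infer_instance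

/-- Which side a child is on. -/
def goSide (s f : ℕ → ℕ) (i d p : ℕ) : Prop := if i % 2 = 0 then goL s f d p else goR s f d p
instance (s f : ℕ → ℕ) (i d p : ℕ) : Decidable (goSide s f i d p) := by unfold goSide; infer_instance

/-- New location of an item. -/
def newLoc (s f : ℕ → ℕ) (n : ℕ × ℕ) (p : ℕ) : ℕ × ℕ :=
  if goL s f n.1 p then (n.1 + 1, 2 * n.2) else if goR s f n.1 p then (n.1 + 1, 2 * n.2 + 1)
  else (n.1 - 1, n.2 / 2)

lemma newLoc_eq (s f : ℕ → ℕ) (d i p d' i' : ℕ) (h0 : d = 0 → goL s f d p ∨ goR s f d p) :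
    (newLoc s f (d, i) p = (d', i')) ↔
      ((d' ≠ 0 ∧ (d, i) = (d' - 1, i' / 2) ∧ goSide s f i' (d' - 1) p) ∨
      ((d, i) = (d' + 1, 2 * i') ∧ ¬ goL s f (d' + 1) p ∧ ¬ goR s f (d' + 1) p) ∨
      ((d, i) = (d' + 1, 2 * i' + 1) ∧ ¬ goL s f (d' + 1) p ∧ ¬ goR s f (d' + 1) p)) := by
  have hLR : goL s f d p → ¬ goR s f d p := by
    unfold goL goR; omega
  unfold newLoc goSide
  simp only [Prod.mk.injEq]
  by_cases hL : goL s f d p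
  · have hR := hLR hL
    rw [if_pos hL]
    simp only [Prod.mk.injEq]
    constructor
    · rintro ⟨rfl, rfl⟩
      left
      refine ⟨by omega, ⟨by omega, by omega⟩, ?_⟩
      rw [if_pos (by omega)]; exact hL
    · rintro (⟨h1, ⟨h2, h3⟩, h4⟩ | ⟨⟨h2, h3⟩, h4, h5⟩ | ⟨⟨h2, h3⟩, h4, h5⟩)
      · rw [← h2] at h4
        split_ifs at h4 with h6
        · omega
        · exact absurd h4 hR
      · rw [← h2] at h4; exact absurd hL h4
      · rw [← h2] at h4; exact absurd hL h4
  · rw [if_neg hL]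
    by_cases hR : goR s f d p
    · rw [if_pos hR]
      simp only [Prod.mk.injEq]
      constructor
      · rintro ⟨rfl, rfl⟩
        left
        refine ⟨by omega, ⟨by omega, by omega⟩, ?_⟩
        rw [if_neg (by omega)]; exact hR
      · rintro (⟨h1, ⟨h2, h3⟩, h4⟩ | ⟨⟨h2, h3⟩, h4, h5⟩ | ⟨⟨h2, h3⟩, h4, h5⟩)
        · rw [← h2] at h4
          split_ifs at h4 with h6
          · exact absurd h4 hL
          · omega
        · rw [← h2] at h5; exact absurd hR h5
        · rw [← h2] at h5; exact absurd hR h5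
    · rw [if_neg hR]
      simp only [Prod.mk.injEq]
      have hd : d ≠ 0 := fun h => (h0 h).elim hL hR
      constructor
      · rintro ⟨h1, h2⟩
        right
        have : d' + 1 = d := by omega
        rw [this]
        rcases Nat.mod_two_eq_zero_or_one i with h | h
        · left; exact ⟨⟨rfl, by omega⟩, hL, hR⟩
        · right; exact ⟨⟨rfl, by omega⟩, hL, hR⟩
      · rintro (⟨h1, ⟨h2, h3⟩, h4⟩ | ⟨⟨h2, h3⟩, h4, h5⟩ | ⟨⟨h2, h3⟩, h4, h5⟩)
        · rw [← h2] at h4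
          split_ifs at h4 with h6
          · exact absurd h4 hL
          · exact absurd h4 hR
        · omega
        · omega

section
variable {K t : ℕ} {loc : Fin (2 ^ K) → ℕ × ℕ} {s : ℕ → ℕ} {idx : Fin (2 ^ K) → ℕ}
    {wire : ℕ × ℕ → ℕ → Fin (2 ^ K)} {f : ℕ → ℕ} {sep : ℕ → List (CStage ℕ)}

lemma StepCtx.zero (C : StepCtx K t loc s idx wire f sep) (w) (hw : (loc w).1 = 0) :
    goL s f (loc w).1 (idx w) ∨ goR s f (loc w).1 (idx w) := by
  have h1 := C.inv.s_ne w
  rw [hw] at h1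
  have h2 := C.inv.par 0 h1
  have h4 : 0 < rr K (t + 1) := by
    have := (rr_spec K (t + 1)).1
    omega
  have h5 := C.inv.even C.hK 0 h4
  have h6 := C.hf0 0 h4
  have h7 := C.idx_lt w
  rw [hw] at h7 ⊢
  unfold goL goR
  omega

lemma ite3 {a A B C : Prop} [Decidable a] [Decidable A] [Decidable B] [Decidable C]
    (h : a ↔ A ∨ B ∨ C) (h1 : ¬ (A ∧ B)) (h2 : ¬ (A ∧ C)) (h3 : ¬ (B ∧ C)) :
    (if a then 1 else 0 : ℕ) = (if A then 1 else 0) + (if B then 1 else 0) + (if C then 1 else 0) := by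
  split_ifs <;> first | rfl | (exfalso; tauto)

lemma StepCtx.newcount (C : StepCtx K t loc s idx wire f sep) (P : Fin (2 ^ K) → Prop) [DecidablePred P]
    (d' i' : ℕ) :
    (univ.filter fun w => newLoc s f (loc w) (idx w) = (d', i') ∧ P w).card =
      (if d' = 0 then 0 else
      (univ.filter fun w => loc w = (d' - 1, i' / 2) ∧ goSide s f i' (d' - 1) (idx w) ∧ P w).card) +
      (univ.filter fun w => loc w = (d' + 1, 2 * i') ∧
        (¬ goL s f (d' + 1) (idx w) ∧ ¬ goR s f (d' + 1) (idx w)) ∧ P w).card +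
      (univ.filter fun w => loc w = (d' + 1, 2 * i' + 1) ∧
        (¬ goL s f (d' + 1) (idx w) ∧ ¬ goR s f (d' + 1) (idx w)) ∧ P w).card := by
  have e : (if d' = 0 then 0 else
      (univ.filter fun w => loc w = (d' - 1, i' / 2) ∧ goSide s f i' (d' - 1) (idx w) ∧ P w).card) =
      (univ.filter fun w => d' ≠ 0 ∧ loc w = (d' - 1, i' / 2) ∧ goSide s f i' (d' - 1) (idx w) ∧ P w).card := by
    by_cases h : d' = 0
    · simp [h]
    · simp [h]
  rw [e]
  simp only [Finset.card_filter]
  rw [← Finset.sum_add_distrib, ← Finset.sum_add_distrib]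
  apply Finset.sum_congr rfl
  intro w _
  have h := newLoc_eq s f (loc w).1 (loc w).2 (idx w) d' i' (C.zero w)
  simp only [Prod.mk.eta] at h
  apply ite3
  · rw [h]
    clear h e
    generalize goSide s f i' (d' - 1) (idx w) = q1
    generalize (¬goL s f (d' + 1) (idx w) ∧ ¬goR s f (d' + 1) (idx w)) = q2
    tauto
  · rintro ⟨⟨h0, h1, -⟩, h2, -⟩; rw [h1] at h2; simp at h2
  · rintro ⟨⟨h0, h1, -⟩, h2, -⟩; rw [h1] at h2; simp at h2
  · rintro ⟨⟨h1, -⟩, h2, -⟩; rw [h1] at h2; simp at h2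

lemma StepCtx.cntSide (C : StepCtx K t loc s idx wire f sep) {d i : ℕ} (hi : i < 2 ^ d) (i' : ℕ) :
    (univ.filter fun w => loc w = (d, i) ∧ goSide s f i' d (idx w)).card = s d / 2 - f d := by
  rw [bag_count C.h1 C.h1' C.h2 (d, i) (s d) (C.sz hi) (fun p _ => goSide s f i' d p)]
  unfold goSide goL goR
  have := C.hf d
  split_ifs
  · have : ((range (s d)).filter fun p => f d ≤ p ∧ p < s d / 2) = Ico (f d) (s d / 2) := by
      ext p; simp; omega
    rw [this, Nat.card_Ico]
  · have : ((range (s d)).filter fun p => s d / 2 ≤ p ∧ p < 2 * (s d / 2) - f d) =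
        Ico (s d / 2) (2 * (s d / 2) - f d) := by
      ext p; simp; omega
    rw [this, Nat.card_Ico]; omega

lemma StepCtx.cntUp (C : StepCtx K t loc s idx wire f sep) {d i : ℕ} (hi : i < 2 ^ d) :
    (univ.filter fun w => loc w = (d, i) ∧ (¬ goL s f d (idx w) ∧ ¬ goR s f d (idx w))).card =
      s d - (2 * (s d / 2) - 2 * f d) := by
  rw [bag_count C.h1 C.h1' C.h2 (d, i) (s d) (C.sz hi) (fun p _ => ¬ goL s f d p ∧ ¬ goR s f d p)]
  have h1 := C.hf d
  have h2 := Finset.card_filter_add_card_filter_not (s := range (s d))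
    (fun p => ¬ goL s f d p ∧ ¬ goR s f d p)
  have : ((range (s d)).filter fun p => ¬ (¬ goL s f d p ∧ ¬ goR s f d p)) =
      Ico (f d) (2 * (s d / 2) - f d) := by
    ext p; simp only [mem_filter, mem_range, mem_Ico]; unfold goL goR; omega
  rw [this, Nat.card_Ico, card_range] at h2
  omega

/-- New bag sizes. -/
def newS (s f : ℕ → ℕ) (d : ℕ) : ℕ :=
  (if d = 0 then 0 else s (d - 1) / 2 - f (d - 1)) +
    2 * (s (d + 1) - (2 * (s (d + 1) / 2) - 2 * f (d + 1)))

lemma StepCtx.linv (C : StepCtx K t loc s idx wire f sep) :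
    LInv K (t + 1) (fun w => newLoc s f (loc w) (idx w)) (newS s f) := by
  have hcnt : ∀ d i, (univ.filter fun w => newLoc s f (loc w) (idx w) = (d, i)).card =
      if i < 2 ^ d then newS s f d else 0 := by
    intro d i
    have h := C.newcount (fun _ => True) d i
    simp only [and_true] at h
    rw [h]
    by_cases hi : i < 2 ^ d
    · have h1 : 2 * i < 2 ^ (d + 1) := by rw [pow_succ]; omega
      have h2 : 2 * i + 1 < 2 ^ (d + 1) := by rw [pow_succ]; omega
      rw [C.cntUp h1, C.cntUp h2, if_pos hi]
      unfold newS
      by_cases hd : d = 0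
      · simp [hd]; omega
      · rw [if_neg hd, if_neg hd, C.cntSide]
        · omega
        · obtain ⟨e, rfl⟩ := Nat.exists_eq_succ_of_ne_zero hd
          simp only [Nat.succ_eq_add_one, Nat.add_sub_cancel]
          rw [Nat.succ_eq_add_one, pow_succ] at hi
          omega
    · rw [if_neg hi]
      have emp : ∀ (e k : ℕ) (Q : Fin (2 ^ K) → Prop) [DecidablePred Q], ¬ k < 2 ^ e →
          (univ.filter fun w => loc w = (e, k) ∧ Q w).card = 0 := by
        intro e k Q _ hk
        rw [card_eq_zero, filter_eq_empty_iff]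
        rintro w - ⟨h1, -⟩
        have := C.inv.idx_lt w
        rw [h1] at this
        exact hk this
      rw [emp (d + 1) (2 * i) _ (by rw [pow_succ]; omega), emp (d + 1) (2 * i + 1) _ (by rw [pow_succ]; omega)]
      split_ifs with hd
      · rfl
      · rw [emp]
        obtain ⟨e, rfl⟩ := Nat.exists_eq_succ_of_ne_zero hd
        simp only [Nat.succ_eq_add_one, Nat.add_sub_cancel]
        rw [Nat.succ_eq_add_one, pow_succ] at hi
        omega
  have hpar : ∀ d, newS s f d ≠ 0 → d % 2 = (t + 1) % 2 ∧ rr K (t + 1) ≤ d := by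
    intro d hd
    have hmod := (rr_spec K (t + 1)).1
    by_cases h1 : d ≠ 0 ∧ s (d - 1) ≠ 0
    · have := C.inv.par _ h1.2
      have := rr_succ K t
      omega
    · have h2 : s (d + 1) ≠ 0 := by
        intro h0
        apply hd
        unfold newS
        rw [h0]
        by_cases hd0 : d = 0
        · simp [hd0]
        · have : s (d - 1) = 0 := by tauto
          simp [this]
      have h3 := C.inv.par _ h2
      refine ⟨by omega, ?_⟩
      by_contra hcon
      have h4 : d + 1 < rr K (t + 1) := by omega
      have h5 := C.inv.even C.hK _ h4
      have h6 := C.hf0 _ h4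
      apply hd
      unfold newS
      have : (if d = 0 then 0 else s (d - 1) / 2 - f (d - 1)) = 0 := by
        split_ifs with hd0
        · rfl
        · have : s (d - 1) = 0 := by tauto
          simp [this]
      omega
  refine ⟨hcnt, hpar, ?_⟩
  intro d
  by_cases h0 : newS s f d = 0
  · rw [h0]; exact_mod_cast (bb_pos _ _ _).le
  have h1 := (hpar d h0).2
  have h2 := (rr_spec K (t + 1)).2
  have h3 := bb_mono K (t + 1) h1
  rw [bb_succ_t K t d] at h3
  rw [bb_succ_t]
  have hA : ((if d = 0 then 0 else s (d - 1) / 2 - f (d - 1) : ℕ) : ℝ) ≤ bb K t d / 8 := by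
    split_ifs with hd
    · have := bb_pos K t d; push_cast; positivity
    · have h4 := C.inv.cap (d - 1)
      have h5 : bb K t d = 4 * bb K t (d - 1) := by rw [← bb_succ_d]; congr 1; omega
      have h6 : ((2 * (s (d - 1) / 2 - f (d - 1)) : ℕ) : ℝ) ≤ s (d - 1) := by
        exact_mod_cast (by omega)
      push_cast at h6 ⊢
      linarith
  have hB : ((s (d + 1) - (2 * (s (d + 1) / 2) - 2 * f (d + 1)) : ℕ) : ℝ) ≤ 1 + 2 * f (d + 1) := by
    exact_mod_cast (by omega)
  have hC := C.hf1 (d + 1)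
  rw [bb_succ_d] at hC
  unfold newS
  push_cast at hA hB ⊢
  linarith

end
end AKS

namespace AKS

section
variable {K t : ℕ} {loc : Fin (2 ^ K) → ℕ × ℕ} {s : ℕ → ℕ} {idx : Fin (2 ^ K) → ℕ}
    {wire : ℕ × ℕ → ℕ → Fin (2 ^ K)} {f : ℕ → ℕ} {sep : ℕ → List (CStage ℕ)}

lemma StepCtx.emp (C : StepCtx K t loc s idx wire f sep) {d i : ℕ} (hs : s d = 0)
    (Q : Fin (2 ^ K) → Prop) [DecidablePred Q] : (univ.filter fun w => loc w = (d, i) ∧ Q w).card = 0 := by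
  rw [card_eq_zero, filter_eq_empty_iff]
  rintro w - ⟨h1, -⟩
  have := C.inv.s_ne w
  rw [h1] at this
  exact this hs

lemma StepCtx.kid (C : StepCtx K t loc s idx wire f sep) {x x' : Fin (2 ^ K) → ℕ}
    (hS : SInv K t loc x) (hx' : Stepped loc idx wire sep x x') {d' i' k : ℕ} (hk : k < 2 ^ (d' + 1))
    (hk2 : k / 2 = i') (j : ℕ) :
    ((univ.filter fun w => loc w = (d' + 1, k) ∧
        (¬ goL s f (d' + 1) (idx w) ∧ ¬ goR s f (d' + 1) (idx w)) ∧
        x' w / 2 ^ (K - d' + j) ≠ i' / 2 ^ j).card : ℝ) ≤ 1 / 64 * (1 / 256) ^ (j + 1) * (4 * bb K t d') := by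
  by_cases hs : s (d' + 1) = 0
  · rw [C.emp hs]
    have := bb_pos K t d'
    push_cast; positivity
  have hd := C.inv.depth_le _ hs
  have h1 := hS (d' + 1) k (j + 1)
  rw [← C.conserve hx' hk (fun y => y / 2 ^ (K - (d' + 1) + (j + 1)) ≠ k / 2 ^ (j + 1)), bb_succ_d] at h1
  refine le_trans ?_ h1
  norm_cast
  apply card_le_card
  intro w
  simp only [mem_filter, mem_univ, true_and]
  rintro ⟨a, -, b⟩
  refine ⟨a, ?_⟩
  rw [show K - (d' + 1) + (j + 1) = K - d' + j by omega, pow_succ', ← Nat.div_div_eq_div_mul, hk2]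
  exact b

lemma StepCtx.parent (C : StepCtx K t loc s idx wire f sep) {x x' : Fin (2 ^ K) → ℕ}
    (hx : IsKey K x) (hS : SInv K t loc x) (hx' : Stepped loc idx wire sep x x') {d i' : ℕ}
    (hi : i' < 2 ^ (d + 1)) (j : ℕ) :
    ((univ.filter fun w => loc w = (d, i' / 2) ∧ goSide s f i' d (idx w) ∧
        x' w / 2 ^ (K - (d + 1) + j) ≠ i' / 2 ^ j).card : ℝ) ≤
      (if j = 0 then 1 / 25 else 1 / 64 * (1 / 256) ^ j) * bb K t d := by
  have hbp := bb_pos K t d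
  have hnn : 0 ≤ (if j = 0 then 1 / 25 else 1 / 64 * (1 / 256) ^ j : ℝ) * bb K t d := by
    split_ifs <;> positivity
  by_cases hs : s d = 0
  · rw [C.emp hs]
    exact_mod_cast hnn
  have hi2 : i' / 2 < 2 ^ d := by rw [pow_succ] at hi; omega
  have hd := C.inv.depth_le _ hs
  have hfd := C.hf d
  rcases Nat.lt_or_ge d K with hdK | hdK
  · rcases Nat.eq_zero_or_pos j with hj | hj
    · subst hj
      rw [if_pos rfl]
      rcases Nat.mod_two_eq_zero_or_one i' with hp | hp
      · refine le_trans ?_ (C.left hx hS hx' hi2 hs hdK)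
        norm_cast
        apply card_le_card
        intro w
        simp only [mem_filter, mem_univ, true_and]
        rintro ⟨a, b, c⟩
        unfold goSide at b
        rw [if_pos hp] at b
        refine ⟨a, b, ?_⟩
        rw [show K - (d + 1) + 0 = K - d - 1 by omega, pow_zero, Nat.div_one] at c
        rw [show 2 * (i' / 2) = i' by omega]
        exact c
      · refine le_trans ?_ (C.right hx hS hx' hi2 hs hdK)
        norm_cast
        apply card_le_card
        intro w
        simp only [mem_filter, mem_univ, true_and]
        rintro ⟨a, b, c⟩
        unfold goSide at b
        rw [if_neg (by omega)] at b
        refine ⟨a, b, ?_⟩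
        rw [show K - (d + 1) + 0 = K - d - 1 by omega, pow_zero, Nat.div_one] at c
        rw [show 2 * (i' / 2) + 1 = i' by omega]
        exact c
    · obtain ⟨j, rfl⟩ : ∃ k, j = k + 1 := ⟨j - 1, by omega⟩
      rw [if_neg (by omega)]
      have h1 := C.mid hx hS hx' hi2 hs j
      have h2 := hS d (i' / 2) j
      have h3 : (univ.filter fun w => loc w = (d, i' / 2) ∧ goSide s f i' d (idx w) ∧
          x' w / 2 ^ (K - (d + 1) + (j + 1)) ≠ i' / 2 ^ (j + 1)).card ≤
          (univ.filter fun w => loc w = (d, i' / 2) ∧ ((f d ≤ idx w ∧ idx w < 2 * (s d / 2) - f d) ∧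
            x' w / 2 ^ (K - d + j) ≠ i' / 2 / 2 ^ j)).card := by
        apply card_le_card
        intro w
        simp only [mem_filter, mem_univ, true_and]
        rintro ⟨a, b, c⟩
        rw [show K - (d + 1) + (j + 1) = K - d + j by omega, pow_succ', ← Nat.div_div_eq_div_mul] at c
        refine ⟨a, ?_, c⟩
        unfold goSide goL goR at b
        split_ifs at b <;> omega
      have h4 : ((256 * (univ.filter fun w => loc w = (d, i' / 2) ∧ goSide s f i' d (idx w) ∧
          x' w / 2 ^ (K - (d + 1) + (j + 1)) ≠ i' / 2 ^ (j + 1)).card : ℕ) : ℝ) ≤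
          1 / 64 * (1 / 256) ^ j * bb K t d := by
        refine le_trans ?_ h2
        exact_mod_cast (Nat.mul_le_mul_left _ h3).trans h1
      push_cast at h4
      rw [pow_succ (1 / 256 : ℝ) j]
      linarith
  · have hdK' : d = K := by omega
    have h1 := C.inv.level_card d
    have h2 : (univ.filter fun w => (loc w).1 = d).card ≤ 2 ^ K := by
      refine (card_le_univ _).trans ?_
      simp
    rw [h1, hdK'] at h2
    have h3 : s K ≤ 1 := by
      by_contra hcon
      have : 2 ^ K * 2 ≤ 2 ^ K * s K := Nat.mul_le_mul_left _ (by omega)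
      have : 0 < 2 ^ K := by positivity
      omega
    have h4 := C.cntSide hi2 i'
    rw [hdK'] at h4
    have h5 : (univ.filter fun w => loc w = (d, i' / 2) ∧ goSide s f i' d (idx w) ∧
        x' w / 2 ^ (K - (d + 1) + j) ≠ i' / 2 ^ j).card ≤ 0 := by
      have : s K / 2 - f K = 0 := by omega
      rw [this] at h4
      rw [← h4, hdK']
      apply card_le_card
      intro w
      simp only [mem_filter, mem_univ, true_and]
      rintro ⟨a, b, c⟩
      exact ⟨a, b⟩
    rw [Nat.le_zero.mp h5]
    exact_mod_cast hnn

lemma StepCtx.sinv (C : StepCtx K t loc s idx wire f sep) {x x' : Fin (2 ^ K) → ℕ}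
    (hx : IsKey K x) (hS : SInv K t loc x) (hx' : Stepped loc idx wire sep x x') :
    SInv K (t + 1) (fun w => newLoc s f (loc w) (idx w)) x' := by
  intro d' i' j
  rw [bb_succ_t]
  have hb := bb_pos K t d'
  have hj0 : (0:ℝ) < (1 / 256) ^ j := by positivity
  by_cases hi : i' < 2 ^ d'
  · rw [C.newcount (fun w => x' w / 2 ^ (K - d' + j) ≠ i' / 2 ^ j) d' i']
    have h1 := C.kid hS hx' (d' := d') (i' := i') (k := 2 * i') (by rw [pow_succ]; omega) (by omega) j
    have h2 := C.kid hS hx' (d' := d') (i' := i') (k := 2 * i' + 1) (by rw [pow_succ]; omega) (by omega) j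
    have h3 : ((if d' = 0 then 0 else (univ.filter fun w => loc w = (d' - 1, i' / 2) ∧
        goSide s f i' (d' - 1) (idx w) ∧ x' w / 2 ^ (K - d' + j) ≠ i' / 2 ^ j).card : ℕ) : ℝ) ≤
        (if j = 0 then 1 / 25 else 1 / 64 * (1 / 256) ^ j) * (bb K t d' / 4) := by
      split_ifs with hd hj hj
      · push_cast; positivity
      · push_cast; positivity
      · obtain ⟨e, rfl⟩ : ∃ k, d' = k + 1 := ⟨d' - 1, by omega⟩
        have := C.parent hx hS hx' hi j
        rw [if_pos hj] at this
        rw [bb_succ_d]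
        simp only [Nat.add_sub_cancel]
        refine this.trans (le_of_eq (by ring))
      · obtain ⟨e, rfl⟩ : ∃ k, d' = k + 1 := ⟨d' - 1, by omega⟩
        have := C.parent hx hS hx' hi j
        rw [if_neg hj] at this
        rw [bb_succ_d]
        simp only [Nat.add_sub_cancel]
        refine this.trans (le_of_eq (by ring))
    rw [pow_succ] at h1 h2
    rw [Nat.cast_add, Nat.cast_add]
    refine (add_le_add (add_le_add h3 h1) h2).trans ?_
    have hp : 0 < (1 / 256 : ℝ) ^ j * bb K t d' := by positivity
    by_cases hj : j = 0
    · rw [if_pos hj, hj]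
      norm_num
      linarith
    · rw [if_neg hj]
      nlinarith
  · have h := C.linv.cnt d' i'
    rw [if_neg hi] at h
    have h5 : (univ.filter fun w => newLoc s f (loc w) (idx w) = (d', i') ∧
        x' w / 2 ^ (K - d' + j) ≠ i' / 2 ^ j).card ≤ 0 := by
      rw [← h]
      apply card_le_card
      intro w
      simp only [mem_filter, mem_univ, true_and]
      exact fun h => h.1
    rw [Nat.le_zero.mp h5]
    push_cast; positivity
end
end AKS

namespace AKS

lemma IsKey.crun {K : ℕ} {x : Fin (2 ^ K) → ℕ} (hx : IsKey K x) (L : List (CStage (Fin (2 ^ K)))) :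
    IsKey K (crun L x) := by
  obtain ⟨e, he, -⟩ := crun_perm L x
  refine ⟨fun a b hab => ?_, fun w => ?_⟩
  · rw [he, he] at hab
    exact e.injective (hx.1 hab)
  · rw [he]; exact hx.2 _

/-- One step of the network. -/
lemma exists_step : ∃ c, ∀ (K t : ℕ) (loc : Fin (2 ^ K) → ℕ × ℕ) (s : ℕ → ℕ), LInv K t loc s → rr K t < K →
    ∃ (loc' : Fin (2 ^ K) → ℕ × ℕ) (s' : ℕ → ℕ) (L : List (CStage (Fin (2 ^ K)))), L.length = c ∧
      LInv K (t + 1) loc' s' ∧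
      ∀ x, IsKey K x → SInv K t loc x → SInv K (t + 1) loc' (crun L x) := by
  obtain ⟨c, hc⟩ := exists_separator 256 (by norm_num)
  refine ⟨c, fun K t loc s hI hK => ?_⟩
  classical
  obtain ⟨idx, wire, h1, h1', h2⟩ := exists_index loc
  let f : ℕ → ℕ := fun d => if d < rr K (t + 1) then 0 else min ⌊1 / 64 * bb K t d⌋₊ (s d / 2)
  have hfm : ∀ d, f d ≤ s d / 2 := by
    intro d; simp only [f]; split_ifs
    · omega
    · exact min_le_right _ _
  have hpre : ∀ d, f d = 0 ∨ s d / 2 ≤ 64 * f d := by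
    intro d
    simp only [f]
    split_ifs
    · left; rfl
    · rcases le_total ⌊1 / 64 * bb K t d⌋₊ (s d / 2) with h | h
      · rw [min_eq_left h]
        rcases Nat.eq_zero_or_pos ⌊1 / 64 * bb K t d⌋₊ with h0 | h0
        · left; exact h0
        · right
          have h3 := Nat.lt_floor_add_one (1 / 64 * bb K t d)
          have h4 := hI.cap d
          have h5 : ((s d / 2 : ℕ) : ℝ) ≤ s d / 2 := Nat.cast_div_le
          have h6 : (1:ℝ) ≤ ⌊1 / 64 * bb K t d⌋₊ := by exact_mod_cast h0
          have h7 : ((s d / 2 : ℕ) : ℝ) ≤ ((64 * ⌊1 / 64 * bb K t d⌋₊ : ℕ) : ℝ) := by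
            push_cast; linarith
          exact_mod_cast h7
      · rw [min_eq_right h]; right; omega
  choose sep hlen hsep using fun d => hc (s d / 2) (f d) (hfm d) (hpre d)
  have hsep' : ∀ d, IsSep 256 (s d / 2) (f d) (sep d) := hsep
  have C : StepCtx K t loc s idx wire f sep :=
    { inv := hI, hK := hK, h1 := h1, h1' := h1', h2 := h2, hf := hfm
      hf1 := by
        intro d
        have hb := bb_pos K t d
        simp only [f]
        split_ifs
        · push_cast; positivity
        · refine le_trans ?_ (Nat.floor_le (show 0 ≤ 1 / 64 * bb K t d by positivity))
          exact_mod_cast min_le_left _ _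
      hf0 := by intro d hd; simp only [f]; rw [if_pos hd]
      hf2 := by
        intro d hd
        simp only [f]; rw [if_neg hd]
        rcases le_total ⌊1 / 64 * bb K t d⌋₊ (s d / 2) with h | h
        · right
          rw [min_eq_left h]
          intro n hn
          exact Nat.le_floor hn
        · left; exact min_eq_right h
      hsep := hsep' }
  obtain ⟨L, hL, hrun⟩ := parallel (α := ℕ) loc idx wire
    (fun n => (univ.filter fun w' => loc w' = n).card) h1 h1' h2 c (fun n => sep n.1)
    (fun n => hlen n.1) (by
      rintro ⟨d, i⟩ st hst p hp
      simp only at hst hp ⊢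
      have h3 := (hsep' d).1 st hst p
      rw [hI.cnt] at hp ⊢
      split_ifs at hp ⊢
      · by_cases h : p < 2 * (s d / 2)
        · have := h3.1 h; omega
        · rw [h3.2 (by omega)]; exact hp
      · omega)
  exact ⟨_, _, L, hL, C.linv, fun x hx hS => C.sinv hx hS (fun w => hrun x w)⟩

lemma LInv.init (K : ℕ) (hK : 2 ≤ K) :
    LInv K 0 (fun _ => (0, 0)) (fun d => if d = 0 then 2 ^ K else 0) := by
  refine ⟨?_, ?_, ?_⟩
  · intro d i
    rcases Nat.eq_zero_or_pos d with rfl | hd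
    · rcases Nat.eq_zero_or_pos i with rfl | hi
      · simp
      · have : ¬ (0 = i) := by omega
        simp [this]
        intro; omega
    · have h1 : ¬ (0 = d) := by omega
      have h2 : ¬ (d = 0) := by omega
      simp [h1, h2]
  · intro d hd
    simp only [ne_eq, ite_eq_right_iff, Classical.not_imp] at hd
    rw [hd.1, rr_zero K hK]; simp
  · intro d
    split_ifs with h
    · rw [h]; unfold bb; push_cast; simp
    · exact_mod_cast (bb_pos _ _ _).le

lemma SInv.init (K : ℕ) (x : Fin (2 ^ K) → ℕ) (hx : IsKey K x) : SInv K 0 (fun _ => (0, 0)) x := by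
  intro d i j
  have : (univ.filter fun w : Fin (2 ^ K) => ((0, 0) : ℕ × ℕ) = (d, i) ∧
      x w / 2 ^ (K - d + j) ≠ i / 2 ^ j).card = 0 := by
    rw [card_eq_zero, filter_eq_empty_iff]
    rintro w - ⟨h1, h2⟩
    simp only [Prod.mk.injEq] at h1
    apply h2
    rw [← h1.1, ← h1.2, Nat.zero_div, Nat.div_eq_zero_iff]
    right
    exact (hx.2 w).trans_le (Nat.pow_le_pow_right (by norm_num) (by omega))
  rw [this]
  have := bb_pos K 0 d
  push_cast; positivity

lemma aks_keys : ∃ c : ℕ, ∀ K, 2 ≤ K → ∃ L : List (CStage (Fin (2 ^ K))), L.length ≤ c * K ∧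
    ∃ l : Fin (2 ^ K) → ℕ, ∀ x, IsKey K x → ∀ w, crun L x w = l w := by
  obtain ⟨c, hc⟩ := exists_step
  refine ⟨c * 8, fun K hK => ?_⟩
  have main : ∀ t, (∀ t' < t, rr K t' < K) → ∃ (L : List (CStage (Fin (2 ^ K))))
      (loc : Fin (2 ^ K) → ℕ × ℕ) (s : ℕ → ℕ), L.length = c * t ∧ LInv K t loc s ∧
        ∀ x, IsKey K x → SInv K t loc (crun L x) := by
    intro t
    induction t with
    | zero => intro _; exact ⟨[], _, _, rfl, LInv.init K hK, fun x hx => SInv.init K x hx⟩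
    | succ t ih =>
      intro h
      obtain ⟨L, loc, s, h1, h2, h3⟩ := ih (fun t' ht' => h t' (by omega))
      obtain ⟨loc', s', L', g1, g2, g3⟩ := hc K t loc s h2 (h t (by omega))
      refine ⟨L ++ L', loc', s', by simp [h1, g1]; ring, g2, fun x hx => ?_⟩
      rw [crun_append]
      exact g3 _ (hx.crun L) (h3 x hx)
  have hex : ∃ t, K ≤ rr K t := ⟨_, rr_large K⟩
  classical
  let T := Nat.find hex
  have hT : K ≤ rr K T := Nat.find_spec hex
  have hTm : ∀ t' < T, rr K t' < K := fun t' ht' => not_le.mp (Nat.find_min hex ht')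
  have hT8 : T ≤ 8 * K := Nat.find_min' hex (rr_large K)
  obtain ⟨L, loc, s, h1, h2, h3⟩ := main T hTm
  refine ⟨L, by rw [h1, mul_assoc]; exact Nat.mul_le_mul_left _ hT8, fun w => (loc w).2, fun x hx w => ?_⟩
  have hT0 : T ≠ 0 := by
    intro h0
    rw [h0, rr_zero K hK] at hT; omega
  have hTK : rr K T = K := by
    have e1 := rr_succ K (T - 1)
    have e2 := hTm (T - 1) (by omega)
    rw [show T - 1 + 1 = T by omega] at e1
    omega
  have hd : (loc w).1 = K := by
    have e1 := h2.depth_le _ (h2.s_ne w)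
    have e2 := (h2.par _ (h2.s_ne w)).2
    omega
  have hb : bb K T K < 64 := by
    have e1 := rr_min K T (K - 2) (by omega) (by have := (rr_spec K T).1; omega)
    obtain ⟨k, rfl⟩ : ∃ k, K = k + 2 := ⟨K - 2, by omega⟩
    rw [Nat.add_sub_cancel] at e1
    rw [show k + 2 = k + 1 + 1 by rfl, bb_succ_d, bb_succ_d]
    linarith
  have h4 := h3 x hx K (loc w).2 0
  have h5 : ((univ.filter fun w' => loc w' = (K, (loc w).2) ∧
      crun L x w' / 2 ^ (K - K + 0) ≠ (loc w).2 / 2 ^ 0).card : ℝ) < 1 := by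
    refine h4.trans_lt ?_
    rw [pow_zero]; linarith
  have h6 : (univ.filter fun w' => loc w' = (K, (loc w).2) ∧
      crun L x w' / 2 ^ (K - K + 0) ≠ (loc w).2 / 2 ^ 0).card = 0 := by
    have : (univ.filter fun w' => loc w' = (K, (loc w).2) ∧
      crun L x w' / 2 ^ (K - K + 0) ≠ (loc w).2 / 2 ^ 0).card < 1 := by exact_mod_cast h5
    omega
  rw [card_eq_zero, filter_eq_empty_iff] at h6
  have h7 := h6 (mem_univ w)
  have h8 : loc w = (K, (loc w).2) := by rw [← hd]
  simp only [Nat.sub_self, add_zero, pow_zero, Nat.div_one] at h7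
  by_contra hcon
  exact h7 ⟨h8, hcon⟩

/-- The Ajtai–Komlós–Szemerédi theorem, in boolean form. -/
theorem aks : ∃ c : ℕ, ∀ K, 2 ≤ K → ∃ L : List (CStage (Fin (2 ^ K))), L.length ≤ c * K ∧
    ∃ l : Fin (2 ^ K) ≃ Fin (2 ^ K), ∀ (b : Fin (2 ^ K) → Bool) w w', l w ≤ l w' →
      crun L b w ≤ crun L b w' := by
  obtain ⟨c, hc⟩ := aks_keys
  refine ⟨c, fun K hK => ?_⟩
  obtain ⟨L, hL, l, hl⟩ := hc K hK
  refine ⟨L, hL, ?_⟩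
  have hid : IsKey K (fun w => (w : ℕ)) := ⟨Fin.val_injective, fun w => w.2⟩
  have hk := hid.crun L
  have hle : crun L (fun w : Fin (2 ^ K) => (w : ℕ)) = l := funext (hl _ hid)
  rw [hle] at hk
  let l' : Fin (2 ^ K) → Fin (2 ^ K) := fun w => ⟨l w, hk.2 w⟩
  have hinj : Function.Injective l' := fun a b hab => hk.1 (by simpa [l'] using hab)
  refine ⟨Equiv.ofBijective l' (Finite.injective_iff_bijective.mp hinj), fun b w w' hww => ?_⟩
  have hww' : l w ≤ l w' := hww
  let e := Tuple.sort b
  have he : Monotone (b ∘ e) := Tuple.monotone_sort b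
  let φ : ℕ → Bool := fun n => if h : n < 2 ^ K then b (e ⟨n, h⟩) else true
  have hφ : Monotone φ := by
    intro m n hmn
    simp only [φ]
    by_cases hn : n < 2 ^ K
    · rw [dif_pos hn, dif_pos (hmn.trans_lt hn)]
      exact he (by simpa using hmn)
    · rw [dif_neg hn]; exact Bool.le_true _
  let x : Fin (2 ^ K) → ℕ := fun w => (e.symm w : ℕ)
  have hx : IsKey K x := ⟨fun a b hab => e.symm.injective (Fin.val_injective hab), fun w => (e.symm w).2⟩
  have hb : b = fun w => φ (x w) := by
    funext w
    simp only [φ, x]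
    rw [dif_pos (e.symm w).2]
    simp
  rw [hb, crun_mono L hφ x]
  simp only
  rw [hl x hx, hl x hx]
  exact hφ hww'

end AKS

namespace AKS

/-- A stage on a graph in involution form. -/
structure NStage {V : Type*} (G : SimpleGraph V) where
  σ : V → V
  inv : ∀ v, σ (σ v) = v
  adj : ∀ v, σ v ≠ v → G.Adj v (σ v)
  mode : V → Option Bool
  hmode : ∀ v, σ v ≠ v → mode (σ v) = (mode v).map not

/-- Value produced at an endpoint. -/
def modeVal (o : Option Bool) (a b : ℕ) : ℕ :=
  match o with
  | some true => min a b
  | some false => max a b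
  | none => b

@[simp] lemma modeVal_self (o : Option Bool) (a : ℕ) : modeVal o a a = a := by
  rcases o with _ | _ | _ <;> simp [modeVal]

def NStage.apply {G : SimpleGraph V} (s : NStage G) (f : V → ℕ) (v : V) : ℕ :=
  modeVal (s.mode v) (f v) (f (s.σ v))

def nrun {G : SimpleGraph V} (L : List (NStage G)) (f : V → ℕ) : V → ℕ :=
  L.foldl (fun g s => s.apply g) f

@[simp] lemma nrun_nil {G : SimpleGraph V} (f : V → ℕ) : nrun ([] : List (NStage G)) f = f := rfl
@[simp] lemma nrun_cons {G : SimpleGraph V} (s : NStage G) (L : List (NStage G)) (f : V → ℕ) :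
    nrun (s :: L) f = nrun L (s.apply f) := rfl
lemma nrun_append {G : SimpleGraph V} (L L' : List (NStage G)) (f : V → ℕ) :
    nrun (L ++ L') f = nrun L' (nrun L f) := by
  simp [nrun, List.foldl_append]

lemma stage_apply_fst {G : SimpleGraph V} (s : Stage G) (f : V → ℕ) (p : V × V) (hp : p ∈ s.pairs) :
    s.apply f p.1 = if s.directed p then min (f p.1) (f p.2) else f p.2 := by
  classical
  have h1 : ∃ q, q ∈ s.pairs ∧ q.1 = p.1 := ⟨p, hp, rfl⟩
  have h2 : h1.choose = p := by
    by_contra hne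
    exact (s.disj _ h1.choose_spec.1 p hp hne).1 h1.choose_spec.2
  unfold Stage.apply
  rw [dif_pos h1, h2]

lemma stage_apply_snd {G : SimpleGraph V} (s : Stage G) (f : V → ℕ) (p : V × V) (hp : p ∈ s.pairs) :
    s.apply f p.2 = if s.directed p then max (f p.1) (f p.2) else f p.1 := by
  classical
  have h0 : ¬ ∃ q, q ∈ s.pairs ∧ q.1 = p.2 := by
    rintro ⟨q, hq, hqp⟩
    by_cases hne : q = p
    · subst hne; exact (s.adj q hq).ne hqp
    · exact (s.disj q hq p hp hne).2.1 hqp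
  have h1 : ∃ q, q ∈ s.pairs ∧ q.2 = p.2 := ⟨p, hp, rfl⟩
  have h2 : h1.choose = p := by
    by_contra hne
    exact (s.disj _ h1.choose_spec.1 p hp hne).2.2.2 h1.choose_spec.2
  unfold Stage.apply
  rw [dif_neg h0, dif_pos h1, h2]

lemma stage_apply_other {G : SimpleGraph V} (s : Stage G) (f : V → ℕ) (v : V)
    (h : ∀ p ∈ s.pairs, p.1 ≠ v ∧ p.2 ≠ v) : s.apply f v = f v := by
  classical
  unfold Stage.apply
  rw [dif_neg (by rintro ⟨q, hq, e⟩; exact (h q hq).1 e), dif_neg (by rintro ⟨q, hq, e⟩; exact (h q hq).2 e)]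

lemma exists_nstage {G : SimpleGraph V} (s : Stage G) : ∃ s' : NStage G, ∀ f, s'.apply f = s.apply f := by
  classical
  have hex : ∀ v, ∃ (w : V) (mo : Option Bool),
      (∃ p ∈ s.pairs, p.1 = v ∧ w = p.2 ∧ mo = if s.directed p then some true else none) ∨
      (∃ p ∈ s.pairs, p.2 = v ∧ w = p.1 ∧ mo = if s.directed p then some false else none) ∨
      ((∀ p ∈ s.pairs, p.1 ≠ v ∧ p.2 ≠ v) ∧ w = v ∧ mo = none) := by
    intro v
    by_cases h1 : ∃ p ∈ s.pairs, p.1 = v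
    · obtain ⟨p, hp, e⟩ := h1
      exact ⟨_, _, Or.inl ⟨p, hp, e, rfl, rfl⟩⟩
    by_cases h2 : ∃ p ∈ s.pairs, p.2 = v
    · obtain ⟨p, hp, e⟩ := h2
      exact ⟨_, _, Or.inr (Or.inl ⟨p, hp, e, rfl, rfl⟩)⟩
    · refine ⟨_, _, Or.inr (Or.inr ⟨fun p hp => ⟨fun e => h1 ⟨p, hp, e⟩, fun e => h2 ⟨p, hp, e⟩⟩, rfl, rfl⟩)⟩
  choose σ mode spec using hex
  have k1 : ∀ p ∈ s.pairs, σ p.1 = p.2 ∧ mode p.1 = if s.directed p then some true else none := by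
    intro p hp
    rcases spec p.1 with ⟨q, hq, e1, e2, e3⟩ | ⟨q, hq, e1, e2, e3⟩ | ⟨h, -, -⟩
    · by_cases hne : q = p
      · subst hne; exact ⟨e2, e3⟩
      · exact absurd e1 (s.disj q hq p hp hne).1
    · by_cases hne : q = p
      · subst hne; exact absurd e1 (s.adj q hq).ne'
      · exact absurd e1 (s.disj q hq p hp hne).2.2.1
    · exact absurd rfl (h p hp).1
  have k2 : ∀ p ∈ s.pairs, σ p.2 = p.1 ∧ mode p.2 = if s.directed p then some false else none := by
    intro p hp
    rcases spec p.2 with ⟨q, hq, e1, e2, e3⟩ | ⟨q, hq, e1, e2, e3⟩ | ⟨h, -, -⟩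
    · by_cases hne : q = p
      · subst hne; exact absurd e1 (s.adj q hq).ne
      · exact absurd e1 (s.disj q hq p hp hne).2.1
    · by_cases hne : q = p
      · subst hne; exact ⟨e2, e3⟩
      · exact absurd e1 (s.disj q hq p hp hne).2.2.2
    · exact absurd rfl (h p hp).2
  refine ⟨⟨σ, ?_, ?_, mode, ?_⟩, ?_⟩
  · intro v
    rcases spec v with ⟨p, hp, rfl, e2, e3⟩ | ⟨p, hp, rfl, e2, e3⟩ | ⟨h, e, -⟩
    · rw [e2, (k2 p hp).1]
    · rw [e2, (k1 p hp).1]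
    · rw [e, e]
  · intro v hv
    rcases spec v with ⟨p, hp, rfl, e2, e3⟩ | ⟨p, hp, rfl, e2, e3⟩ | ⟨h, e, -⟩
    · rw [e2]; exact s.adj p hp
    · rw [e2]; exact (s.adj p hp).symm
    · exact absurd e hv
  · intro v hv
    rcases spec v with ⟨p, hp, rfl, e2, e3⟩ | ⟨p, hp, rfl, e2, e3⟩ | ⟨h, e, -⟩
    · rw [e2, (k2 p hp).2, e3]; split_ifs <;> rfl
    · rw [e2, (k1 p hp).2, e3]; split_ifs <;> rfl
    · exact absurd e hv
  · intro f
    funext v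
    unfold NStage.apply
    rcases spec v with ⟨p, hp, rfl, e2, e3⟩ | ⟨p, hp, rfl, e2, e3⟩ | ⟨h, e2, e3⟩
    · rw [stage_apply_fst s f p hp]
      simp only
      rw [e2, e3]
      split_ifs <;> rfl
    · rw [stage_apply_snd s f p hp]
      simp only
      rw [e2, e3]
      split_ifs
      · simp [modeVal, max_comm]
      · rfl
    · rw [stage_apply_other s f v h]
      simp only
      rw [e2]; simp

lemma exists_stage [Fintype V] {G : SimpleGraph V} (s : NStage G) : ∃ s' : Stage G, ∀ f, s'.apply f = s.apply f := by
  classical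
  let o := Fintype.equivFin V
  let S : Stage G :=
    { pairs := univ.filter fun p : V × V => p.2 = s.σ p.1 ∧ p.1 ≠ p.2 ∧
        (s.mode p.1 = some true ∨ (s.mode p.1 = none ∧ o p.1 < o p.2))
      adj := by
        intro p hp
        simp only [mem_filter, mem_univ, true_and] at hp
        rw [hp.1]; exact s.adj _ (by rw [← hp.1]; exact hp.2.1.symm)
      directed := fun p => decide (s.mode p.1 = some true)
      disj := by
        rintro ⟨p1, p2⟩ hp ⟨q1, q2⟩ hq hne
        simp only [mem_filter, mem_univ, true_and] at hp hq
        obtain ⟨rfl, hp2, hp3⟩ := hp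
        obtain ⟨rfl, hq2, hq3⟩ := hq
        simp only [ne_eq, Prod.mk.injEq] at hne ⊢
        have a1 : p1 ≠ q1 := by rintro rfl; exact hne ⟨rfl, rfl⟩
        have a2 : p1 ≠ s.σ q1 := by
          rintro rfl
          rw [s.inv] at hp3
          rw [s.hmode q1 hq2.symm] at hp3
          rcases hq3 with hq3 | ⟨hq3, hq4⟩
          · rw [hq3] at hp3; simp at hp3
          · rw [hq3] at hp3; simp at hp3; omega
        refine ⟨a1, a2, ?_, ?_⟩
        · intro h; apply a2; rw [← h, s.inv]
        · intro h; apply a1; rw [← s.inv p1, h, s.inv] }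
  refine ⟨S, fun f => ?_⟩
  funext v
  have hmem : ∀ p : V × V, p ∈ S.pairs ↔ (p.2 = s.σ p.1 ∧ p.1 ≠ p.2 ∧
        (s.mode p.1 = some true ∨ (s.mode p.1 = none ∧ o p.1 < o p.2))) := by
    intro p; simp [S]
  by_cases h0 : s.σ v = v
  · rw [stage_apply_other S]
    · unfold NStage.apply; rw [h0]; simp
    · rintro p hp
      rw [hmem] at hp
      constructor
      · rintro rfl; apply hp.2.1; rw [hp.1, h0]
      · rintro rfl
        apply hp.2.1
        have := hp.1
        rw [this, s.inv] at h0
        rw [this]; exact h0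
  · have hdir : ∀ p, S.directed p = decide (s.mode p.1 = some true) := fun p => rfl
    have hm := s.hmode v h0
    have hne : o v ≠ o (s.σ v) := fun h => h0 (o.injective h).symm
    have fstc : (s.mode v = some true ∨ (s.mode v = none ∧ o v < o (s.σ v))) → S.apply f v = s.apply f v := by
      intro h
      have := stage_apply_fst S f (v, s.σ v) ((hmem _).mpr ⟨rfl, fun e => h0 e.symm, h⟩)
      simp only at this
      rw [this, hdir]
      unfold NStage.apply
      rcases h with h | ⟨h, -⟩
      · simp [h, modeVal]
      · simp [h, modeVal]
    have sndc : (s.mode v = some false ∨ (s.mode v = none ∧ o (s.σ v) < o v)) → S.apply f v = s.apply f v := by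
      intro h
      have := stage_apply_snd S f (s.σ v, v) ((hmem _).mpr ⟨(s.inv v).symm, h0, by
        rcases h with h | ⟨h, h'⟩
        · left; rw [hm, h]; rfl
        · right; exact ⟨by rw [hm, h]; rfl, h'⟩⟩)
      simp only at this
      rw [this, hdir]
      simp only
      rw [hm]
      unfold NStage.apply
      rcases h with h | ⟨h, -⟩
      · simp [h, modeVal, max_comm]
      · simp [h, modeVal]
    rcases hmo : s.mode v with _ | _ | _
    · rcases lt_or_gt_of_ne hne with h | h
      · exact fstc (Or.inr ⟨hmo, h⟩)
      · exact sndc (Or.inr ⟨hmo, h⟩)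
    · exact sndc (Or.inl hmo)
    · exact fstc (Or.inl hmo)

lemma exists_nlist {G : SimpleGraph V} (L : List (Stage G)) :
    ∃ L' : List (NStage G), L'.length = L.length ∧ ∀ f, nrun L' f = runNetwork L f := by
  induction L with
  | nil => exact ⟨[], rfl, fun f => rfl⟩
  | cons s L ih =>
    obtain ⟨L', h1, h2⟩ := ih
    obtain ⟨s', hs⟩ := exists_nstage s
    exact ⟨s' :: L', by simp [h1], fun f => by rw [nrun_cons, h2, hs]; rfl⟩

lemma exists_slist [Fintype V] {G : SimpleGraph V} (L : List (NStage G)) :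
    ∃ L' : List (Stage G), L'.length = L.length ∧ ∀ f, runNetwork L' f = nrun L f := by
  induction L with
  | nil => exact ⟨[], rfl, fun f => rfl⟩
  | cons s L ih =>
    obtain ⟨L', h1, h2⟩ := ih
    obtain ⟨s', hs⟩ := exists_stage s
    refine ⟨s' :: L', by simp [h1], fun f => ?_⟩
    rw [nrun_cons, ← h2, ← hs]; rfl

/-- A run rearranges the keys. -/
lemma NStage.exists_perm {G : SimpleGraph V} (s : NStage G) (f : V → ℕ) :
    ∃ e : Equiv.Perm V, ∀ v, s.apply f v = f (e v) := by
  classical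
  let e : V → V := fun v => if s.apply f v = f v ∧ s.apply f (s.σ v) = f (s.σ v) then v else s.σ v
  have key : ∀ v, (s.apply f v = f v ∧ s.apply f (s.σ v) = f (s.σ v)) ∨
      (s.apply f v = f (s.σ v) ∧ s.apply f (s.σ v) = f v) := by
    intro v
    by_cases h : s.σ v = v
    · left
      have : s.apply f v = f v := by unfold NStage.apply; rw [h]; simp
      rw [h]; exact ⟨this, this⟩
    · unfold NStage.apply
      rw [s.inv, s.hmode v h]
      rcases s.mode v with _ | _ | _
      · right; simp [modeVal]
      · simp only [modeVal, Option.map_some, Bool.not_false]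
        rcases le_total (f v) (f (s.σ v)) with h1 | h1 <;> simp [h1]
      · simp only [modeVal, Option.map_some, Bool.not_true]
        rcases le_total (f v) (f (s.σ v)) with h1 | h1 <;> simp [h1]
  have hee : ∀ v, e (e v) = v := by
    intro v
    simp only [e]
    by_cases h : s.apply f v = f v ∧ s.apply f (s.σ v) = f (s.σ v)
    · rw [if_pos h, if_pos h]
    · rw [if_neg h, if_neg, s.inv]
      rw [s.inv]; tauto
  refine ⟨⟨e, e, hee, hee⟩, fun v => ?_⟩
  simp only [Equiv.coe_fn_mk, e]
  split_ifs with h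
  · exact h.1
  · rcases key v with h' | h'
    · exact absurd h' h
    · exact h'.1

lemma nrun_perm {G : SimpleGraph V} (L : List (NStage G)) (f : V → ℕ) :
    ∃ e : Equiv.Perm V, ∀ v, nrun L f v = f (e v) := by
  induction L generalizing f with
  | nil => exact ⟨1, fun v => rfl⟩
  | cons s L ih =>
    obtain ⟨e₁, h1⟩ := s.exists_perm f
    obtain ⟨e₂, h3⟩ := ih (s.apply f)
    exact ⟨e₁ * e₂, fun v => by rw [nrun_cons, h3, h1]; rfl⟩

lemma nrun_inj {G : SimpleGraph V} (L : List (NStage G)) (f : V → ℕ) (hf : Function.Injective f) :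
    Function.Injective (nrun L f) := by
  obtain ⟨e, he⟩ := nrun_perm L f
  intro a b hab
  rw [he, he] at hab
  exact e.injective (hf hab)

/-- Routing as a network of swaps. -/
lemma exists_route {G : SimpleGraph V} (P : List (Equiv.Perm V)) (hP : ∀ τ ∈ P, IsMatchingStep G τ) :
    ∃ L : List (NStage G), L.length = P.length ∧ ∀ f v, nrun L f (finalPos P v) = f v := by
  induction P with
  | nil => exact ⟨[], rfl, fun f v => rfl⟩
  | cons τ P ih =>
    obtain ⟨L, h1, h2⟩ := ih (fun τ' h => hP τ' (List.mem_cons_of_mem _ h))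
    obtain ⟨g1, g2⟩ := hP τ List.mem_cons_self
    refine ⟨⟨τ, g1, g2, fun _ => none, fun _ _ => rfl⟩ :: L, by simp [h1], fun f v => ?_⟩
    have : finalPos (τ :: P) v = finalPos P (τ v) := rfl
    rw [this, nrun_cons, h2]
    simp [NStage.apply, modeVal, g1]

end AKS

namespace AKS

section copies
variable {X : Type*} {G : SimpleGraph V} {H : SimpleGraph X} {q : ℕ} (φ : Fin q → X → V)

lemma copies_stage (hφ : ∀ i x j y, φ i x = φ j y → i = j ∧ x = y)
    (hadj : ∀ i x y, H.Adj x y → G.Adj (φ i x) (φ i y)) (s : NStage H) :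
    ∃ s' : NStage G, ∀ g, (∀ i x, s'.apply g (φ i x) = s.apply (fun x => g (φ i x)) x) ∧
      ∀ v, (∀ i x, φ i x ≠ v) → s'.apply g v = g v := by
  classical
  have hex : ∀ v, ∃ (w : V) (mo : Option Bool),
      (∃ i x, φ i x = v ∧ w = φ i (s.σ x) ∧ mo = s.mode x) ∨ ((∀ i x, φ i x ≠ v) ∧ w = v ∧ mo = none) := by
    intro v
    by_cases h : ∃ i x, φ i x = v
    · obtain ⟨i, x, h⟩ := h
      exact ⟨_, _, Or.inl ⟨i, x, h, rfl, rfl⟩⟩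
    · push Not at h
      exact ⟨_, _, Or.inr ⟨h, rfl, rfl⟩⟩
  choose σ mode spec using hex
  have k1 : ∀ i x, σ (φ i x) = φ i (s.σ x) ∧ mode (φ i x) = s.mode x := by
    intro i x
    rcases spec (φ i x) with ⟨j, y, e1, e2, e3⟩ | ⟨h, -, -⟩
    · obtain ⟨rfl, rfl⟩ := hφ _ _ _ _ e1
      exact ⟨e2, e3⟩
    · exact absurd rfl (h i x)
  refine ⟨⟨σ, ?_, ?_, mode, ?_⟩, fun g => ⟨?_, ?_⟩⟩
  · intro v
    rcases spec v with ⟨i, x, rfl, e2, e3⟩ | ⟨h, e, -⟩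
    · rw [e2, (k1 _ _).1, s.inv]
    · rw [e, e]
  · intro v hv
    rcases spec v with ⟨i, x, rfl, e2, e3⟩ | ⟨h, e, -⟩
    · rw [e2] at hv ⊢
      exact hadj _ _ _ (s.adj x (fun h => hv (by rw [h])))
    · exact absurd e hv
  · intro v hv
    rcases spec v with ⟨i, x, rfl, e2, e3⟩ | ⟨h, e, -⟩
    · rw [e2] at hv ⊢
      rw [(k1 _ _).2, e3]
      exact s.hmode x (fun h => hv (by rw [h]))
    · exact absurd e hv
  · intro i x
    unfold NStage.apply
    simp only
    rw [(k1 i x).1, (k1 i x).2]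
  · intro v hv
    unfold NStage.apply
    simp only
    rcases spec v with ⟨i, x, e1, e2, e3⟩ | ⟨h, e, -⟩
    · exact absurd e1 (hv i x)
    · rw [e]; simp

lemma copies_run (hφ : ∀ i x j y, φ i x = φ j y → i = j ∧ x = y)
    (hadj : ∀ i x y, H.Adj x y → G.Adj (φ i x) (φ i y)) (L : List (NStage H)) :
    ∃ L' : List (NStage G), L'.length = L.length ∧
      ∀ g, (∀ i x, nrun L' g (φ i x) = nrun L (fun x => g (φ i x)) x) ∧
      ∀ v, (∀ i x, φ i x ≠ v) → nrun L' g v = g v := by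
  induction L with
  | nil => exact ⟨[], rfl, fun g => ⟨fun i x => rfl, fun v _ => rfl⟩⟩
  | cons s L ih =>
    obtain ⟨L', h1, h2⟩ := ih
    obtain ⟨s', hs⟩ := copies_stage φ hφ hadj s
    refine ⟨s' :: L', by simp [h1], fun g => ⟨fun i x => ?_, fun v hv => ?_⟩⟩
    · rw [nrun_cons, nrun_cons, (h2 _).1]
      congr 1
      funext y
      exact (hs g).1 i y
    · rw [nrun_cons, (h2 _).2 v hv, (hs g).2 v hv]

end copies

/-- Masking of one stage. -/
lemma mask_stage {G : SimpleGraph V} (s : NStage G) (M : Set V) :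
    ∃ (s' : NStage G) (τ : Equiv.Perm V), ∀ (f g : V → ℕ) (B : ℕ),
      (∀ v, v ∉ M → f v = g v ∧ g v < B) → (∀ v, v ∈ M → B ≤ g v) →
      (∀ v, τ.symm v ∉ M → s'.apply f v = s.apply g v ∧ s.apply g v < B) ∧
      (∀ v, τ.symm v ∈ M → B ≤ s.apply g v) ∧ ∀ v, v ∈ M → s'.apply f (τ v) = f v := by
  classical
  let keep : V → Prop := fun v => v ∉ M ∧ s.σ v ∉ M
  let move : V → Prop := fun v => (v ∈ M ∧ s.σ v ∉ M ∧ s.mode v ≠ some false) ∨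
    (v ∉ M ∧ s.σ v ∈ M ∧ s.mode v ≠ some true)
  have hkeep : ∀ v, keep (s.σ v) ↔ keep v := by
    intro v; simp only [keep, s.inv]; tauto
  have hmove : ∀ v, move (s.σ v) ↔ move v := by
    intro v
    simp only [move, s.inv]
    by_cases h : s.σ v = v
    · rw [h]
    · rw [s.hmode v h]
      rcases s.mode v with _ | _ | _ <;> simp <;> tauto
  have hτ : ∀ v, (fun v => if move v then s.σ v else v) ((fun v => if move v then s.σ v else v) v) = v := by
    intro v
    simp only
    by_cases h : move v
    · rw [if_pos h, if_pos ((hmove v).mpr h), s.inv]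
    · rw [if_neg h, if_neg h]
  let τ : Equiv.Perm V := ⟨fun v => if move v then s.σ v else v, fun v => if move v then s.σ v else v, hτ, hτ⟩
  let s' : NStage G :=
    { σ := fun v => if keep v ∨ move v then s.σ v else v
      inv := by
        intro v
        by_cases h : keep v ∨ move v
        · rw [if_pos h, if_pos (by rwa [hkeep, hmove]), s.inv]
        · rw [if_neg h, if_neg h]
      adj := by
        intro v hv
        by_cases h : keep v ∨ move v
        · rw [if_pos h] at hv ⊢; exact s.adj v hv
        · rw [if_neg h] at hv; exact absurd rfl hv
      mode := fun v => if keep v then s.mode v else none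
      hmode := by
        intro v hv
        by_cases h : keep v ∨ move v
        · rw [if_pos h] at hv ⊢
          simp only [hkeep]
          split_ifs
          · exact s.hmode v hv
          · rfl
        · rw [if_neg h] at hv; exact absurd rfl hv }
  refine ⟨s', τ, fun f g B h1 h2 => ?_⟩
  have hs' : ∀ v, s'.apply f v = modeVal (if keep v then s.mode v else none) (f v)
    (f (if keep v ∨ move v then s.σ v else v)) := fun v => rfl
  have hτs : ∀ v, τ.symm v = if move v then s.σ v else v := fun v => rfl
  have hτt : ∀ v, τ v = if move v then s.σ v else v := fun v => rfl
  refine ⟨fun v hv => ?_, fun v hv => ?_, fun v hv => ?_⟩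
  · rw [hs']
    rw [hτs] at hv
    unfold NStage.apply
    by_cases hm : move v
    · rw [if_pos hm] at hv
      have hk : ¬ keep v := by simp only [keep, move] at hm ⊢; tauto
      have hvM : v ∈ M := by simp only [move] at hm; tauto
      have hmo : s.mode v ≠ some false := by simp only [move] at hm; tauto
      rw [if_neg hk, if_pos (Or.inr hm)]
      have e1 := h1 _ hv
      have e2 := h2 v hvM
      rcases hmode : s.mode v with _ | _ | _
      · simp only [modeVal]; exact e1
      · exact absurd hmode hmo
      · simp only [modeVal]
        rw [min_eq_right (by omega)]; exact e1
    · rw [if_neg hm] at hv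
      have e1 := h1 _ hv
      by_cases hk : keep v
      · have e2 := h1 _ hk.2
        rw [if_pos hk, if_pos (Or.inl hk), e1.1, e2.1]
        refine ⟨rfl, ?_⟩
        rcases s.mode v with _ | _ | _ <;> simp only [modeVal]
        · exact e2.2
        · exact max_lt e1.2 e2.2
        · exact (min_le_left _ _).trans_lt e1.2
      · have hσ : s.σ v ∈ M := by simp only [keep] at hk; tauto
        have hmo : s.mode v = some true := by
          by_contra hcon
          exact hm (Or.inr ⟨hv, hσ, hcon⟩)
        rw [if_neg hk, if_neg (by tauto), hmo]
        simp only [modeVal]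
        have := h2 _ hσ
        rw [min_eq_left (by omega)]; exact e1
  · rw [hτs] at hv
    unfold NStage.apply
    by_cases hm : move v
    · rw [if_pos hm] at hv
      have e2 := h2 _ hv
      have hmo : s.mode v ≠ some true := by simp only [move] at hm; tauto
      rcases hmode : s.mode v with _ | _ | _
      · simp only [modeVal]; exact e2
      · simp only [modeVal]; exact e2.trans (le_max_right _ _)
      · exact absurd hmode hmo
    · rw [if_neg hm] at hv
      have e2 := h2 _ hv
      by_cases hσ : s.σ v ∈ M
      · have e3 := h2 _ hσ
        rcases s.mode v with _ | _ | _ <;> simp only [modeVal]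
        · exact e3
        · exact e3.trans (le_max_right _ _)
        · exact le_min e2 e3
      · have hmo : s.mode v = some false := by
          by_contra hcon
          exact hm (Or.inl ⟨hv, hσ, hcon⟩)
        rw [hmo]
        simp only [modeVal]
        exact e2.trans (le_max_left _ _)
  · rw [hs', hτt]
    by_cases hm : move v
    · rw [if_pos hm]
      have hk : ¬ keep (s.σ v) := by rw [hkeep]; simp only [keep]; tauto
      rw [if_neg hk, if_pos (Or.inr ((hmove v).mpr hm)), s.inv]
      rfl
    · rw [if_neg hm]
      have hk : ¬ keep v := by simp only [keep]; tauto
      rw [if_neg hk, if_neg (by tauto)]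
      rfl

/-- Masking of a network. -/
lemma mask_run {G : SimpleGraph V} (L : List (NStage G)) : ∀ (M : Set V),
    ∃ (L' : List (NStage G)) (τ : Equiv.Perm V), L'.length = L.length ∧ ∀ (f g : V → ℕ) (B : ℕ),
      (∀ v, v ∉ M → f v = g v ∧ g v < B) → (∀ v, v ∈ M → B ≤ g v) →
      (∀ v, τ.symm v ∉ M → nrun L' f v = nrun L g v ∧ nrun L g v < B) ∧
      (∀ v, τ.symm v ∈ M → B ≤ nrun L g v) ∧ ∀ v, v ∈ M → nrun L' f (τ v) = f v := by
  induction L with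
  | nil =>
    intro M
    exact ⟨[], 1, rfl, fun f g B h1 h2 => ⟨fun v hv => h1 v hv, fun v hv => h2 v hv, fun v _ => rfl⟩⟩
  | cons s L ih =>
    intro M
    obtain ⟨s', τ1, hs⟩ := mask_stage s M
    obtain ⟨L', τ2, hl, hL⟩ := ih {v | τ1.symm v ∈ M}
    refine ⟨s' :: L', τ1.trans τ2, by simp [hl], fun f g B h1 h2 => ?_⟩
    obtain ⟨a1, a2, a3⟩ := hs f g B h1 h2
    obtain ⟨b1, b2, b3⟩ := hL (s'.apply f) (s.apply g) B a1 a2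
    refine ⟨b1, b2, fun v hv => ?_⟩
    rw [nrun_cons, Equiv.trans_apply, b3 _ (by simpa using hv), a3 v hv]

end AKS

namespace AKS

open scoped Classical in
/-- Threshold configuration on slots: `false` means a small key is present. -/
noncomputable def thr {U : Type*} (ι : V → U) (f : V → ℕ) (θ : ℕ) (u : U) : Bool :=
  decide (¬ ∃ v, ι v = u ∧ f v < θ)

lemma thr_false {U : Type*} (ι : V → U) (f : V → ℕ) (θ : ℕ) (u : U) :
    thr ι f θ u = false ↔ ∃ v, ι v = u ∧ f v < θ := by
  unfold thr; simp

lemma bool_eq_of_false_iff {a b : Bool} (h : a = false ↔ b = false) : a = b := by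
  cases a <;> cases b <;> simp_all

/-- Effect of sorting all active groups. -/
structure SG {U κ : Type*} [Fintype U] [DecidableEq κ] (A : κ → Prop) (grp : U → κ) (pos : U → ℕ)
    (g g' : U → Bool) : Prop where
  out : ∀ u, ¬ A (grp u) → g' u = g u
  cnt : ∀ c, (univ.filter fun u => grp u = c ∧ g' u = false).card =
    (univ.filter fun u => grp u = c ∧ g u = false).card
  srt : ∀ u u', A (grp u) → grp u = grp u' → pos u ≤ pos u' → g' u ≤ g' u'

lemma perm_extend [Fintype V] (P : V → Prop) (tgt : V → V) (h : ∀ v w, P v → P w → tgt v = tgt w → v = w) :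
    ∃ ρ : Equiv.Perm V, ∀ v, P v → ρ v = tgt v := by
  classical
  have hi : Set.InjOn tgt {v | P v} := fun v hv w hw e => h v w hv hw e
  let e : {v // P v} ≃ {y // y ∈ tgt '' {v | P v}} := Equiv.Set.imageOfInjOn tgt {v | P v} hi
  refine ⟨e.extendSubtype, fun v hv => ?_⟩
  rw [Equiv.extendSubtype_apply_of_mem _ _ hv]
  rfl

section sim
variable {X U κ : Type*} [Fintype V] [Fintype X] [Fintype U] [DecidableEq κ]
  {G : SimpleGraph V} {H : SimpleGraph X} {q m : ℕ}

set_option maxHeartbeats 1000000 in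
lemma sim_round (φ : Fin q → X → V) (hφ : ∀ i x j y, φ i x = φ j y → i = j ∧ x = y)
    (hadj : ∀ i x y, H.Adj x y → G.Adj (φ i x) (φ i y)) (πH : X ≃ Fin m) (LH : List (NStage H))
    (hLH : ∀ g : X → ℕ, Function.Injective g → ∀ x y, πH x < πH y → nrun LH g x < nrun LH g y)
    (R : ℕ) (hR : ∀ ρ : Equiv.Perm V, ∃ L : List (NStage G), L.length ≤ R ∧ ∀ f v, nrun L f (ρ v) = f v)
    (A : κ → Prop) (grp : U → κ) (pos : U → ℕ) (code : κ → Fin q)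
    (hcode : ∀ c c', A c → A c' → code c = code c' → c = c')
    (hpos : ∀ u, A (grp u) → pos u < m)
    (hinj : ∀ u u', A (grp u) → grp u = grp u' → pos u = pos u' → u = u')
    (hcont : ∀ u, A (grp u) → ∀ k < pos u, ∃ u', grp u' = grp u ∧ pos u' = k)
    (ι : V → U) (hι : Function.Injective ι) :
    ∃ (L : List (NStage G)) (ι' : V → U), L.length ≤ R + LH.length ∧ Function.Injective ι' ∧
      ∀ f : V → ℕ, Function.Injective f → ∀ θ, SG A grp pos (thr ι f θ) (thr ι' (nrun L f) θ) := by
  classical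
  let tgt : V → V := fun v => if h : A (grp (ι v)) then
    φ (code (grp (ι v))) (πH.symm ⟨pos (ι v), hpos _ h⟩) else v
  have htgt : ∀ v (h : A (grp (ι v))), tgt v = φ (code (grp (ι v))) (πH.symm ⟨pos (ι v), hpos _ h⟩) := by
    intro v h; simp only [tgt]; rw [dif_pos h]
  obtain ⟨ρ, hρ0⟩ := perm_extend (fun v => A (grp (ι v))) tgt (by
    intro v w hv hw e
    rw [htgt v hv, htgt w hw] at e
    obtain ⟨e1, e2⟩ := hφ _ _ _ _ e
    have e3 := hcode _ _ hv hw e1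
    have e4 : pos (ι v) = pos (ι w) := by simpa using e2
    exact hι (hinj _ _ hv e3 e4))
  have hρ : ∀ v (h : A (grp (ι v))), ρ v = φ (code (grp (ι v))) (πH.symm ⟨pos (ι v), hpos _ h⟩) :=
    fun v h => (hρ0 v h).trans (htgt v h)
  let M : Set V := {y | ¬ A (grp (ι (ρ.symm y)))}
  have hM : ∀ y, y ∉ M ↔ A (grp (ι (ρ.symm y))) := by intro y; simp [M]
  -- unmasked vertices of a copy
  have hMc : ∀ i x, φ i x ∉ M → code (grp (ι (ρ.symm (φ i x)))) = i ∧ pos (ι (ρ.symm (φ i x))) = πH x := by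
    intro i x hx
    have h1 := (hM _).mp hx
    have h2 := hρ _ h1
    rw [Equiv.apply_symm_apply] at h2
    obtain ⟨h3, h4⟩ := hφ _ _ _ _ h2
    refine ⟨h3.symm, ?_⟩
    have h5 := congrArg πH h4
    rw [Equiv.apply_symm_apply] at h5
    rw [h5]
  have hMcopy : ∀ y, y ∉ M → ∃ i x, φ i x = y := by
    intro y hy
    have h2 := hρ _ ((hM _).mp hy)
    rw [Equiv.apply_symm_apply] at h2
    exact ⟨_, _, h2.symm⟩
  obtain ⟨L0, hL0, hrun0⟩ := copies_run φ hφ hadj LH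
  obtain ⟨L', τ, hL', hmask⟩ := mask_run L0 M
  obtain ⟨Lr, hLr, hroute⟩ := hR ρ
  have facts : ∀ f : V → ℕ, Function.Injective f → ∃ (g g2 : V → ℕ) (B : ℕ),
      (∀ y, y ∉ M → g y = f (ρ.symm y) ∧ g y < B) ∧ (∀ y, y ∈ M → B ≤ g y) ∧
      (∀ v, τ.symm v ∉ M → nrun (Lr ++ L') f v = g2 v ∧ g2 v < B) ∧
      (∀ v, τ.symm v ∈ M → B ≤ g2 v) ∧
      (∀ v, v ∈ M → nrun (Lr ++ L') f (τ v) = f (ρ.symm v)) ∧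
      (∀ i x y, πH x < πH y → g2 (φ i x) < g2 (φ i y)) ∧
      (∀ i, ∃ e : Equiv.Perm X, ∀ x, g2 (φ i x) = g (φ i (e x))) ∧
      (∀ v, (∀ i x, φ i x ≠ v) → g2 v = g v) := by
    intro f hf
    let B := (∑ v, f v) + 1
    have hB : ∀ v, f v < B := fun v =>
      Nat.lt_succ_of_le (Finset.single_le_sum (f := f) (fun _ _ => Nat.zero_le _) (mem_univ v))
    have hf1 : ∀ y, nrun Lr f y = f (ρ.symm y) := by
      intro y
      have := hroute f (ρ.symm y)
      rwa [Equiv.apply_symm_apply] at this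
    let g : V → ℕ := fun y => if y ∈ M then B + (Fintype.equivFin V y : ℕ) else f (ρ.symm y)
    have g1 : ∀ y, y ∈ M → g y = B + (Fintype.equivFin V y : ℕ) := fun y hy => if_pos hy
    have g0 : ∀ y, y ∉ M → g y = f (ρ.symm y) := fun y hy => if_neg hy
    have hg : Function.Injective g := by
      intro a b hab
      by_cases ha : a ∈ M <;> by_cases hb : b ∈ M
      · rw [g1 a ha, g1 b hb] at hab
        exact (Fintype.equivFin V).injective (Fin.ext (by omega))
      · rw [g1 a ha, g0 b hb] at hab
        have := hB (ρ.symm b); omega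
      · rw [g0 a ha, g1 b hb] at hab
        have := hB (ρ.symm a); omega
      · rw [g0 a ha, g0 b hb] at hab
        exact ρ.symm.injective (hf hab)
    obtain ⟨m1, m2, m3⟩ := hmask (nrun Lr f) g B
      (fun v hv => ⟨by rw [g0 v hv, hf1], by rw [g0 v hv]; exact hB _⟩)
      (fun v hv => by rw [g1 v hv]; omega)
    have hinjc : ∀ i, Function.Injective (fun x => g (φ i x)) := fun i x y e => (hφ _ _ _ _ (hg e)).2
    refine ⟨g, nrun L0 g, B, fun y hy => ⟨g0 y hy, by rw [g0 y hy]; exact hB _⟩,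
      fun y hy => by rw [g1 y hy]; omega, ?_, m2, ?_, ?_, ?_, (hrun0 g).2⟩
    · intro v hv; rw [nrun_append]; exact m1 v hv
    · intro v hv; rw [nrun_append, m3 v hv, hf1]
    · intro i x y hxy
      rw [(hrun0 g).1, (hrun0 g).1]
      exact hLH _ (hinjc i) x y hxy
    · intro i
      obtain ⟨e, he⟩ := nrun_perm LH (fun x => g (φ i x))
      exact ⟨e, fun x => by rw [(hrun0 g).1, he]⟩
  -- the slot for an unmasked vertex
  have slot : ∀ v, τ.symm v ∉ M → ∃ u i x, v = φ i x ∧ A (grp u) ∧ code (grp u) = i ∧ pos u = πH x := by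
    intro v hv
    obtain ⟨g, g2, B, a1, a2, b1, b2, -, d, e, o⟩ := facts (fun v => (Fintype.equivFin V v : ℕ))
      (fun a b h => (Fintype.equivFin V).injective (Fin.ext h))
    have hvB := (b1 v hv).2
    obtain ⟨i, x, rfl⟩ : ∃ i x, φ i x = v := by
      by_contra hcon
      push Not at hcon
      have h1 := o v hcon
      have h2 : v ∈ M := by
        by_contra h3
        obtain ⟨i, x, h4⟩ := hMcopy v h3
        exact hcon i x h4
      have := a2 v h2
      omega
    obtain ⟨e, he⟩ := e i
    -- there is an unmasked vertex of rank at least that of x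
    obtain ⟨x', hx', hxx⟩ : ∃ x', φ i x' ∉ M ∧ πH x ≤ πH x' := by
      by_contra hcon
      push Not at hcon
      have c1 : (univ.filter fun y => πH y ≤ πH x).card ≤ (univ.filter fun y => πH y < πH x).card := by
        apply Finset.card_le_card_of_injOn e
        · intro y hy
          simp only [coe_filter, mem_univ, true_and, Set.mem_ofPred_eq] at hy ⊢
          apply hcon
          intro hm
          have h1 := a2 _ hm
          rw [← he] at h1
          rcases hy.lt_or_eq with h2 | h2
          · have := d i _ _ h2; omega
          · rw [πH.injective h2] at h1; omega
        · exact fun a _ b _ h => e.injective h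
      have c2 : (univ.filter fun y => πH y < πH x) ⊂ (univ.filter fun y => πH y ≤ πH x) := by
        rw [Finset.ssubset_iff_of_subset]
        · exact ⟨x, by simp, by simp⟩
        · intro y hy
          simp only [mem_filter, mem_univ, true_and] at hy ⊢
          exact hy.le
      have := Finset.card_lt_card c2
      omega
    obtain ⟨k1, k2⟩ := hMc i x' hx'
    have k3 := (hM _).mp hx'
    rcases hxx.lt_or_eq with h2 | h2
    · obtain ⟨u, hu1, hu2⟩ := hcont _ k3 (πH x) (by rw [k2]; exact h2)
      exact ⟨u, i, x, rfl, by rw [hu1]; exact k3, by rw [hu1]; exact k1, hu2⟩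
    · exact ⟨_, i, x, rfl, k3, k1, by rw [k2, h2]⟩
  have hιex : ∀ v, ∃ u, (τ.symm v ∈ M → u = ι (ρ.symm (τ.symm v))) ∧
      (τ.symm v ∉ M → A (grp u) ∧ ∃ i x, v = φ i x ∧ code (grp u) = i ∧ pos u = πH x) := by
    intro v
    by_cases h : τ.symm v ∈ M
    · exact ⟨_, fun _ => rfl, fun h' => absurd h h'⟩
    · obtain ⟨u, i, x, h1, h2, h3, h4⟩ := slot v h
      exact ⟨u, fun h' => absurd h' h, fun _ => ⟨h2, i, x, h1, h3, h4⟩⟩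
  choose ι' hι1 hι2 using hιex
  have hA : ∀ v, A (grp (ι' v)) ↔ τ.symm v ∉ M := by
    intro v
    constructor
    · intro h h'
      rw [hι1 v h'] at h
      exact h' h
    · intro h; exact (hι2 v h).1
  have hι'c : ∀ i x, τ.symm (φ i x) ∉ M → code (grp (ι' (φ i x))) = i ∧ pos (ι' (φ i x)) = πH x := by
    intro i x h
    obtain ⟨-, j, y, e1, e2, e3⟩ := hι2 _ h
    obtain ⟨rfl, rfl⟩ := hφ _ _ _ _ e1
    exact ⟨e2, e3⟩
  have hι'copy : ∀ v, τ.symm v ∉ M → ∃ x, v = φ (code (grp (ι' v))) x := by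
    intro v h
    obtain ⟨-, j, y, e1, e2, e3⟩ := hι2 _ h
    exact ⟨y, by rw [e2]; exact e1⟩
  have hι'inj : Function.Injective ι' := by
    intro a b hab
    by_cases ha : τ.symm a ∈ M
    · have hb : τ.symm b ∈ M := by
        by_contra hb
        rw [← hA, ← hab, hA] at hb
        exact hb ha
      rw [hι1 a ha, hι1 b hb] at hab
      exact τ.symm.injective (ρ.symm.injective (hι hab))
    · have hb : τ.symm b ∉ M := by
        rw [← hA, ← hab, hA]; exact ha
      obtain ⟨-, i, x, e1, e2, e3⟩ := hι2 a ha
      obtain ⟨-, j, y, d1, d2, d3⟩ := hι2 b hb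
      rw [hab] at e2 e3
      have hij : i = j := e2.symm.trans d2
      have hxy : x = y := πH.injective (Fin.ext (e3.symm.trans d3))
      rw [e1, d1, hij, hxy]
  refine ⟨Lr ++ L', ι', ?_, hι'inj, ?_⟩
  · rw [List.length_append]; omega
  intro f hf θ
  obtain ⟨g, g2, B, a1, a2, b1, b2, cc, d, e, o⟩ := facts f hf
  generalize nrun (Lr ++ L') f = f2 at b1 cc
  have hout : ∀ u, ¬ A (grp u) → thr ι' f2 θ u = thr ι f θ u := by
    intro u hu
    have : thr ι' f2 θ u = false ↔ thr ι f θ u = false := by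
      rw [thr_false, thr_false]
      constructor
      · rintro ⟨v, rfl, hv⟩
        have h1 : τ.symm v ∈ M := by
          by_contra h; exact hu ((hA v).mpr h)
        refine ⟨ρ.symm (τ.symm v), (hι1 v h1).symm, ?_⟩
        rw [← cc _ h1, Equiv.apply_symm_apply]; exact hv
      · rintro ⟨v, rfl, hv⟩
        have h1 : ρ v ∈ M := by
          by_contra h
          rw [hM, Equiv.symm_apply_apply] at h
          exact hu h
        refine ⟨τ (ρ v), ?_, ?_⟩
        · rw [hι1 _ (by rw [Equiv.symm_apply_apply]; exact h1), Equiv.symm_apply_apply, Equiv.symm_apply_apply]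
        · rw [cc _ h1, Equiv.symm_apply_apply]; exact hv
    exact bool_eq_of_false_iff this
  refine ⟨hout, ?_, ?_⟩
  · intro c
    by_cases hc : A c
    · obtain ⟨e, he⟩ := e (code c)
      have e1 : (univ.filter fun x => g2 (φ (code c) x) < min θ B).card =
          (univ.filter fun u => grp u = c ∧ thr ι' f2 θ u = false).card := by
        apply card_bij (fun x _ => ι' (φ (code c) x))
        · intro x hx
          simp only [mem_filter, mem_univ, true_and, lt_min_iff] at hx ⊢
          have h1 : τ.symm (φ (code c) x) ∉ M := by
            intro h; have := b2 _ h; omega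
          refine ⟨hcode _ _ ((hA _).mpr h1) hc (hι'c _ _ h1).1, ?_⟩
          rw [thr_false]
          exact ⟨_, rfl, by rw [(b1 _ h1).1]; exact hx.1⟩
        · intro x _ y _ h
          exact (hφ _ _ _ _ (hι'inj h)).2
        · intro u hu
          simp only [mem_filter, mem_univ, true_and, thr_false, lt_min_iff] at hu ⊢
          obtain ⟨hu1, v, rfl, hv⟩ := hu
          have h1 := (hA v).mp (by rw [hu1]; exact hc)
          obtain ⟨x, hx⟩ := hι'copy v h1
          rw [hu1] at hx
          obtain ⟨h3, h4⟩ := b1 v h1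
          refine ⟨x, ?_, by rw [← hx]⟩
          rw [← hx]; omega
      have e2 : (univ.filter fun x => g (φ (code c) x) < min θ B).card =
          (univ.filter fun u => grp u = c ∧ thr ι f θ u = false).card := by
        apply card_bij (fun x _ => ι (ρ.symm (φ (code c) x)))
        · intro x hx
          simp only [mem_filter, mem_univ, true_and, lt_min_iff] at hx ⊢
          have h1 : φ (code c) x ∉ M := by
            intro h; have := a2 _ h; omega
          refine ⟨hcode _ _ ((hM _).mp h1) hc (hMc _ _ h1).1, ?_⟩
          rw [thr_false]
          exact ⟨_, rfl, by rw [← (a1 _ h1).1]; exact hx.1⟩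
        · intro x _ y _ h
          exact (hφ _ _ _ _ (ρ.symm.injective (hι h))).2
        · intro u hu
          simp only [mem_filter, mem_univ, true_and, thr_false, lt_min_iff] at hu ⊢
          obtain ⟨hu1, v, rfl, hv⟩ := hu
          have hact : A (grp (ι v)) := by rw [hu1]; exact hc
          have h1 := hρ v hact
          have h2 : ρ v ∉ M := by rw [hM, Equiv.symm_apply_apply]; exact hact
          obtain ⟨h3, h4⟩ := a1 _ h2
          rw [Equiv.symm_apply_apply] at h3
          rw [hu1] at h1
          refine ⟨πH.symm ⟨pos (ι v), hpos _ hact⟩, ?_, ?_⟩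
          · rw [← h1]; omega
          · rw [← h1, Equiv.symm_apply_apply]
      rw [← e1, ← e2]
      apply card_bij (fun x _ => e x)
      · intro x hx
        simp only [mem_filter, mem_univ, true_and] at hx ⊢
        rw [← he]; exact hx
      · intro x _ y _ h; exact e.injective h
      · intro x hx
        simp only [mem_filter, mem_univ, true_and] at hx ⊢
        exact ⟨e.symm x, by rw [he, Equiv.apply_symm_apply]; exact hx, by simp⟩
    · congr 1
      apply filter_congr
      intro u _
      constructor
      · rintro ⟨rfl, h⟩; exact ⟨rfl, by rw [← hout u hc]; exact h⟩
      · rintro ⟨rfl, h⟩; exact ⟨rfl, by rw [hout u hc]; exact h⟩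
  · intro u u' hu huu hpp
    have key : thr ι' f2 θ u' = false → thr ι' f2 θ u = false := by
      rw [thr_false, thr_false]
      rintro ⟨v, rfl, hv⟩
      have h1 := (hA v).mp (by rw [← huu]; exact hu)
      obtain ⟨x', hx'⟩ := hι'copy v h1
      obtain ⟨h3, h4⟩ := b1 v h1
      set i := code (grp (ι' v)) with hi
      have hp' : pos (ι' v) = πH x' := by
        have := (hι'c i x' (by rw [← hx']; exact h1)).2
        rwa [← hx'] at this
      let x := πH.symm ⟨pos u, hpos u hu⟩
      have hle : g2 (φ i x) ≤ g2 (φ i x') := by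
        have h5 : πH x ≤ πH x' := by
          rw [Fin.le_def, ← hp']
          simpa [x] using hpp
        rcases h5.lt_or_eq with h6 | h6
        · exact (d i _ _ h6).le
        · rw [πH.injective h6]
      rw [← hx'] at hle
      have h7 : τ.symm (φ i x) ∉ M := by
        intro h; have := b2 _ h; omega
      refine ⟨φ i x, ?_, by rw [(b1 _ h7).1]; omega⟩
      obtain ⟨q1, q2⟩ := hι'c i x h7
      have q3 := (hA _).mpr h7
      apply hinj _ _ q3
      · rw [huu]
        exact hcode _ _ q3 (by rw [← huu]; exact hu) (by rw [q1])
      · rw [q2]; simp [x]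
    cases h1 : thr ι' f2 θ u
    · exact Bool.false_le _
    · cases h2 : thr ι' f2 θ u'
      · rw [key h2] at h1; exact absurd h1 (by simp)
      · exact le_rfl

end sim
end AKS

namespace AKS

lemma sg_chain {U κ : Type*} [Fintype U] [DecidableEq κ] {A1 A2 A3 : κ → Prop} {grp : U → κ} {pos : U → ℕ}
    {g g1 g2 : U → Bool} (h1 : SG A1 grp pos g g1) (h2 : SG A2 grp pos g1 g2)
    (h3 : ∀ c, A3 c ↔ A1 c ∨ A2 c) (hd : ∀ c, A1 c → ¬ A2 c) : SG A3 grp pos g g2 := by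
  refine ⟨?_, ?_, ?_⟩
  · intro u hu
    rw [h3, not_or] at hu
    rw [h2.out u hu.2, h1.out u hu.1]
  · intro c
    rw [h2.cnt, h1.cnt]
  · intro u u' hu huu hp
    rw [h3] at hu
    rcases hu with hu | hu
    · rw [h2.out u (hd _ hu), h2.out u' (by rw [← huu]; exact hd _ hu)]
      exact h1.srt u u' hu huu hp
    · exact h2.srt u u' hu huu hp

section pass
variable {W : Type*} [DecidableEq W]

def own (s : CStage W) (w : W) : W := if s.lo w then w else s.σ w

lemma own_own (s : CStage W) (w : W) : own s (own s w) = own s w := by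
  unfold own
  by_cases h : s.lo w
  · simp [h]
  · by_cases h2 : s.σ w = w
    · simp [h, h2]
    · have := s.hlo w h2
      simp [h] at this
      simp [h, this]

lemma own_cases (s : CStage W) (w : W) : own s w = w ∨ own s w = s.σ w := by
  unfold own; split_ifs <;> simp

lemma own_inj (s : CStage W) (w w' : W) (h : own s w = own s w') (h2 : own s w = w ↔ own s w' = w') : w = w' := by
  by_cases h3 : own s w = w
  · rw [← h3, h, h2.mp h3]
  · have h4 : own s w' ≠ w' := fun e => h3 (h2.mpr e)
    have h5 := (own_cases s w).resolve_left h3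
    have h6 := (own_cases s w').resolve_left h4
    rw [← s.inv w, ← s.inv w', ← h5, ← h6, h]

def bpos {h : ℕ} (s : CStage W) (u : W × Fin h) : ℕ := u.2 + if own s u.1 = u.1 then 0 else h

lemma bpos_inj {h : ℕ} (s : CStage W) (u u' : W × Fin h) (h1 : own s u.1 = own s u'.1)
    (h2 : bpos s u = bpos s u') : u = u' := by
  have l1 := u.2.2
  have l2 := u'.2.2
  unfold bpos at h2
  have h3 : u.1 = u'.1 := by
    apply own_inj s _ _ h1
    constructor
    · intro h3
      by_contra h4
      rw [if_pos h3, if_neg h4] at h2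
      omega
    · intro h3
      by_contra h4
      rw [if_pos h3, if_neg h4] at h2
      omega
  rw [h3] at h2
  exact Prod.ext h3 (Fin.ext (by omega))

lemma bpos_cont {h : ℕ} (s : CStage W) (u : W × Fin h) (k : ℕ) (hk : k < bpos s u) :
    ∃ u' : W × Fin h, own s u'.1 = own s u.1 ∧ bpos s u' = k := by
  have l1 := u.2.2
  unfold bpos at hk
  by_cases h1 : own s u.1 = u.1
  · rw [if_pos h1] at hk
    exact ⟨(u.1, ⟨k, by omega⟩), rfl, by simp [bpos, h1]⟩
  · rw [if_neg h1] at hk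
    by_cases h2 : k < h
    · exact ⟨(own s u.1, ⟨k, h2⟩), own_own s _, by simp [bpos, own_own]⟩
    · exact ⟨(u.1, ⟨k - h, by omega⟩), rfl, by simp [bpos, h1]; omega⟩

lemma bpos_lt {h m : ℕ} (hm : 2 * h ≤ m) (s : CStage W) (u : W × Fin h) : bpos s u < m := by
  have l1 := u.2.2
  unfold bpos
  split_ifs <;> omega

/-- `r` picks one value of `G` in every block. -/
def Sel {h : ℕ} (G : W × Fin h → Bool) (r : W → Bool) : Prop := ∀ w, ∃ a, G (w, a) = r w

def nf {h : ℕ} (G : W × Fin h → Bool) (w : W) : ℕ := (univ.filter fun a : Fin h => G (w, a) = false).card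

lemma nf_pos {h : ℕ} (G : W × Fin h → Bool) (w : W) : 0 < nf G w ↔ ∃ a, G (w, a) = false := by
  unfold nf
  rw [Finset.card_pos]
  constructor
  · rintro ⟨a, ha⟩; exact ⟨a, (mem_filter.mp ha).2⟩
  · rintro ⟨a, ha⟩; exact ⟨a, mem_filter.mpr ⟨mem_univ _, ha⟩⟩

lemma nf_le {h : ℕ} (G : W × Fin h → Bool) (w : W) : nf G w ≤ h := by
  unfold nf
  exact (card_le_univ _).trans (by simp)

lemma nf_lt {h : ℕ} (G : W × Fin h → Bool) (w : W) : nf G w < h ↔ ∃ a, G (w, a) = true := by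
  constructor
  · intro hl
    by_contra hc
    push Not at hc
    have : nf G w = h := by
      unfold nf
      rw [filter_true_of_mem (fun a _ => by simpa using hc a)]
      simp
    omega
  · rintro ⟨a, ha⟩
    have : nf G w < (univ : Finset (Fin h)).card := by
      apply card_lt_card
      rw [Finset.ssubset_univ_iff]
      intro he
      have := he ▸ mem_univ a
      simp [ha] at this
    simpa using this

variable [Fintype W]

lemma nf_sum {h : ℕ} (s : CStage W) (G : W × Fin h → Bool) (c : W) :
    (univ.filter fun u : W × Fin h => own s u.1 = c ∧ G u = false).card =
      ∑ w ∈ univ.filter (fun w => own s w = c), nf G w := by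
  unfold nf
  rw [← card_sigma]
  apply card_bij (fun u _ => ⟨u.1, u.2⟩)
  · rintro ⟨w, a⟩ hu
    simpa using hu
  · rintro ⟨w, a⟩ _ ⟨w', a'⟩ _ e
    simp at e
    simp [e]
  · rintro ⟨w, a⟩ hu
    exact ⟨(w, a), by simpa using hu, rfl⟩

lemma fiber_fix (s : CStage W) (c : W) (h : own s c = c) (hc : s.σ c = c) :
    (univ.filter fun w => own s w = c) = {c} := by
  ext w
  simp only [mem_filter, mem_univ, true_and, mem_singleton]
  constructor
  · intro hw
    rcases own_cases s w with e | e
    · rw [← e, hw]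
    · rw [← s.inv w, ← e, hw, hc]
  · rintro rfl; exact h

lemma own_partner (s : CStage W) (c : W) (h : own s c = c) (hc : s.σ c ≠ c) : own s (s.σ c) = c := by
  have h1 := s.hlo c hc
  unfold own at h ⊢
  by_cases h2 : s.lo c
  · simp [h1, h2, s.inv]
  · simp [h2] at h; exact absurd h hc

lemma fiber_pair (s : CStage W) (c : W) (h : own s c = c) (hc : s.σ c ≠ c) :
    (univ.filter fun w => own s w = c) = {c, s.σ c} := by
  ext w
  simp only [mem_filter, mem_univ, true_and, mem_singleton, mem_insert]
  constructor
  · intro hw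
    rcases own_cases s w with e | e
    · left; rw [← e, hw]
    · right; rw [← s.inv w, ← e, hw]
  · rintro (rfl | rfl)
    · exact h
    · exact own_partner s c h hc

lemma block_lemma {h : ℕ} (hh : 0 < h) (s : CStage W) (G G' : W × Fin h → Bool)
    (hS : SG (fun _ => True) (fun u : W × Fin h => own s u.1) (bpos s) G G') (r' : W → Bool) (hr : Sel G' r') :
    ∃ r, Sel G r ∧ s.apply r = r' := by
  have loc : ∀ c, ∃ pq : Bool × Bool, own s c = c → (∃ a, G (c, a) = pq.1) ∧ (∃ a, G (s.σ c, a) = pq.2) ∧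
      min pq.1 pq.2 = r' c ∧ max pq.1 pq.2 = r' (s.σ c) ∧ (s.σ c = c → pq.1 = pq.2) := by
    intro c
    by_cases hc : own s c = c
    swap
    · exact ⟨(true, true), fun h => absurd h hc⟩
    have hcnt := hS.cnt c
    rw [nf_sum, nf_sum] at hcnt
    by_cases hf : s.σ c = c
    · rw [fiber_fix s c hc hf, sum_singleton, sum_singleton] at hcnt
      obtain ⟨a1, ha1⟩ := hr c
      have : ∃ a, G (c, a) = r' c := by
        cases hrc : r' c
        · rw [← nf_pos, ← hcnt, nf_pos]; exact ⟨a1, by rw [ha1, hrc]⟩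
        · rw [← nf_lt, ← hcnt, nf_lt]; exact ⟨a1, by rw [ha1, hrc]⟩
      exact ⟨(r' c, r' c), fun _ => ⟨this, by rw [hf]; exact this, by simp, by simp [hf], fun _ => rfl⟩⟩
    · rw [fiber_pair s c hc hf, sum_pair (Ne.symm hf), sum_pair (Ne.symm hf)] at hcnt
      obtain ⟨a1, ha1⟩ := hr c
      obtain ⟨a2, ha2⟩ := hr (s.σ c)
      have hop := own_partner s c hc hf
      have hsrt : ∀ a b, G' (c, a) ≤ G' (s.σ c, b) := by
        intro a b
        apply hS.srt (c, a) (s.σ c, b) trivial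
        · simp only [hc, hop]
        · have := a.2
          simp only [bpos, hc, hop, if_true, if_neg (Ne.symm hf)]
          omega
      have b1 := nf_le G c
      have b2 := nf_le G (s.σ c)
      have b3 := nf_le G' c
      have b4 := nf_le G' (s.σ c)
      have h12 := hsrt a1 a2
      rw [ha1, ha2] at h12
      cases hrc : r' c <;> cases hrd : r' (s.σ c)
      · -- both false
        have h1 : ¬ nf G' c < h := by
          rw [nf_lt]
          rintro ⟨a, ha⟩
          have := hsrt a a2
          rw [ha, ha2, hrd] at this
          exact absurd this (by decide)
        have h2 : 0 < nf G' (s.σ c) := (nf_pos _ _).mpr ⟨a2, by rw [ha2, hrd]⟩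
        refine ⟨(false, false), fun _ => ⟨(nf_pos _ _).mp (by omega), (nf_pos _ _).mp (by omega), rfl, rfl, fun _ => rfl⟩⟩
      · have h1 : 0 < nf G' c := (nf_pos _ _).mpr ⟨a1, by rw [ha1, hrc]⟩
        have h2 : nf G' (s.σ c) < h := (nf_lt _ _).mpr ⟨a2, by rw [ha2, hrd]⟩
        by_cases h3 : 0 < nf G c ∧ nf G (s.σ c) < h
        · exact ⟨(false, true), fun _ => ⟨(nf_pos _ _).mp h3.1, (nf_lt _ _).mp h3.2, rfl, rfl, fun e => absurd e hf⟩⟩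
        · exact ⟨(true, false), fun _ => ⟨(nf_lt _ _).mp (by omega), (nf_pos _ _).mp (by omega), rfl, rfl,
            fun e => absurd e hf⟩⟩
      · rw [hrc, hrd] at h12; exact absurd h12 (by decide)
      · have h1 : ¬ 0 < nf G' (s.σ c) := by
          rw [nf_pos]
          rintro ⟨a, ha⟩
          have := hsrt a1 a
          rw [ha, ha1, hrc] at this
          exact absurd this (by decide)
        have h2 : nf G' c < h := (nf_lt _ _).mpr ⟨a1, by rw [ha1, hrc]⟩
        exact ⟨(true, true), fun _ => ⟨(nf_lt _ _).mp (by omega), (nf_lt _ _).mp (by omega), rfl, rfl, fun _ => rfl⟩⟩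
  choose pq hpq using loc
  have hnot : ∀ w, own s w ≠ w → own s w = s.σ w ∧ own s (s.σ w) = s.σ w := by
    intro w hw
    have h1 := (own_cases s w).resolve_left hw
    exact ⟨h1, by rw [← h1]; exact own_own s w⟩
  refine ⟨fun w => if own s w = w then (pq w).1 else (pq (s.σ w)).2, ?_, ?_⟩
  · intro w
    by_cases hw : own s w = w
    · simp only [hw, if_true]; exact (hpq w hw).1
    · simp only [hw, if_false]
      have := (hpq _ (hnot w hw).2).2.1
      rwa [s.inv] at this
  · funext w
    unfold CStage.apply
    by_cases hf : s.σ w = w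
    · have hw : own s w = w := by rcases own_cases s w with e | e <;> simp [e, hf]
      obtain ⟨-, -, h3, h4, h5⟩ := hpq w hw
      have h5 := h5 hf
      simp only [hf, hw, if_true, min_self, max_self, ite_self]
      rw [← h3, ← h5, min_self]
    · by_cases hl : s.lo w
      · have hw : own s w = w := by simp [own, hl]
        have hp := own_partner s w hw hf
        obtain ⟨-, -, h3, h4, h5⟩ := hpq w hw
        simp only [hl, hw, hp, if_true, if_neg (Ne.symm hf), s.inv]
        exact h3
      · have hw : own s w ≠ w := by simp [own, hl, hf]
        obtain ⟨e1, e2⟩ := hnot w hw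
        obtain ⟨-, -, h3, h4, h5⟩ := hpq _ e2
        rw [s.inv] at h4
        rw [if_neg hl]
        beta_reduce
        rw [if_neg hw, if_pos e2, max_comm]
        exact h4

end pass

section main
variable {X : Type*} [Fintype V] [Fintype X]
  {G : SimpleGraph V} {H : SimpleGraph X} {q m : ℕ}

lemma pass_rounds (φ : Fin q → X → V) (hφ : ∀ i x j y, φ i x = φ j y → i = j ∧ x = y)
    (hadj : ∀ i x y, H.Adj x y → G.Adj (φ i x) (φ i y)) (πH : X ≃ Fin m) (LH : List (NStage H))
    (hLH : ∀ g : X → ℕ, Function.Injective g → ∀ x y, πH x < πH y → nrun LH g x < nrun LH g y)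
    (R : ℕ) (hR : ∀ ρ : Equiv.Perm V, ∃ L : List (NStage G), L.length ≤ R ∧ ∀ f v, nrun L f (ρ v) = f v)
    {N h : ℕ} (hq : 0 < q) (hm : 2 * h ≤ m) (s : CStage (Fin N))
    (ι : V → Fin N × Fin h) (hι : Function.Injective ι) (T : ℕ) :
    ∃ (L : List (NStage G)) (ι' : V → Fin N × Fin h), L.length ≤ T * (R + LH.length) ∧ Function.Injective ι' ∧
      ∀ f : V → ℕ, Function.Injective f → ∀ θ,
        SG (fun w : Fin N => (w : ℕ) / q < T) (fun u : Fin N × Fin h => own s u.1) (bpos s)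
          (thr ι f θ) (thr ι' (nrun L f) θ) := by
  induction T with
  | zero =>
    refine ⟨[], ι, by simp, hι, fun f hf θ => ⟨fun u _ => rfl, fun c => rfl, fun u u' hu => ?_⟩⟩
    exact absurd hu (Nat.not_lt_zero _)
  | succ T ih =>
    obtain ⟨L1, ι1, hl1, hi1, hs1⟩ := ih
    obtain ⟨L2, ι2, hl2, hi2, hs2⟩ := sim_round φ hφ hadj πH LH hLH R hR
      (fun w : Fin N => (w : ℕ) / q = T) (fun u : Fin N × Fin h => own s u.1) (bpos s)
      (fun w => ⟨(w : ℕ) % q, Nat.mod_lt _ hq⟩)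
      (by
        intro c c' h1 h2 h3
        have h3 : (c : ℕ) % q = (c' : ℕ) % q := by simpa using h3
        apply Fin.ext
        rw [← Nat.div_add_mod (c : ℕ) q, ← Nat.div_add_mod (c' : ℕ) q, h1, h2, h3])
      (fun u _ => bpos_lt hm s u)
      (fun u u' _ h1 h2 => bpos_inj s u u' h1 h2)
      (fun u _ k hk => bpos_cont s u k hk) ι1 hi1
    refine ⟨L1 ++ L2, ι2, ?_, hi2, fun f hf θ => ?_⟩
    · rw [List.length_append, Nat.succ_mul]; omega
    · rw [nrun_append]
      exact sg_chain (hs1 f hf θ) (hs2 _ (nrun_inj L1 f hf) θ)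
        (fun c => by constructor <;> intro h <;> omega) (fun c h h' => by omega)

lemma pass_one (φ : Fin q → X → V) (hφ : ∀ i x j y, φ i x = φ j y → i = j ∧ x = y)
    (hadj : ∀ i x y, H.Adj x y → G.Adj (φ i x) (φ i y)) (πH : X ≃ Fin m) (LH : List (NStage H))
    (hLH : ∀ g : X → ℕ, Function.Injective g → ∀ x y, πH x < πH y → nrun LH g x < nrun LH g y)
    (R : ℕ) (hR : ∀ ρ : Equiv.Perm V, ∃ L : List (NStage G), L.length ≤ R ∧ ∀ f v, nrun L f (ρ v) = f v)
    {N h : ℕ} (hq : 0 < q) (hm : 2 * h ≤ m) (s : CStage (Fin N))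
    (ι : V → Fin N × Fin h) (hι : Function.Injective ι) :
    ∃ (L : List (NStage G)) (ι' : V → Fin N × Fin h), L.length ≤ (N / q + 1) * (R + LH.length) ∧
      Function.Injective ι' ∧
      ∀ f : V → ℕ, Function.Injective f → ∀ θ,
        SG (fun _ => True) (fun u : Fin N × Fin h => own s u.1) (bpos s)
          (thr ι f θ) (thr ι' (nrun L f) θ) := by
  obtain ⟨L, ι', h1, h2, h3⟩ := pass_rounds φ hφ hadj πH LH hLH R hR hq hm s ι hι (N / q + 1)
  refine ⟨L, ι', h1, h2, fun f hf θ => ?_⟩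
  have h4 := h3 f hf θ
  have h5 : (fun w : Fin N => (w : ℕ) / q < N / q + 1) = fun _ => True := by
    funext w
    have : (w : ℕ) / q ≤ N / q := Nat.div_le_div_right w.2.le
    simp only [eq_iff_iff, iff_true]; omega
  rw [h5] at h4
  exact h4

lemma pass_list (φ : Fin q → X → V) (hφ : ∀ i x j y, φ i x = φ j y → i = j ∧ x = y)
    (hadj : ∀ i x y, H.Adj x y → G.Adj (φ i x) (φ i y)) (πH : X ≃ Fin m) (LH : List (NStage H))
    (hLH : ∀ g : X → ℕ, Function.Injective g → ∀ x y, πH x < πH y → nrun LH g x < nrun LH g y)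
    (R : ℕ) (hR : ∀ ρ : Equiv.Perm V, ∃ L : List (NStage G), L.length ≤ R ∧ ∀ f v, nrun L f (ρ v) = f v)
    {N h : ℕ} (hq : 0 < q) (hm : 2 * h ≤ m) (hh : 0 < h) (S : List (CStage (Fin N)))
    (ι : V → Fin N × Fin h) (hι : Function.Injective ι) :
    ∃ (L : List (NStage G)) (ι' : V → Fin N × Fin h),
      L.length ≤ S.length * ((N / q + 1) * (R + LH.length)) ∧ Function.Injective ι' ∧
      ∀ f : V → ℕ, Function.Injective f → ∀ θ r', Sel (thr ι' (nrun L f) θ) r' →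
        ∃ r, crun S r = r' := by
  suffices hsuf : ∃ (L : List (NStage G)) (ι' : V → Fin N × Fin h),
      L.length ≤ S.length * ((N / q + 1) * (R + LH.length)) ∧ Function.Injective ι' ∧
      ∀ f : V → ℕ, Function.Injective f → ∀ θ r', Sel (thr ι' (nrun L f) θ) r' →
        ∃ r, Sel (thr ι f θ) r ∧ crun S r = r' by
    obtain ⟨L, ι', h1, h2, h3⟩ := hsuf
    refine ⟨L, ι', h1, h2, fun f hf θ r' hr => ?_⟩
    obtain ⟨r, -, h⟩ := h3 f hf θ r' hr
    exact ⟨r, h⟩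
  induction S generalizing ι with
  | nil => exact ⟨[], ι, by simp, hι, fun f hf θ r' hr => ⟨r', hr, rfl⟩⟩
  | cons s S ih =>
    obtain ⟨L1, ι1, hl1, hi1, hs1⟩ := pass_one φ hφ hadj πH LH hLH R hR hq hm s ι hι
    obtain ⟨L2, ι2, hl2, hi2, hs2⟩ := ih ι1 hi1
    refine ⟨L1 ++ L2, ι2, ?_, hi2, fun f hf θ r' hr => ?_⟩
    · rw [List.length_append, List.length_cons, Nat.succ_mul]; omega
    · rw [nrun_append] at hr
      obtain ⟨r1, h1, h2⟩ := hs2 _ (nrun_inj L1 f hf) θ r' hr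
      obtain ⟨r, h3, h4⟩ := block_lemma hh s _ _ (hs1 f hf θ) r1 h1
      exact ⟨r, h3, by rw [crun_cons, h4, h2]⟩

lemma exists_order (key : V → ℕ) (hkey : Function.Injective key) :
    ∃ π : V ≃ Fin (Fintype.card V), ∀ u w, π u < π w → key u < key w := by
  let _ : LinearOrder V := LinearOrder.lift' key hkey
  let e : V ≃o Fin (Fintype.card V) := (Fintype.orderIsoFinOfCardEq V rfl).symm
  refine ⟨e.toEquiv, fun u w h => ?_⟩
  have h1 : u < w := e.lt_iff_lt.mp h
  exact h1

theorem par_sort (φ : Fin q → X → V) (hφ : ∀ i x j y, φ i x = φ j y → i = j ∧ x = y)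
    (hadj : ∀ i x y, H.Adj x y → G.Adj (φ i x) (φ i y)) (πH : X ≃ Fin m) (LH : List (Stage H))
    (hLH : IsSortingNetwork H πH LH)
    (R : ℕ) (hR : ∀ ρ : Equiv.Perm V, ∃ L : List (NStage G), L.length ≤ R ∧ ∀ f v, nrun L f (ρ v) = f v)
    {N h : ℕ} (hq : 0 < q) (hm : 2 * h ≤ m) (hh : 0 < h) (hN : Fintype.card V ≤ N * h)
    (S : List (CStage (Fin N))) (l : Fin N ≃ Fin N)
    (hS : ∀ (b : Fin N → Bool) w w', l w ≤ l w' → crun S b w ≤ crun S b w') :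
    ∃ π : V ≃ Fin (Fintype.card V), ∃ L : List (Stage G), IsSortingNetwork G π L ∧
      L.length ≤ (S.length + 1) * ((N / q + 1) * (R + LH.length)) := by
  classical
  obtain ⟨LN, hLN, hrunN⟩ := exists_nlist LH
  have hLN2 : ∀ g : X → ℕ, Function.Injective g → ∀ x y, πH x < πH y → nrun LN g x < nrun LN g y := by
    intro g hg x y hxy
    rw [hrunN]; exact hLH g hg x y hxy
  obtain ⟨ι⟩ : Nonempty (V ↪ Fin N × Fin h) := Function.Embedding.nonempty_of_card_le (by simpa using hN)
  obtain ⟨L1, ι1, hl1, hi1, hs1⟩ := pass_list φ hφ hadj πH LN hLN2 R hR hq hm hh S ι ι.injective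
  obtain ⟨L2, ι2, hl2, hi2, hs2⟩ := pass_one φ hφ hadj πH LN hLN2 R hR hq hm (idStage (Fin N)) ι1 hi1
  let key : V → ℕ := fun v => (l (ι2 v).1 : ℕ) * h + (ι2 v).2
  have hkey : Function.Injective key := by
    intro v v' e
    have e : (l (ι2 v).1 : ℕ) * h + (ι2 v).2 = (l (ι2 v').1 : ℕ) * h + (ι2 v').2 := e
    have l1 := (ι2 v).2.2
    have l2 := (ι2 v').2.2
    have d1 : ((l (ι2 v).1 : ℕ) * h + (ι2 v).2) / h = l (ι2 v).1 := by
      rw [mul_comm, Nat.mul_add_div hh, Nat.div_eq_of_lt l1, add_zero]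
    have d2 : ((l (ι2 v').1 : ℕ) * h + (ι2 v').2) / h = l (ι2 v').1 := by
      rw [mul_comm, Nat.mul_add_div hh, Nat.div_eq_of_lt l2, add_zero]
    have h1 : l (ι2 v).1 = l (ι2 v').1 := Fin.ext (by rw [← d1, e, d2])
    have h2 : (ι2 v).1 = (ι2 v').1 := l.injective h1
    rw [h1] at e
    exact hi2 (Prod.ext h2 (Fin.ext (by omega)))
  obtain ⟨π, hπ⟩ := exists_order key hkey
  obtain ⟨L, hL, hrun⟩ := exists_slist (L1 ++ L2)
  refine ⟨π, L, ?_, ?_⟩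
  swap
  · rw [hL, List.length_append, Nat.succ_mul, ← hLN]; omega
  intro f hf v v' hvv
  rw [hrun, nrun_append]
  have hk : (l (ι2 v).1 : ℕ) * h + (ι2 v).2 < (l (ι2 v').1 : ℕ) * h + (ι2 v').2 := hπ _ _ hvv
  have hf1 := nrun_inj L1 f hf
  have hf2 := nrun_inj L2 _ hf1
  have mono : ∀ θ, thr ι2 (nrun L2 (nrun L1 f)) θ (ι2 v) ≤ thr ι2 (nrun L2 (nrun L1 f)) θ (ι2 v') := by
    intro θ
    have hsg := hs2 _ hf1 θ
    set g2 := thr ι2 (nrun L2 (nrun L1 f)) θ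
    by_cases hw : (ι2 v).1 = (ι2 v').1
    · apply hsg.srt _ _ trivial
      · simp only [hw]
      · rw [hw] at hk
        simp only [bpos, own, idStage, if_true]
        omega
    · have hlt : l (ι2 v).1 ≤ l (ι2 v').1 := by
        by_contra hc
        rw [not_le, Fin.lt_def] at hc
        have l1 := (ι2 v).2.2
        have l2 := (ι2 v').2.2
        have : ((l (ι2 v').1 : ℕ) + 1) * h ≤ (l (ι2 v).1 : ℕ) * h := Nat.mul_le_mul_right _ hc
        rw [Nat.succ_mul] at this
        omega
      let r' : Fin N → Bool := fun w => if w = (ι2 v).1 then g2 (ι2 v) else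
        if w = (ι2 v').1 then g2 (ι2 v') else g2 (w, ⟨0, hh⟩)
      have hr' : Sel g2 r' := by
        intro w
        by_cases h1 : w = (ι2 v).1
        · exact ⟨(ι2 v).2, by simp only [r', h1, if_true]⟩
        · by_cases h2 : w = (ι2 v').1
          · exact ⟨(ι2 v').2, by simp only [r', h2, if_neg (Ne.symm hw), if_true]⟩
          · exact ⟨⟨0, hh⟩, by simp only [r', if_neg h1, if_neg h2]⟩
      obtain ⟨r1, h1, h2⟩ := block_lemma hh _ _ _ hsg r' hr'
      have h3 : (idStage (Fin N)).apply r1 = r1 := by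
        have := crun_replicate_id (W := Fin N) 1 r1
        exact this
      rw [h3] at h2
      subst h2
      obtain ⟨r, hr⟩ := hs1 f hf θ _ h1
      have h4 := hS r _ _ hlt
      rw [hr] at h4
      simpa only [r', if_true, if_neg (Ne.symm hw)] using h4
  by_contra hcon
  have hne : v ≠ v' := by rintro rfl; exact lt_irrefl _ hvv
  have hlt : nrun L2 (nrun L1 f) v' < nrun L2 (nrun L1 f) v :=
    lt_of_le_of_ne (not_lt.mp hcon) (fun e => hne (hf2 e).symm)
  have h1 := mono (nrun L2 (nrun L1 f) v)
  rw [(thr_false _ _ _ _).mpr ⟨v', rfl, hlt⟩] at h1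
  have h2 : thr ι2 (nrun L2 (nrun L1 f)) (nrun L2 (nrun L1 f) v) (ι2 v) = false := by
    revert h1
    cases thr ι2 (nrun L2 (nrun L1 f)) (nrun L2 (nrun L1 f) v) (ι2 v) <;> decide
  obtain ⟨v2, e, hv2⟩ := (thr_false _ _ _ _).mp h2
  rw [hi2 e] at hv2
  exact lt_irrefl _ hv2

end main
end AKS

namespace AKS

lemma routes_mul {G : SimpleGraph V} {σ τ : Equiv.Perm V} (h1 : ∃ t, RoutesIn G σ t) (h2 : ∃ t, RoutesIn G τ t) :
    ∃ t, RoutesIn G (σ * τ) t := by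
  obtain ⟨_, L1, -, a1, b1⟩ := h1
  obtain ⟨_, L2, -, a2, b2⟩ := h2
  refine ⟨_, L2 ++ L1, rfl, ?_, ?_⟩
  · intro ρ hρ
    rcases List.mem_append.mp hρ with h | h
    · exact a2 ρ h
    · exact a1 ρ h
  · intro v
    have : finalPos (L2 ++ L1) v = finalPos L1 (finalPos L2 v) := by
      simp [finalPos, List.foldl_append]
    rw [this, b2, b1]; rfl

lemma routes_one (G : SimpleGraph V) : ∃ t, RoutesIn G 1 t :=
  ⟨0, [], rfl, by simp, fun v => rfl⟩

lemma routes_adj [DecidableEq V] {G : SimpleGraph V} {a b : V} (h : G.Adj a b) :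
    ∃ t, RoutesIn G (Equiv.swap a b) t := by
  refine ⟨1, [Equiv.swap a b], rfl, ?_, fun v => rfl⟩
  intro τ hτ
  rw [List.mem_singleton] at hτ
  subst hτ
  refine ⟨fun v => Equiv.swap_apply_self a b v, fun v hv => ?_⟩
  rcases Equiv.swap_apply_ne_self_iff.mp hv with ⟨-, rfl | rfl⟩
  · rw [Equiv.swap_apply_left]; exact h
  · rw [Equiv.swap_apply_right]; exact h.symm

lemma routes_walk [DecidableEq V] {G : SimpleGraph V} {a b : V} (p : G.Walk a b) :
    ∃ t, RoutesIn G (Equiv.swap a b) t := by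
  induction p with
  | nil => rw [Equiv.swap_self]; exact routes_one G
  | @cons a b c h p ih =>
    by_cases hac : a = c
    · subst hac; rw [Equiv.swap_self]; exact routes_one G
    · by_cases hbc : b = c
      · subst hbc; exact routes_adj h
      · have := Equiv.swap_mul_swap_mul_swap (x := c) (y := b) (z := a) (Ne.symm hbc) (Ne.symm hac)
        rw [← this]
        have h2 : ∃ t, RoutesIn G (Equiv.swap b a) t := by rw [Equiv.swap_comm]; exact routes_adj h
        have h3 : ∃ t, RoutesIn G (Equiv.swap c b) t := by rw [Equiv.swap_comm]; exact ih
        exact routes_mul (routes_mul h2 h3) h2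

lemma routes_all [Fintype V] [DecidableEq V] {G : SimpleGraph V} (hG : G.Connected) (ρ : Equiv.Perm V) :
    ∃ t, RoutesIn G ρ t := by
  induction ρ using Equiv.Perm.swap_induction_on with
  | one => exact routes_one G
  | swap_mul f x y _ ih =>
    obtain ⟨p⟩ := hG.preconnected x y
    exact routes_mul (routes_walk p) ih

lemma route_rt [Fintype V] [DecidableEq V] {G : SimpleGraph V} (hG : G.Connected) (ρ : Equiv.Perm V) :
    ∃ L : List (NStage G), L.length ≤ rt G ∧ ∀ f v, nrun L f (ρ v) = f v := by
  have h1 : RoutesIn G ρ (rtP G ρ) := Nat.sInf_mem (s := {t | RoutesIn G ρ t}) (routes_all hG ρ)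
  obtain ⟨P, h2, h3, h4⟩ := h1
  obtain ⟨L, h5, h6⟩ := exists_route P h3
  refine ⟨L, ?_, fun f v => ?_⟩
  · rw [h5, h2]
    exact Finset.le_sup (f := fun σ => rtP G σ) (mem_univ ρ)
  · rw [← h4, h6]

lemma sort_two : ∃ L : List (Stage (⊤ : SimpleGraph (Fin 2))), IsSortingNetwork ⊤ (Equiv.refl (Fin 2)) L := by
  let s : Stage (⊤ : SimpleGraph (Fin 2)) :=
    { pairs := {((0 : Fin 2), (1 : Fin 2))}
      adj := by
        intro p hp
        rw [mem_singleton] at hp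
        subst hp
        simp
      directed := fun _ => true
      disj := by
        intro p hp q hq hne
        rw [mem_singleton] at hp hq
        exact absurd (hp.trans hq.symm) hne }
  refine ⟨[s], fun f hf u w huw => ?_⟩
  have hmem : ((0 : Fin 2), (1 : Fin 2)) ∈ s.pairs := mem_singleton_self _
  have h0 := stage_apply_fst s f _ hmem
  have h1 := stage_apply_snd s f _ hmem
  have hd : s.directed ((0 : Fin 2), (1 : Fin 2)) = true := rfl
  rw [if_pos hd] at h0 h1
  have huw : u < w := huw
  have hu : u = 0 := by omega
  have hw : w = 1 := by omega
  subst hu hw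
  change s.apply f 0 < s.apply f 1
  have hne : f 0 ≠ f 1 := fun e => by have := hf e; simp at this
  simp only at h0 h1
  rw [h0, h1]
  omega

lemma sort_exists [Fintype V] {G : SimpleGraph V} (hG : G.Connected) (hV : 2 ≤ Fintype.card V) :
    ∃ π : V ≃ Fin (Fintype.card V), ∃ L : List (Stage G), L.length = st G ∧ IsSortingNetwork G π L := by
  classical
  have hne : {t | ∃ π : V ≃ Fin (Fintype.card V), ∃ L : List (Stage G),
      L.length = t ∧ IsSortingNetwork G π L}.Nonempty := by
    obtain ⟨c, hc⟩ := aks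
    obtain ⟨S, -, l, hl⟩ := hc (Fintype.card V + 2) (by omega)
    obtain ⟨L2, hL2⟩ := sort_two
    have : Nontrivial V := Fintype.one_lt_card_iff_nontrivial.mp hV
    obtain ⟨a⟩ := hG.nonempty
    obtain ⟨b, hab⟩ := hG.preconnected.exists_adj_of_nontrivial a
    obtain ⟨π, L, h1, -⟩ := par_sort (q := 1) (m := 2) (h := 1) (fun _ (x : Fin 2) => if x = 0 then a else b)
      (by
        intro i x j y e
        refine ⟨Subsingleton.elim _ _, ?_⟩
        by_cases hx : x = 0 <;> by_cases hy : y = 0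
        · rw [hx, hy]
        · rw [if_pos hx, if_neg hy] at e; exact absurd e hab.ne
        · rw [if_neg hx, if_pos hy] at e; exact absurd e hab.ne.symm
        · omega)
      (by
        intro i x y hxy
        have hxy : x ≠ y := hxy.ne
        by_cases hx : x = 0 <;> by_cases hy : y = 0
        · exact absurd (hx.trans hy.symm) hxy
        · rw [if_pos hx, if_neg hy]; exact hab
        · rw [if_neg hx, if_pos hy]; exact hab.symm
        · exact absurd (by omega) hxy)
      (Equiv.refl (Fin 2)) L2 hL2 (rt G) (route_rt hG) (by omega) (by omega) (by omega)
      (by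
        have := Nat.lt_two_pow_self (n := Fintype.card V + 2)
        omega) S l hl
    exact ⟨_, π, L, rfl, h1⟩
  exact Nat.sInf_mem hne

lemma half_bound {c : ℕ} (hc : ∀ K, 2 ≤ K → ∃ L : List (CStage (Fin (2 ^ K))), L.length ≤ c * K ∧
      ∃ l : Fin (2 ^ K) ≃ Fin (2 ^ K), ∀ (b : Fin (2 ^ K) → Bool) w w', l w ≤ l w' → crun L b w ≤ crun L b w')
    {X : Type*} [Fintype V] [DecidableEq V] [Fintype X] {G : SimpleGraph V} {H : SimpleGraph X}
    (hG : G.Connected) (hH : H.Connected) {q : ℕ} (hq : 2 ≤ q) (hX : 2 ≤ Fintype.card X)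
    (hV : Fintype.card V = q * Fintype.card X)
    (φ : Fin q → X → V) (hφ : ∀ i x j y, φ i x = φ j y → i = j ∧ x = y)
    (hadj : ∀ i x y, H.Adj x y → G.Adj (φ i x) (φ i y)) :
    (st G : ℝ) ≤ (48 * (c + 1) : ℝ) * (Real.log q * ((rt G : ℝ) + (st H : ℝ))) := by
  obtain ⟨πH, LH, hlen, hsort⟩ := sort_exists hH hX
  set K := Nat.clog 2 (3 * q) with hK
  have k1 : 3 * q ≤ 2 ^ K := Nat.le_pow_clog (by omega) _
  have k2 : 2 ^ (K - 1) < 3 * q := Nat.pow_pred_clog_lt_self (by omega) (by omega)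
  have k3 : 2 ≤ K := by
    by_contra hcon
    have : 2 ^ K ≤ 2 ^ 1 := Nat.pow_le_pow_right (by omega) (by omega)
    omega
  have k4 : 2 ^ K < 6 * q := by
    have : 2 ^ K = 2 ^ (K - 1) * 2 := by rw [← pow_succ]; congr 1; omega
    omega
  obtain ⟨S, hS1, l, hl⟩ := hc K k3
  obtain ⟨π, L, hL1, hL2⟩ := par_sort (h := Fintype.card X / 2) φ hφ hadj πH LH hsort (rt G) (route_rt hG)
    (by omega) (by omega) (by omega)
    (by
      rw [hV]
      have h3 : Fintype.card X ≤ 3 * (Fintype.card X / 2) := by omega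
      calc q * Fintype.card X ≤ q * (3 * (Fintype.card X / 2)) := Nat.mul_le_mul_left _ h3
        _ = (3 * q) * (Fintype.card X / 2) := by ring
        _ ≤ _ := Nat.mul_le_mul_right _ k1) S l hl
  have hst : st G ≤ L.length := Nat.sInf_le ⟨π, L, rfl, hL1⟩
  have hdiv : 2 ^ K / q + 1 ≤ 6 := by
    have : 2 ^ K / q < 6 := by rw [Nat.div_lt_iff_lt_mul (by omega)]; exact k4
    omega
  have hnat : st G ≤ ((c + 1) * K) * (6 * (rt G + st H)) := by
    refine hst.trans (hL2.trans ?_)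
    rw [hlen]
    apply Nat.mul_le_mul
    · rw [Nat.succ_mul]; omega
    · exact Nat.mul_le_mul_right _ hdiv
  have hlog : (K : ℝ) ≤ 8 * Real.log q := by
    have h1 : 2 ^ K ≤ q ^ 4 := by
      have h8 : 2 ^ 3 ≤ q ^ 3 := Nat.pow_le_pow_left hq 3
      have : q ^ 4 = q ^ 3 * q := by ring
      nlinarith
    have h2 : ((2 : ℝ)) ^ K ≤ (q : ℝ) ^ 4 := by exact_mod_cast h1
    have h3 := Real.log_le_log (by positivity) h2
    rw [Real.log_pow, Real.log_pow] at h3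
    have h4 := Real.log_two_gt_d9
    have h5 : (0 : ℝ) ≤ K := Nat.cast_nonneg _
    push_cast at h3
    nlinarith
  have hreal : (st G : ℝ) ≤ (((c : ℝ) + 1) * K) * (6 * ((rt G : ℝ) + st H)) := by exact_mod_cast hnat
  have h0 : (0 : ℝ) ≤ (c + 1) * (6 * ((rt G : ℝ) + st H)) := by positivity
  calc (st G : ℝ) ≤ (((c : ℝ) + 1) * K) * (6 * ((rt G : ℝ) + st H)) := hreal
    _ = ((c + 1) * (6 * ((rt G : ℝ) + st H))) * K := by ring
    _ ≤ ((c + 1) * (6 * ((rt G : ℝ) + st H))) * (8 * Real.log q) := mul_le_mul_of_nonneg_left hlog h0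
    _ = _ := by ring

end AKS

/-- for the Cartesian product `G = G₁ □ G₂`,
`st(G) = O(min(log|V₁| (rt(G) + st(G₂)), log|V₂| (rt(G) + st(G₁))))`. -/
theorem stmt17 :
    ∃ C : ℝ, 0 < C ∧ ∀ (n₁ n₂ : ℕ) (G₁ : SimpleGraph (Fin n₁))
      (G₂ : SimpleGraph (Fin n₂)), G₁.Connected → G₂.Connected →
      2 ≤ n₁ → 2 ≤ n₂ →
      (st (G₁ □ G₂) : ℝ) ≤
        C * min (Real.log n₁ * ((rt (G₁ □ G₂) : ℝ) + (st G₂ : ℝ)))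
                (Real.log n₂ * ((rt (G₁ □ G₂) : ℝ) + (st G₁ : ℝ))) := by
  obtain ⟨c, hc⟩ := AKS.aks
  refine ⟨48 * (c + 1), by positivity, ?_⟩
  intro n₁ n₂ G₁ G₂ hG₁ hG₂ h1 h2
  have hG : (G₁ □ G₂).Connected := hG₁.boxProd hG₂
  have hpos : (0 : ℝ) ≤ 48 * (c + 1) := by positivity
  rw [mul_min_of_nonneg _ _ hpos]
  apply le_min
  · refine AKS.half_bound hc hG hG₂ h1 (by simpa using h2) (by simp) (fun i x => (i, x)) ?_ ?_
    · intro i x j y e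
      simpa using e
    · intro i x y hxy
      exact SimpleGraph.boxProd_adj_right.mpr hxy
  · refine AKS.half_bound hc hG hG₁ h2 (by simpa using h1) (by simp [mul_comm]) (fun i x => (x, i)) ?_ ?_
    · intro i x j y e
      simp only [Prod.mk.injEq] at e
      exact ⟨e.2, e.1⟩
    · intro i x y hxy
      exact SimpleGraph.boxProd_adj_left.mpr hxy
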